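/- Halász's Theorem for short intervals: For every κ > 0 there is a constant C = C(κ) > 0 such that for all f in the class C(κ), all real x ≥ C and all δ with 0 < δ < 1/4, one has |∑_{x < n ≤ x + x^{1−δ}} f(n)| ≤ C · (x^{1−δ}/log x) · ( ∫_{1/log x}^{1} ( max_{|t| ≤ (1/2)·x^δ·(log x)^κ} |F(1+σ+it)| ) dσ/σ + (δ·log x + log log x)^κ ). -/

import Mathlib

open Complex MeasureTheory
open scoped Classical

noncomputable section

/-- Membership of `f` in the class `C(κ)`, witnessed by `Λf`. -/
structure IsHalaszClass (κ : ℝ) (f : ℕ → ℂ) (Λf : ℕ → ℂ) : Prop where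
  map_one : f 1 = 1
  mult : ∀ m n : ℕ, Nat.Coprime m n → f (m * n) = f m * f n
  supp : ∀ n : ℕ, ¬ IsPrimePow n → Λf n = 0
  bound : ∀ n : ℕ, 1 ≤ n → ‖Λf n‖ ≤ κ * ArithmeticFunction.vonMangoldt n
  conv : ∀ n : ℕ, 1 ≤ n →
    f n * (Real.log n : ℂ) = ∑ d ∈ n.divisors, Λf d * f (n / d)
  abs_conv : ∀ σ : ℝ, 1 < σ → Summable (fun n : ℕ => ‖f n‖ / (n : ℝ) ^ σ)

/-- The Dirichlet series `F(s) = ∑ f(n) n^{-s}`. -/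
def Fser (f : ℕ → ℂ) (s : ℂ) : ℂ := ∑' n : ℕ, f n / (n : ℂ) ^ s

namespace HalaszShort
open Finset
open scoped ArithmeticFunction.vonMangoldt

lemma sum_vonMangoldt_le (N : ℕ) : ∑ n ∈ Ioc 0 N, Λ n ≤ 6 * N := by
  have h := Chebyshev.psi_le_const_mul_self (x := N) (by positivity)
  rw [Chebyshev.psi, Nat.floor_natCast] at h
  have h4 : Real.log 4 ≤ 2 := by
    have : Real.log 4 = 2 * Real.log 2 := by
      rw [show (4 : ℝ) = 2 ^ 2 by norm_num, Real.log_pow]; norm_num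
    have := Real.log_two_lt_d9
    linarith
  refine h.trans ?_
  gcongr
  linarith

lemma sum_vonMangoldt_div_le {N : ℕ} (hN : 1 ≤ N) :
    ∑ n ∈ Ioc 0 N, Λ n / n ≤ Real.log N + 6 := by
  have hN0 : (0 : ℝ) < N := by exact_mod_cast hN
  have key : ∑ n ∈ Ioc 0 N, Real.log n = ∑ d ∈ Ioc 0 N, Λ d * (N / d : ℕ) := by
    have := ArithmeticFunction.sum_Ioc_mul_zeta_eq_sum (R := ℝ) Λ N
    rw [ArithmeticFunction.vonMangoldt_mul_zeta] at this
    simpa using this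
  have h1 : ∑ n ∈ Ioc 0 N, Real.log n ≤ N * Real.log N := by
    calc ∑ n ∈ Ioc 0 N, Real.log n ≤ ∑ n ∈ Ioc 0 N, Real.log N := by
          refine sum_le_sum fun n hn => ?_
          rw [mem_Ioc] at hn
          exact Real.log_le_log (by exact_mod_cast hn.1) (by exact_mod_cast hn.2)
      _ = N * Real.log N := by simp
  have h2 : N * ∑ n ∈ Ioc 0 N, Λ n / n ≤ ∑ d ∈ Ioc 0 N, (Λ d * (N / d : ℕ) + Λ d) := by
    rw [mul_sum]
    refine sum_le_sum fun d hd => ?_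
    rw [mem_Ioc] at hd
    have hd0 : (0 : ℝ) < d := by exact_mod_cast hd.1
    have : (N : ℝ) / d ≤ (N / d : ℕ) + 1 := by
      rw [div_le_iff₀ hd0]
      have := (Nat.lt_div_mul_add (a := N) hd.1).le
      have h : (N : ℝ) ≤ ((N / d : ℕ) : ℝ) * d + d := by exact_mod_cast this
      linarith
    calc (N : ℝ) * (Λ d / d) = Λ d * (N / d) := by ring
      _ ≤ Λ d * ((N / d : ℕ) + 1) := by
        gcongr
      _ = _ := by ring
  rw [sum_add_distrib, ← key] at h2
  have h3 := sum_vonMangoldt_le N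
  have : N * ∑ n ∈ Ioc 0 N, Λ n / n ≤ N * (Real.log N + 6) := by linarith
  exact le_of_mul_le_mul_left this hN0

/-- Geometric summation over the level sets of `i`. -/
lemma sum_mul_le_of_levels {S : Finset ℕ} {i : ℕ → ℕ} {a w : ℕ → ℝ} {r K : ℝ}
    (ha : ∀ k ∈ S, 0 ≤ a k) (hr0 : 0 ≤ r) (hr : r < 1)
    (hK : ∀ j, ∑ k ∈ S with i k = j, a k ≤ K) (hw : ∀ k ∈ S, w k ≤ r ^ i k) :
    ∑ k ∈ S, a k * w k ≤ K / (1 - r) := by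
  have hK0 : 0 ≤ K := (sum_nonneg fun k hk => ha k (mem_filter.1 hk).1).trans (hK 0)
  set J := S.image i
  calc ∑ k ∈ S, a k * w k ≤ ∑ k ∈ S, a k * r ^ i k := by
        refine sum_le_sum fun k hk => ?_
        exact mul_le_mul_of_nonneg_left (hw k hk) (ha k hk)
    _ = ∑ j ∈ J, ∑ k ∈ S with i k = j, a k * r ^ i k :=
        (sum_fiberwise_of_maps_to (fun k hk => mem_image_of_mem i hk) _).symm
    _ ≤ ∑ j ∈ J, K * r ^ j := by
        refine sum_le_sum fun j _ => ?_
        rw [sum_congr rfl (g := fun k => a k * r ^ j)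
          (fun k hk => by rw [(mem_filter.1 hk).2]), ← sum_mul]
        gcongr
        exact hK j
    _ = K * ∑ j ∈ J, r ^ j := by rw [mul_sum]
    _ ≤ K * (1 - r)⁻¹ := by
        gcongr
        rw [← tsum_geometric_of_lt_one hr0 hr]
        exact (summable_geometric_of_lt_one hr0 hr).sum_le_tsum _ (fun _ _ => by positivity)
    _ = K / (1 - r) := by rw [div_eq_mul_inv]

/-- The contribution of a dyadic block to `∑ Λ(n)/n`. -/
lemma sum_vonMangoldt_div_block_le {S : Finset ℕ} {M : ℝ} (hM : 0 < M)
    (hS : ∀ n ∈ S, M ≤ n ∧ (n : ℝ) ≤ 4 * M) : ∑ n ∈ S, Λ n / n ≤ 24 := by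
  have hsub : S ⊆ Ioc 0 ⌊4 * M⌋₊ := fun n hn => by
    have := hS n hn
    rw [mem_Ioc]
    exact ⟨by exact_mod_cast hM.trans_le this.1, Nat.le_floor this.2⟩
  calc ∑ n ∈ S, Λ n / n ≤ ∑ n ∈ S, Λ n / M := by
        refine sum_le_sum fun n hn => ?_
        have := (hS n hn).1
        gcongr
    _ = (∑ n ∈ S, Λ n) / M := by rw [sum_div]
    _ ≤ (∑ n ∈ Ioc 0 ⌊4 * M⌋₊, Λ n) / M := by
        gcongr
    _ ≤ (6 * (4 * M)) / M := by
        gcongr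
        refine (sum_vonMangoldt_le _).trans ?_
        gcongr
        exact Nat.floor_le (by positivity)
    _ = 24 := by field_simp; norm_num

lemma one_sub_two_rpow_neg {μ : ℝ} (h0 : 0 < μ) (h1 : μ ≤ 1) :
    μ / 2 ≤ 1 - (2 : ℝ) ^ (-μ) := by
  have hb := rpow_one_add_le_one_add_mul_self (s := -1 / 2) (p := μ) (by norm_num) h0.le h1
  have : (2 : ℝ) ^ (-μ) = (1 + -1 / 2) ^ μ := by
    rw [show (1 + -1 / 2 : ℝ) = 2⁻¹ by norm_num, Real.inv_rpow (by norm_num),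
      Real.rpow_neg (by norm_num)]
  rw [this]
  linarith

lemma sum_vonMangoldt_rpow_le {S : Finset ℕ} {μ : ℝ} (h0 : 0 < μ) (h1 : μ ≤ 1)
    (hS : ∀ n ∈ S, 1 ≤ n) : ∑ n ∈ S, Λ n / n * (n : ℝ) ^ (-μ) ≤ 48 / μ := by
  have hr : (2 : ℝ) ^ (-μ) < 1 := by
    have := one_sub_two_rpow_neg h0 h1
    linarith
  refine (sum_mul_le_of_levels (i := fun n => Nat.log 2 n) (K := 24) (r := 2 ^ (-μ))
    (fun k _ => div_nonneg ArithmeticFunction.vonMangoldt_nonneg (by positivity))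
    (by positivity) hr ?_ ?_).trans ?_
  · intro j
    refine sum_vonMangoldt_div_block_le (M := 2 ^ j) (by positivity) fun n hn => ?_
    rw [mem_filter] at hn
    have hn1 := hS n hn.1
    have h2 := Nat.pow_log_le_self 2 (x := n) (by omega)
    have h3 := Nat.lt_pow_succ_log_self (b := 2) (by norm_num) n
    rw [hn.2] at h2 h3
    constructor
    · exact_mod_cast h2
    · have : (n : ℝ) ≤ 2 ^ (j + 1) := by exact_mod_cast h3.le
      rw [pow_succ] at this
      have : (0 : ℝ) < 2 ^ j := by positivity
      linarith
  · intro n hn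
    have hn1 := hS n hn
    have h2 := Nat.pow_log_le_self 2 (x := n) (by omega)
    rw [← Real.rpow_natCast, ← Real.rpow_mul (by norm_num), mul_comm, Real.rpow_mul (by norm_num)]
    apply Real.rpow_le_rpow_of_nonpos (by positivity) _ (by linarith)
    rw [Real.rpow_natCast]
    exact_mod_cast h2
  · rw [div_le_div_iff₀ (by linarith) h0]
    linarith [one_sub_two_rpow_neg h0 h1]

lemma sum_vonMangoldt_rpow_top_le {S : Finset ℕ} {μ X : ℝ} (h0 : 0 < μ) (h1 : μ ≤ 1)
    (hS : ∀ n ∈ S, 1 ≤ n ∧ (n : ℝ) ≤ X) : ∑ n ∈ S, Λ n / n * ((n : ℝ) / X) ^ μ ≤ 48 / μ := by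
  have hr : (2 : ℝ) ^ (-μ) < 1 := by
    have := one_sub_two_rpow_neg h0 h1
    linarith
  have aux : ∀ n ∈ S, (2 : ℝ) ^ Nat.log 2 ⌊X / n⌋₊ ≤ X / n ∧
      X / n ≤ 2 * 2 ^ Nat.log 2 ⌊X / n⌋₊ := by
    intro n hn
    have hn1 := hS n hn
    have hn0 : (0 : ℝ) < n := by exact_mod_cast hn1.1
    have h1 : 1 ≤ X / n := by rw [one_le_div hn0]; exact hn1.2
    have hf : 1 ≤ ⌊X / n⌋₊ := by rwa [Nat.one_le_floor_iff]
    have h2 := Nat.pow_log_le_self 2 (x := ⌊X / n⌋₊) (by omega)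
    have h3 := Nat.lt_pow_succ_log_self (b := 2) (by norm_num) ⌊X / n⌋₊
    constructor
    · calc ((2 : ℝ) ^ Nat.log 2 ⌊X / n⌋₊) ≤ ⌊X / n⌋₊ := by exact_mod_cast h2
        _ ≤ _ := Nat.floor_le (by linarith)
    · have h4 : X / n < ⌊X / n⌋₊ + 1 := Nat.lt_floor_add_one _
      have h5 : (⌊X / n⌋₊ : ℝ) + 1 ≤ 2 ^ (Nat.log 2 ⌊X / n⌋₊ + 1) := by exact_mod_cast h3
      rw [pow_succ] at h5
      linarith
  refine (sum_mul_le_of_levels (i := fun n => Nat.log 2 ⌊X / n⌋₊) (K := 24) (r := 2 ^ (-μ))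
    (fun k _ => div_nonneg ArithmeticFunction.vonMangoldt_nonneg (by positivity))
    (by positivity) hr ?_ ?_).trans ?_
  · intro j
    by_cases hX : 0 < X
    · refine sum_vonMangoldt_div_block_le (M := X / (2 * 2 ^ j)) (by positivity) fun n hn => ?_
      rw [mem_filter] at hn
      have h := aux n hn.1
      rw [hn.2] at h
      have hn0 : (0 : ℝ) < n := by exact_mod_cast (hS n hn.1).1
      constructor
      · rw [div_le_iff₀ hn0] at h
        rw [div_le_iff₀ (by positivity)]
        linarith [h.2]
      · have h1 := h.1
        rw [le_div_iff₀ hn0] at h1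
        rw [← mul_div_assoc, le_div_iff₀ (by positivity)]
        nlinarith [hX]
    · rw [sum_eq_zero]
      · norm_num
      intro n hn
      have := hS n (mem_filter.1 hn).1
      have h1 : (1 : ℝ) ≤ n := by exact_mod_cast this.1
      linarith [this.2]
  · intro n hn
    have h := (aux n hn).1
    have hn0 : (0 : ℝ) < n := by exact_mod_cast (hS n hn).1
    have hX : 0 < X := hn0.trans_le (hS n hn).2
    rw [← Real.rpow_natCast, ← Real.rpow_mul (by norm_num), mul_comm, Real.rpow_mul (by norm_num),
      Real.rpow_neg (by positivity), ← Real.inv_rpow (by positivity), Real.rpow_natCast]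
    apply Real.rpow_le_rpow (by positivity) _ h0.le
    rw [← inv_div X]
    exact inv_anti₀ (by positivity) h
  · rw [div_le_div_iff₀ (by linarith) h0]
    linarith [one_sub_two_rpow_neg h0 h1]

lemma sum_vonMangoldt_div_log_le {N : ℕ} (hN : 2 ≤ N) :
    ∑ n ∈ Ioc 1 N, Λ n / (n * Real.log n) ≤ Real.log (Real.log N) + 12 := by
  have hl2 : (0.69 : ℝ) < Real.log 2 := by linarith [Real.log_two_gt_d9]
  have hS1 : ∀ N : ℕ, 1 ≤ N → ∑ n ∈ Ioc 0 N, Λ n / n = ∑ n ∈ Ioc 1 N, Λ n / (n : ℝ) := by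
    intro N hN
    rw [← sum_Ioc_consecutive _ (Nat.zero_le 1) hN]
    simp
  have hT : ∀ N : ℕ, 2 ≤ N → ∑ n ∈ Ioc 1 N, Λ n / (n * Real.log n)
      - (∑ n ∈ Ioc 0 N, Λ n / n) / Real.log N ≤
      Real.log (Real.log N) - 6 / Real.log N + (6 / Real.log 2 - Real.log (Real.log 2)) := by
    intro N hN
    induction N, hN using Nat.le_induction with
    | base =>
      rw [hS1 2 (by norm_num)]
      have : Ioc 1 2 = {2} := by decide
      rw [this]
      simp only [sum_singleton]
      push_cast
      have : Λ 2 / (2 * Real.log 2) - Λ 2 / 2 / Real.log 2 = 0 := by field_simp; ring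
      linarith
    | succ n hn ih =>
      have h2 : (2 : ℝ) ≤ n := by exact_mod_cast hn
      have hl : 0 < Real.log n := Real.log_pos (by linarith)
      have hl' : Real.log n ≤ Real.log (n + 1 : ℕ) :=
        Real.log_le_log (by linarith) (by push_cast; linarith)
      have hl1 : 0 < Real.log (n + 1 : ℕ) := hl.trans_le hl'
      rw [sum_Ioc_succ_top (by omega), sum_Ioc_succ_top (by omega)]
      have hS := sum_vonMangoldt_div_le (N := n) (by omega)
      set S := ∑ k ∈ Ioc 0 n, Λ k / (k : ℝ)
      set l := Real.log n
      set l' := Real.log (n + 1 : ℕ)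
      have hlog : 1 - l / l' ≤ Real.log l' - Real.log l := by
        rw [← Real.log_div hl1.ne' hl.ne']
        have := Real.one_sub_inv_le_log_of_pos (x := l' / l) (by positivity)
        rwa [inv_div] at this
      have hd : 0 ≤ 1 / l - 1 / l' := by
        rw [sub_nonneg]
        exact one_div_le_one_div_of_le hl hl'
      have e1 : S * (1 / l - 1 / l') ≤ (l + 6) * (1 / l - 1 / l') := by gcongr
      have e2 : (l + 6) * (1 / l - 1 / l') = 1 - l / l' + (6 / l - 6 / l') := by
        field_simp
      have e3 : Λ (n + 1) / ((n + 1 : ℕ) * l') - Λ (n + 1) / (n + 1 : ℕ) / l' = 0 := by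
        rw [div_div, sub_self]
      have e4 : (S + Λ (n + 1) / (n + 1 : ℕ)) / l' = S / l' + Λ (n + 1) / (n + 1 : ℕ) / l' := by
        rw [add_div]
      rw [e4]
      have e5 : S * (1 / l - 1 / l') = S / l - S / l' := by ring
      linarith
  have h2 : (2 : ℝ) ≤ N := by exact_mod_cast hN
  have hl : 0 < Real.log N := Real.log_pos (by linarith)
  have h := hT N hN
  have hS := sum_vonMangoldt_div_le (N := N) (by omega)
  have h1 : (∑ n ∈ Ioc 0 N, Λ n / n) / Real.log N ≤ 1 + 6 / Real.log N := by
    rw [div_le_iff₀ hl]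
    have : (1 + 6 / Real.log N) * Real.log N = Real.log N + 6 := by field_simp
    linarith
  have h3 : 6 / Real.log 2 ≤ 9 := by
    rw [div_le_iff₀ (by linarith)]
    linarith
  have h4 : - Real.log (Real.log 2) ≤ 1 := by
    have := Real.one_sub_inv_le_log_of_pos (x := Real.log 2) (by linarith)
    have h5 : (Real.log 2)⁻¹ ≤ 2 := by
      rw [inv_le_comm₀ (by linarith) (by norm_num)]
      linarith
    linarith
  linarith

section Primes
variable {S : Finset ℕ} {l : ℝ}

lemma le_exp_floor_of_log_le {p : ℕ} (hp : 0 < p) (h : Real.log p ≤ l) : p ≤ ⌊Real.exp l⌋₊ := by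
  apply Nat.le_floor
  rw [← Real.log_le_iff_le_exp (by exact_mod_cast hp)]
  exact h

lemma sum_prime_inv_le (hl : 1 ≤ l) (hS : ∀ p ∈ S, p.Prime ∧ Real.log p ≤ l) :
    ∑ p ∈ S, (1 : ℝ) / p ≤ Real.log l + 12 := by
  set N := ⌊Real.exp l⌋₊
  have hN : 2 ≤ N := Nat.le_floor (by
    have := Real.add_one_le_exp l
    push_cast
    linarith)
  have hN2 : (2 : ℝ) ≤ N := by exact_mod_cast hN
  have hNl : Real.log N ≤ l := by
    rw [Real.log_le_iff_le_exp (by linarith)]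
    exact Nat.floor_le (Real.exp_pos _).le
  have hl0 : 0 < Real.log N := Real.log_pos (by linarith)
  calc ∑ p ∈ S, (1 : ℝ) / p ≤ ∑ p ∈ S, Λ p / (p * Real.log p) := by
        refine sum_le_sum fun p hp => ?_
        have hp' := (hS p hp).1
        have : 0 < Real.log p := Real.log_pos (by exact_mod_cast hp'.one_lt)
        rw [ArithmeticFunction.vonMangoldt_apply_prime hp']
        apply le_of_eq
        field_simp
    _ ≤ ∑ p ∈ Ioc 1 N, Λ p / (p * Real.log p) := by
        refine sum_le_sum_of_subset_of_nonneg (fun p hp => ?_) (fun p _ _ => ?_)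
        · have hp' := (hS p hp).1
          rw [mem_Ioc]
          exact ⟨hp'.one_lt, le_exp_floor_of_log_le hp'.pos (hS p hp).2⟩
        · exact div_nonneg ArithmeticFunction.vonMangoldt_nonneg
            (mul_nonneg (by positivity) (Real.log_natCast_nonneg p))
    _ ≤ Real.log (Real.log N) + 12 := sum_vonMangoldt_div_log_le hN
    _ ≤ Real.log l + 12 := by gcongr

lemma sum_prime_log_div_le (hl : 1 ≤ l) (hS : ∀ p ∈ S, p.Prime ∧ Real.log p ≤ l) :
    ∑ p ∈ S, Real.log p / p ≤ 7 * l := by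
  set N := ⌊Real.exp l⌋₊
  have hN : 1 ≤ N := Nat.le_floor (by
    have := Real.add_one_le_exp l
    push_cast
    linarith)
  have hNl : Real.log N ≤ l := by
    rw [Real.log_le_iff_le_exp (by exact_mod_cast hN)]
    exact Nat.floor_le (Real.exp_pos _).le
  calc ∑ p ∈ S, Real.log p / p = ∑ p ∈ S, Λ p / p := by
        refine sum_congr rfl fun p hp => ?_
        rw [ArithmeticFunction.vonMangoldt_apply_prime (hS p hp).1]
    _ ≤ ∑ p ∈ Ioc 0 N, Λ p / p := by
        refine sum_le_sum_of_subset_of_nonneg (fun p hp => ?_) (fun p _ _ => ?_)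
        · have hp' := (hS p hp).1
          rw [mem_Ioc]
          exact ⟨hp'.pos, le_exp_floor_of_log_le hp'.pos (hS p hp).2⟩
        · exact div_nonneg ArithmeticFunction.vonMangoldt_nonneg (by positivity)
    _ ≤ Real.log N + 6 := sum_vonMangoldt_div_le hN
    _ ≤ 7 * l := by linarith

lemma sum_prime_rpow_le (hl : 1 ≤ l) (hS : ∀ p ∈ S, p.Prime ∧ l ≤ Real.log p) :
    ∑ p ∈ S, (p : ℝ) ^ (-1 - 1 / l) ≤ 48 := by
  have hl0 : 0 < l := by linarith
  have h1 : ∑ p ∈ S, (p : ℝ) ^ (-1 - 1 / l) ≤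
      ∑ p ∈ S, (Λ p / p * (p : ℝ) ^ (-(1 / l))) / l := by
    refine sum_le_sum fun p hp => ?_
    obtain ⟨hp1, hp2⟩ := hS p hp
    have hp0 : (0 : ℝ) < p := by exact_mod_cast hp1.pos
    rw [ArithmeticFunction.vonMangoldt_apply_prime hp1, le_div_iff₀ hl0,
      sub_eq_add_neg, Real.rpow_add hp0, Real.rpow_neg_one]
    have : 0 < (p : ℝ)⁻¹ * (p : ℝ) ^ (-(1 / l)) := by positivity
    calc (p : ℝ)⁻¹ * (p : ℝ) ^ (-(1 / l)) * l ≤ (p : ℝ)⁻¹ * (p : ℝ) ^ (-(1 / l)) * Real.log p := by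
          gcongr
      _ = _ := by ring
  refine h1.trans ?_
  rw [← sum_div, div_le_iff₀ hl0]
  have := sum_vonMangoldt_rpow_le (S := S) (μ := 1 / l) (by positivity)
    (by rw [div_le_one hl0]; exact hl) (fun n hn => (hS n hn).1.one_le)
  rwa [div_div_eq_mul_div, div_one] at this

end Primes

open scoped ArithmeticFunction.Moebius in
lemma sum_divisors_moebius_real (m : ℕ) :
    ∑ e ∈ m.divisors, (ArithmeticFunction.moebius e : ℝ) = if m = 1 then 1 else 0 := by
  have h : (ArithmeticFunction.moebius * (ArithmeticFunction.zeta : ArithmeticFunction ℤ)) m =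
      (1 : ArithmeticFunction ℤ) m := by rw [ArithmeticFunction.moebius_mul_coe_zeta]
  rw [ArithmeticFunction.coe_mul_zeta_apply, ArithmeticFunction.one_apply] at h
  exact_mod_cast h

lemma sum_moebius_div_of_dvd {q r s : ℕ} (hr : 1 ≤ r) (hs : s ∈ Icc 1 q) :
    ∑ d ∈ Icc 1 q with r ∣ d ∧ d ∣ s, (ArithmeticFunction.moebius (s / d) : ℝ) =
      if s = r then 1 else 0 := by
  rw [mem_Icc] at hs
  by_cases hrs : r ∣ s
  · obtain ⟨m, rfl⟩ := hrs
    have hm : m ≠ 0 := by rintro rfl; omega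
    have := sum_divisors_moebius_real m
    rw [← Nat.sum_div_divisors] at this
    have e : (r * m = r) ↔ m = 1 := by
      rw [mul_eq_left₀ (by omega)]
    simp only [e]
    rw [← this]
    symm
    refine sum_nbij' (fun e => r * e) (fun d => d / r) ?_ ?_ ?_ ?_ ?_
    · intro e he
      rw [Nat.mem_divisors] at he
      rw [mem_filter, mem_Icc]
      have he0 : 0 < e := Nat.pos_of_dvd_of_pos he.1 (by omega)
      refine ⟨⟨Nat.mul_pos hr he0, ?_⟩, dvd_mul_right _ _, mul_dvd_mul_left _ he.1⟩
      exact (Nat.mul_le_mul_left r (Nat.le_of_dvd (by omega) he.1)).trans hs.2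
    · intro d hd
      rw [mem_filter] at hd
      obtain ⟨_, ⟨e, rfl⟩, h⟩ := hd
      rw [Nat.mul_div_cancel_left _ hr, Nat.mem_divisors]
      exact ⟨Nat.dvd_of_mul_dvd_mul_left hr h, hm⟩
    · intro e _
      exact Nat.mul_div_cancel_left _ hr
    · intro d hd
      rw [mem_filter] at hd
      exact Nat.mul_div_cancel' hd.2.1
    · intro e _
      rw [Nat.mul_div_mul_left _ _ hr]
  · rw [filter_false_of_mem, sum_empty, if_neg]
    · rintro rfl; exact hrs dvd_rfl
    · rintro d _ ⟨h1, h2⟩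
      exact hrs (h1.trans h2)

lemma card_Ioc_filter_dvd_le (a b m : ℕ) (hab : a ≤ b) (hm : 0 < m) :
    |((#{n ∈ Ioc a b | m ∣ n} : ℕ) : ℝ) - (b - a : ℝ) / m| ≤ 1 := by
  have h0 : ∀ n : ℕ, #{k ∈ Ioc 0 n | m ∣ k} = n / m := fun n => Nat.Ioc_filter_dvd_card_eq_div n m
  have h1 : #{n ∈ Ioc 0 b | m ∣ n} = #{n ∈ Ioc 0 a | m ∣ n} + #{n ∈ Ioc a b | m ∣ n} := by
    rw [← card_union_of_disjoint, ← filter_union, Ioc_union_Ioc_eq_Ioc (Nat.zero_le a) hab]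
    apply disjoint_filter_filter
    rw [disjoint_left]
    intro n h1 h2
    rw [mem_Ioc] at h1 h2
    omega
  rw [h0, h0] at h1
  have hm' : (0 : ℝ) < m := by exact_mod_cast hm
  have e : ((#{n ∈ Ioc a b | m ∣ n} : ℕ) : ℝ) = (b / m : ℕ) - (a / m : ℕ) := by
    rw [h1]; push_cast; ring
  have k : ∀ n : ℕ, ((n / m : ℕ) : ℝ) ≤ n / m ∧ (n : ℝ) / m < (n / m : ℕ) + 1 := fun n => by
    refine ⟨Nat.cast_div_le, ?_⟩
    rw [div_lt_iff₀ hm']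
    have := Nat.lt_div_mul_add (a := n) hm
    calc (n : ℝ) < (n / m * m + m : ℕ) := by exact_mod_cast this
      _ = _ := by push_cast; ring
  rw [e, sub_div, abs_le]
  have := k a
  have := k b
  constructor <;> linarith

/-- Upper-bound sieve with arbitrary weights of level `q`. -/
lemma card_rough_le_of_weights (q a b : ℕ) (hab : a ≤ b) (hq : 1 ≤ q) (c : ℕ → ℝ)
    (h1 : c 1 = 1) (hc : ∀ d ∈ Icc 1 q, |c d| ≤ 1) :
    (#{v ∈ Ioc a b | ∀ p, p.Prime → p ≤ q → ¬ p ∣ v} : ℝ) ≤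
      (b - a) * ∑ r ∈ Icc 1 q, Nat.totient r * (∑ d ∈ Icc 1 q with r ∣ d, c d) ^ 2 + q ^ 4 := by
  have hab' : (0 : ℝ) ≤ b - a := by
    rw [sub_nonneg]; exact_mod_cast hab
  set D := Icc 1 q
  have s1 : (#{v ∈ Ioc a b | ∀ p, p.Prime → p ≤ q → ¬ p ∣ v} : ℝ) ≤
      ∑ n ∈ Ioc a b, (∑ d ∈ D, if d ∣ n then c d * d else 0) ^ 2 := by
    rw [card_filter]
    push_cast
    refine sum_le_sum fun n hn => ?_
    split_ifs with h
    · rw [sum_eq_single 1]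
      · simp [h1]
      · intro d hd hd1
        rw [mem_Icc] at hd
        rw [if_neg]
        intro hdn
        obtain ⟨p, hp, hpd⟩ := Nat.exists_prime_and_dvd hd1
        exact h p hp ((Nat.le_of_dvd (by omega) hpd).trans hd.2) (hpd.trans hdn)
      · intro h
        exact absurd (mem_Icc.2 ⟨le_refl 1, hq⟩) h
    · positivity
  have s2 : ∑ n ∈ Ioc a b, (∑ d ∈ D, if d ∣ n then c d * d else 0) ^ 2 =
      ∑ d ∈ D, ∑ e ∈ D, c d * d * (c e * e) * #{n ∈ Ioc a b | d.lcm e ∣ n} := by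
    simp_rw [sq, sum_mul_sum]
    rw [sum_comm]
    refine sum_congr rfl fun d _ => ?_
    rw [sum_comm]
    refine sum_congr rfl fun e _ => ?_
    rw [card_filter, Nat.cast_sum, mul_sum]
    refine sum_congr rfl fun n _ => ?_
    by_cases h1 : d ∣ n <;> by_cases h2 : e ∣ n <;> simp [h1, h2, Nat.lcm_dvd_iff]
  have s3 : ∀ d ∈ D, ∀ e ∈ D, c d * d * (c e * e) * #{n ∈ Ioc a b | d.lcm e ∣ n} ≤
      (b - a) * (∑ r ∈ D, if r ∣ d ∧ r ∣ e then Nat.totient r * (c d * c e) else 0) + q ^ 2 := by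
    intro d hd e he
    have hcd := hc d hd
    have hce := hc e he
    rw [mem_Icc] at hd he
    have hg : 0 < d.gcd e := Nat.gcd_pos_of_pos_left _ (by omega)
    have hl : 0 < d.lcm e := Nat.lcm_pos (by omega) (by omega)
    have hcard := card_Ioc_filter_dvd_le a b _ hab hl
    have htot : (∑ r ∈ D, if r ∣ d ∧ r ∣ e then (Nat.totient r : ℝ) * (c d * c e) else 0) =
        d.gcd e * (c d * c e) := by
      rw [← sum_filter, ← sum_mul]
      congr 1
      rw [← Nat.cast_sum]
      congr 1
      conv_rhs => rw [← Nat.sum_totient (d.gcd e)]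
      refine sum_congr ?_ fun _ _ => rfl
      ext r
      rw [mem_filter, Nat.mem_divisors, mem_Icc, Nat.dvd_gcd_iff]
      constructor
      · rintro ⟨_, h⟩
        exact ⟨h, by omega⟩
      · rintro ⟨h, _⟩
        have := Nat.le_of_dvd (by omega) h.1
        have := Nat.pos_of_dvd_of_pos h.1 (by omega)
        exact ⟨⟨by omega, by omega⟩, h⟩
    rw [htot]
    set N : ℝ := ((#{n ∈ Ioc a b | d.lcm e ∣ n} : ℕ) : ℝ)
    have hde : (d : ℝ) * e = d.gcd e * d.lcm e := by
      exact_mod_cast (Nat.gcd_mul_lcm d e).symm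
    have hl' : (0 : ℝ) < d.lcm e := by exact_mod_cast hl
    have e1 : c d * d * (c e * e) * N = (b - a) * (d.gcd e * (c d * c e)) +
        c d * c e * (d * e) * (N - (b - a) / d.lcm e) := by
      rw [show c d * d * (c e * e) * N = c d * c e * (d * e) * N by ring, hde]
      field_simp
      ring
    rw [e1]
    gcongr
    calc c d * c e * (d * e) * (N - (b - a) / d.lcm e)
        ≤ |c d * c e * (d * e) * (N - (b - a) / d.lcm e)| := le_abs_self _
      _ = |c d| * |c e| * (d * e) * |N - (b - a) / d.lcm e| := by
          simp [abs_mul]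
      _ ≤ 1 * 1 * (q * q) * 1 := by
          have : (d : ℝ) ≤ q := by exact_mod_cast hd.2
          have : (e : ℝ) ≤ q := by exact_mod_cast he.2
          gcongr
      _ = q ^ 2 := by ring
  refine s1.trans (s2.le.trans ((sum_le_sum fun d hd => sum_le_sum (s3 d hd)).trans (le_of_eq ?_)))
  simp_rw [sum_add_distrib, ← mul_sum]
  congr 1
  · congr 1
    have : ∀ d ∈ D, ∑ e ∈ D, ∑ r ∈ D,
        (if r ∣ d ∧ r ∣ e then (Nat.totient r : ℝ) * (c d * c e) else 0) =
        ∑ r ∈ D, ∑ e ∈ D, (if r ∣ d ∧ r ∣ e then (Nat.totient r : ℝ) * (c d * c e) else 0) :=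
      fun d _ => sum_comm
    rw [sum_congr rfl this, sum_comm]
    refine sum_congr rfl fun r _ => ?_
    rw [sq, sum_filter, sum_mul_sum, mul_sum]
    refine sum_congr rfl fun d _ => ?_
    rw [mul_sum]
    refine sum_congr rfl fun e _ => ?_
    by_cases h1 : r ∣ d <;> by_cases h2 : r ∣ e <;> simp [h1, h2]
  · simp [D]
    ring

lemma sum_inv_of_primeFactors_eq_le (T : Finset ℕ) {d : ℕ} (hd : Squarefree d)
    (hT : ∀ n ∈ T, n ≠ 0 ∧ n.primeFactors = d.primeFactors) :
    ∑ n ∈ T, (1 : ℝ) / n ≤ 1 / Nat.totient d := by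
  have hd0 : d ≠ 0 := hd.ne_zero
  have hdiv : ∀ n ∈ T, d ∣ n := fun n hn => by
    rw [← Nat.prod_primeFactors_of_squarefree hd, ← (hT n hn).2]
    exact Nat.prod_primeFactors_dvd n
  let φ : ℕ →* ℝ :=
    { toFun := fun n => (n : ℝ)⁻¹, map_one' := by simp, map_mul' := fun m n => by simp [mul_comm] }
  have hφ : ∀ {p : ℕ}, p.Prime → ‖φ p‖ < 1 := fun {p} hp => by
    have : (1 : ℝ) < p := by exact_mod_cast hp.one_lt
    change ‖(p : ℝ)⁻¹‖ < 1
    rw [norm_inv, Real.norm_natCast]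
    exact inv_lt_one_of_one_lt₀ this
  have hsum := EulerProduct.summable_and_hasSum_factoredNumbers_prod_filter_prime_geometric hφ
    d.primeFactors
  have hmem : ∀ n ∈ T, n / d ∈ Nat.factoredNumbers d.primeFactors := fun n hn => by
    have h := hdiv n hn
    have hn0 := (hT n hn).1
    apply Nat.mem_factoredNumbers_of_primeFactors_subset
    · exact (Nat.div_pos (Nat.le_of_dvd (by omega) h) (by omega)).ne'
    · rw [← (hT n hn).2]
      exact Nat.primeFactors_mono (Nat.div_dvd_of_dvd h) hn0
  let g : T → Nat.factoredNumbers d.primeFactors := fun n => ⟨n.1 / d, hmem n.1 n.2⟩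
  have hg : Function.Injective g := by
    intro m n hmn
    have : m.1 / d = n.1 / d := congrArg Subtype.val hmn
    ext
    rw [← Nat.div_mul_cancel (hdiv m.1 m.2), this, Nat.div_mul_cancel (hdiv n.1 n.2)]
  have key : ∑ n ∈ T, φ (n / d) ≤ ∏ p ∈ d.primeFactors with p.Prime, (1 - φ p)⁻¹ := by
    rw [← hsum.2.tsum_eq]
    have hs : Summable fun m : Nat.factoredNumbers d.primeFactors => φ m := hsum.2.summable
    calc ∑ n ∈ T, φ (n / d) = ∑ n : T, φ (g n) := by
          rw [← sum_coe_sort]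
      _ = ∑ m ∈ univ.map ⟨g, hg⟩, φ m := by rw [sum_map]; rfl
      _ ≤ _ := hs.sum_le_tsum _ (fun m _ => by
        change (0 : ℝ) ≤ ((m.1 : ℕ) : ℝ)⁻¹; positivity)
  have htot : (Nat.totient d : ℝ) = d * ∏ p ∈ d.primeFactors, (1 - (p : ℝ)⁻¹) := by
    have := congrArg (fun z : ℚ => (z : ℝ)) (Nat.totient_eq_mul_prod_factors d)
    push_cast at this
    exact this
  have hfil : d.primeFactors.filter Nat.Prime = d.primeFactors :=
    filter_true_of_mem fun p hp => Nat.prime_of_mem_primeFactors hp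
  rw [hfil] at key
  have hd' : (0 : ℝ) < d := by exact_mod_cast Nat.pos_of_ne_zero hd0
  rw [htot, one_div, mul_inv, ← prod_inv_distrib]
  calc ∑ n ∈ T, (1 : ℝ) / n = (d : ℝ)⁻¹ * ∑ n ∈ T, φ (n / d) := by
        rw [mul_sum]
        refine sum_congr rfl fun n hn => ?_
        change (1 : ℝ) / n = (d : ℝ)⁻¹ * ((n / d : ℕ) : ℝ)⁻¹
        rw [Nat.cast_div (hdiv n hn) hd'.ne']
        field_simp
    _ ≤ _ := by
        gcongr
        exact key

lemma log_le_sum_moebius_sq_div_totient {q : ℕ} (hq : 1 ≤ q) :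
    Real.log q ≤ ∑ r ∈ Icc 1 q, (ArithmeticFunction.moebius r : ℝ) ^ 2 / Nat.totient r := by
  let rad : ℕ → ℕ := fun n => ∏ p ∈ n.primeFactors, p
  have hradsq : ∀ n, Squarefree (rad n) := fun n =>
    squarefree_prod_of_pairwise_isCoprime
      (fun p hp q hq hpq => Nat.coprime_iff_isRelPrime.1 <| (Nat.coprime_primes
        (Nat.prime_of_mem_primeFactors hp) (Nat.prime_of_mem_primeFactors hq)).2 hpq)
      fun p hp => (Nat.prime_of_mem_primeFactors hp).squarefree
  have hmaps : ∀ n ∈ Icc 1 q, rad n ∈ Icc 1 q := fun n hn => by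
    rw [mem_Icc] at hn ⊢
    have := Nat.le_of_dvd (by omega) (Nat.prod_primeFactors_dvd n)
    have := (hradsq n).ne_zero
    change 1 ≤ rad n ∧ rad n ≤ q
    have : rad n ≤ n := by assumption
    omega
  have h1 : Real.log q ≤ ∑ n ∈ Icc 1 q, (1 : ℝ) / n := by
    have h := log_add_one_le_harmonic q
    rw [harmonic_eq_sum_Icc] at h
    push_cast at h
    have : Real.log q ≤ Real.log (q + 1) := Real.log_le_log (by exact_mod_cast hq) (by linarith)
    simpa using this.trans h
  refine h1.trans ?_
  rw [← sum_fiberwise_of_maps_to hmaps]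
  refine sum_le_sum fun d hd => ?_
  by_cases hsq : Squarefree d
  · have : (ArithmeticFunction.moebius d : ℝ) ^ 2 = 1 := by
      have := ArithmeticFunction.moebius_sq_eq_one_of_squarefree hsq
      exact_mod_cast this
    rw [this]
    refine sum_inv_of_primeFactors_eq_le _ hsq fun n hn => ?_
    rw [mem_filter, mem_Icc] at hn
    refine ⟨by omega, ?_⟩
    rw [← hn.2]
    exact (Nat.primeFactors_prod_primeFactors n).symm
  · rw [sum_eq_zero]
    · positivity
    · intro n hn
      rw [mem_filter] at hn
      exact absurd (hn.2 ▸ hradsq n) hsq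

/-- Selberg's upper bound sieve for the primes up to `q`. -/
lemma card_rough_le (q a b : ℕ) (hab : a ≤ b) (hq : 2 ≤ q) :
    (#{v ∈ Ioc a b | ∀ p, p.Prime → p ≤ q → ¬ p ∣ v} : ℝ) ≤
      (b - a) / Real.log q + q ^ 4 := by
  have hab' : (0 : ℝ) ≤ b - a := by
    rw [sub_nonneg]; exact_mod_cast hab
  set D := Icc 1 q
  set G := ∑ r ∈ D, (ArithmeticFunction.moebius r : ℝ) ^ 2 / Nat.totient r with hG
  have hGl : Real.log q ≤ G := log_le_sum_moebius_sq_div_totient (by omega)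
  have hlog : 0 < Real.log q := Real.log_pos (by exact_mod_cast hq)
  have hG0 : 0 < G := hlog.trans_le hGl
  let Y : ℕ → ℝ := fun r => (ArithmeticFunction.moebius r : ℝ) / (Nat.totient r * G)
  let c : ℕ → ℝ := fun d => ∑ s ∈ D with d ∣ s, (ArithmeticFunction.moebius (s / d) : ℝ) * Y s
  have habs : ∀ n, |(ArithmeticFunction.moebius n : ℝ)| ≤ 1 := fun n => by
    exact_mod_cast ArithmeticFunction.abs_moebius_le_one
  have hmsq : ∀ n, |(ArithmeticFunction.moebius n : ℝ)| = (ArithmeticFunction.moebius n : ℝ) ^ 2 :=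
    fun n => by
      have := ArithmeticFunction.moebius_eq_or n
      rcases this with h | h | h <;> simp [h]
  have hYabs : ∑ s ∈ D, |Y s| = 1 := by
    calc ∑ s ∈ D, |Y s| = ∑ s ∈ D, (ArithmeticFunction.moebius s : ℝ) ^ 2 / Nat.totient s / G := by
          refine sum_congr rfl fun s _ => ?_
          rw [abs_div, hmsq, abs_of_nonneg (by positivity), div_div]
      _ = 1 := by rw [← sum_div, ← hG, div_self hG0.ne']
  have hc1 : c 1 = 1 := by
    calc c 1 = ∑ s ∈ D, (ArithmeticFunction.moebius s : ℝ) ^ 2 / Nat.totient s / G := by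
          simp only [c, one_dvd, filter_true]
          refine sum_congr rfl fun s _ => ?_
          rw [Nat.div_one]
          simp only [Y]
          rw [← mul_div_assoc, ← sq, div_div]
      _ = 1 := by rw [← sum_div, ← hG, div_self hG0.ne']
  have hc : ∀ d ∈ D, |c d| ≤ 1 := by
    intro d _
    calc |c d| ≤ ∑ s ∈ D with d ∣ s, |(ArithmeticFunction.moebius (s / d) : ℝ) * Y s| :=
          abs_sum_le_sum_abs _ _
      _ ≤ ∑ s ∈ D with d ∣ s, |Y s| := by
          refine sum_le_sum fun s _ => ?_
          rw [abs_mul]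
          exact mul_le_of_le_one_left (abs_nonneg _) (habs _)
      _ ≤ ∑ s ∈ D, |Y s| := sum_le_sum_of_subset_of_nonneg (filter_subset _ _)
          fun _ _ _ => abs_nonneg _
      _ = 1 := hYabs
  have hcY : ∀ r ∈ D, ∑ d ∈ D with r ∣ d, c d = Y r := by
    intro r hr
    have hr1 : 1 ≤ r := (mem_Icc.1 hr).1
    calc ∑ d ∈ D with r ∣ d, c d
        = ∑ s ∈ D, Y s * ∑ d ∈ D with r ∣ d ∧ d ∣ s,
            (ArithmeticFunction.moebius (s / d) : ℝ) := by
          simp only [c, sum_filter, mul_sum]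
          rw [sum_congr rfl (g := fun d => ∑ s ∈ D, if r ∣ d ∧ d ∣ s then
            (ArithmeticFunction.moebius (s / d) : ℝ) * Y s else 0)]
          · rw [sum_comm]
            refine sum_congr rfl fun s _ => sum_congr rfl fun d _ => ?_
            split_ifs <;> ring
          · intro d _
            by_cases h : r ∣ d <;> simp [h]
      _ = ∑ s ∈ D, Y s * if s = r then 1 else 0 :=
          sum_congr rfl fun s hs => by rw [sum_moebius_div_of_dvd hr1 hs]
      _ = Y r := by simp [hr]
  have hform : ∑ r ∈ D, Nat.totient r * (∑ d ∈ D with r ∣ d, c d) ^ 2 = 1 / G := by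
    calc ∑ r ∈ D, Nat.totient r * (∑ d ∈ D with r ∣ d, c d) ^ 2
        = ∑ r ∈ D, (ArithmeticFunction.moebius r : ℝ) ^ 2 / Nat.totient r / G ^ 2 := by
          refine sum_congr rfl fun r hr => ?_
          rw [hcY r hr]
          have : (0 : ℝ) < Nat.totient r := by
            exact_mod_cast Nat.totient_pos.2 (mem_Icc.1 hr).1
          simp only [Y]
          field_simp
      _ = 1 / G := by
          rw [← sum_div, ← hG]
          field_simp
  refine (card_rough_le_of_weights q a b hab (by omega) c hc1 hc).trans ?_
  rw [hform]
  gcongr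
  rw [mul_one_div]
  gcongr

lemma isPrimePow_eq_minFac_pow {n : ℕ} (hn : IsPrimePow n) :
    n = n.minFac ^ n.factorization n.minFac := by
  exact (hn.minFac_pow_factorization_eq).symm

lemma minFac_eq_of_prime_dvd {n p : ℕ} (hn : IsPrimePow n) (hp : p.Prime) (hpn : p ∣ n) :
    n.minFac = p := by
  have h1 : n.minFac.Prime := Nat.minFac_prime hn.ne_one
  have h := isPrimePow_eq_minFac_pow hn
  rw [h] at hpn
  exact ((Nat.prime_dvd_prime_iff_eq hp h1).1 (hp.dvd_of_dvd_pow hpn)).symm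

/-- A Brun–Titchmarsh bound including prime powers. -/
lemma sum_vonMangoldt_Ioc_le (a L : ℕ) (hL : 1 ≤ L) (ha : (a : ℝ) ≤ (L : ℝ) ^ (5 / 2 : ℝ)) :
    ∑ n ∈ Ioc a (a + L), Λ n ≤ 3000 * L := by
  have hL1 : (1 : ℝ) ≤ L := by exact_mod_cast hL
  have hL0 : (0 : ℝ) < L := by linarith
  have hb : ((a + L : ℕ) : ℝ) ≤ 2 * (L : ℝ) ^ (5 / 2 : ℝ) := by
    have : (L : ℝ) ^ (1 : ℝ) ≤ (L : ℝ) ^ (5 / 2 : ℝ) :=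
      Real.rpow_le_rpow_of_exponent_le hL1 (by norm_num)
    rw [Real.rpow_one] at this
    push_cast
    linarith
  have hpos : (0 : ℝ) < ((a + L : ℕ) : ℝ) := by exact_mod_cast (by omega : 0 < a + L)
  have hlogb : Real.log (a + L : ℕ) ≤ 1 + 5 / 2 * Real.log L := by
    calc Real.log (a + L : ℕ) ≤ Real.log (2 * (L : ℝ) ^ (5 / 2 : ℝ)) := Real.log_le_log hpos hb
      _ = Real.log 2 + 5 / 2 * Real.log L := by
          rw [Real.log_mul (by norm_num) (by positivity), Real.log_rpow hL0]
      _ ≤ _ := by linarith [Real.log_two_lt_d9]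
  have hl2 : (0.69 : ℝ) < Real.log 2 := by linarith [Real.log_two_gt_d9]
  have hl2' : Real.log 2 < 0.7 := by linarith [Real.log_two_lt_d9]
  have hΛ : ∀ n ∈ Ioc a (a + L), Λ n ≤ Real.log (a + L : ℕ) := fun n hn => by
    rw [mem_Ioc] at hn
    exact ArithmeticFunction.vonMangoldt_le_log.trans
      (Real.log_le_log (by exact_mod_cast (by omega : 0 < n)) (by exact_mod_cast hn.2))
  set l := Real.log L with hl
  rcases le_or_gt (14 : ℝ) l with hbig | hsmall
  swap
  · calc ∑ n ∈ Ioc a (a + L), Λ n ≤ ∑ n ∈ Ioc a (a + L), (36 : ℝ) := by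
          refine sum_le_sum fun n hn => (hΛ n hn).trans ?_
          linarith
      _ = 36 * L := by simp [mul_comm]
      _ ≤ 3000 * L := by nlinarith
  · set q := ⌊(L : ℝ) ^ (1 / 10 : ℝ)⌋₊ with hq
    have hL20 : 2 ≤ (L : ℝ) ^ (1 / 20 : ℝ) := by
      rw [Real.rpow_def_of_pos hL0, ← Real.log_le_iff_le_exp (by norm_num)]
      linarith
    have hqle : (q : ℝ) ≤ (L : ℝ) ^ (1 / 10 : ℝ) := Nat.floor_le (by positivity)
    have hqge : (L : ℝ) ^ (1 / 20 : ℝ) ≤ q := by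
      have h1 : (L : ℝ) ^ (1 / 10 : ℝ) < q + 1 := Nat.lt_floor_add_one _
      have h2 : (L : ℝ) ^ (1 / 10 : ℝ) = (L : ℝ) ^ (1 / 20 : ℝ) * (L : ℝ) ^ (1 / 20 : ℝ) := by
        rw [← Real.rpow_add hL0]; norm_num
      nlinarith
    have hq2 : 2 ≤ q := by exact_mod_cast hL20.trans hqge
    have hlogq : l / 20 ≤ Real.log q := by
      have := Real.log_le_log (by positivity) hqge
      rw [Real.log_rpow hL0] at this
      linarith
    have hlogL : l ≤ 10 * (L : ℝ) ^ (1 / 10 : ℝ) := by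
      have := Real.log_le_rpow_div (x := (L : ℝ)) (ε := 1 / 10) hL0.le (by norm_num)
      linarith
    set R := (Ioc a (a + L)).filter fun v => ∀ p, p.Prime → p ≤ q → ¬ p ∣ v
    have hsplit : ∑ n ∈ Ioc a (a + L), Λ n = ∑ n ∈ R, Λ n +
        ∑ n ∈ (Ioc a (a + L)).filter (fun v => ¬ ∀ p, p.Prime → p ≤ q → ¬ p ∣ v), Λ n :=
      (sum_filter_add_sum_filter_not _ _ _).symm
    have hR : (#R : ℝ) ≤ 20 * L / l + (L : ℝ) ^ (4 / 10 : ℝ) := by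
      have := card_rough_le q a (a + L) (by omega) hq2
      refine this.trans ?_
      push_cast
      refine add_le_add ?_ ?_
      · rw [add_sub_cancel_left, div_le_div_iff₀ (by linarith) (by linarith)]
        nlinarith
      · calc (q : ℝ) ^ 4 ≤ ((L : ℝ) ^ (1 / 10 : ℝ)) ^ 4 := by gcongr
          _ = (L : ℝ) ^ (4 / 10 : ℝ) := by
              rw [← Real.rpow_natCast, ← Real.rpow_mul hL0.le]; norm_num
    have hlogb3 : Real.log (a + L : ℕ) ≤ 3 * l := by linarith
    have h1 : ∑ n ∈ R, Λ n ≤ 90 * L := by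
      calc ∑ n ∈ R, Λ n ≤ ∑ n ∈ R, 3 * l :=
            sum_le_sum fun n hn => (hΛ n (mem_filter.1 hn).1).trans hlogb3
        _ = #R * (3 * l) := by rw [sum_const, nsmul_eq_mul]
        _ ≤ (20 * L / l + (L : ℝ) ^ (4 / 10 : ℝ)) * (3 * l) := by gcongr
        _ = 60 * L + 3 * (l * (L : ℝ) ^ (4 / 10 : ℝ)) := by field_simp; ring
        _ ≤ 60 * L + 3 * (10 * L) := by
            gcongr 60 * (L : ℝ) + 3 * ?_
            calc l * (L : ℝ) ^ (4 / 10 : ℝ)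
                ≤ 10 * (L : ℝ) ^ (1 / 10 : ℝ) * (L : ℝ) ^ (4 / 10 : ℝ) := by gcongr
              _ = 10 * (L : ℝ) ^ (1 / 2 : ℝ) := by
                  rw [mul_assoc, ← Real.rpow_add hL0]; norm_num
              _ ≤ 10 * L := by
                  gcongr
                  calc (L : ℝ) ^ (1 / 2 : ℝ) ≤ (L : ℝ) ^ (1 : ℝ) :=
                        Real.rpow_le_rpow_of_exponent_le hL1 (by norm_num)
                    _ = L := Real.rpow_one _
        _ = 90 * L := by ring
    have h2 : ∑ n ∈ (Ioc a (a + L)).filter (fun v => ¬ ∀ p, p.Prime → p ≤ q → ¬ p ∣ v), Λ n ≤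
        2400 * L := by
      set Q := (Ioc a (a + L)).filter (fun v => ¬ ∀ p, p.Prime → p ≤ q → ¬ p ∣ v) with hQ
      have hcard : #(Q.filter IsPrimePow) ≤ #(Icc 1 q ×ˢ range (Nat.log 2 (a + L) + 1)) := by
        refine card_le_card_of_injOn (fun n => (n.minFac, n.factorization n.minFac)) ?_ ?_
        · intro n hn
          rw [mem_coe, mem_filter, hQ, mem_filter, mem_Ioc] at hn
          obtain ⟨⟨hn1, hn2⟩, hpp⟩ := hn
          push Not at hn2
          obtain ⟨p, hp, hpq, hpn⟩ := hn2
          rw [mem_coe, mem_product, mem_Icc, mem_range]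
          have hmf := minFac_eq_of_prime_dvd hpp hp hpn
          refine ⟨⟨n.minFac_pos, by simpa [hmf] using hpq⟩, ?_⟩
          rw [Nat.lt_succ_iff]
          refine Nat.le_log_of_pow_le (by norm_num) ?_
          calc 2 ^ n.factorization n.minFac ≤ n.minFac ^ n.factorization n.minFac :=
                Nat.pow_le_pow_left (Nat.minFac_prime hpp.ne_one).two_le _
            _ = n := (isPrimePow_eq_minFac_pow hpp).symm
            _ ≤ a + L := hn1.2
        · intro m hm n hn hmn
          rw [mem_coe, mem_filter] at hm hn
          simp only [Prod.mk.injEq] at hmn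
          calc m = m.minFac ^ m.factorization m.minFac := isPrimePow_eq_minFac_pow hm.2
            _ = n.minFac ^ n.factorization n.minFac := by rw [hmn.2, hmn.1]
            _ = n := (isPrimePow_eq_minFac_pow hn.2).symm
      have hcard' : (#(Q.filter IsPrimePow) : ℝ) ≤ (L : ℝ) ^ (1 / 10 : ℝ) * (5 * l) := by
        have hlog2 : (Nat.log 2 (a + L) : ℝ) ≤ 3 * l / 0.69 := by
          rw [le_div_iff₀ (by norm_num)]
          have := Nat.pow_log_le_self 2 (x := a + L) (by omega)
          have h3 : ((2 : ℝ) ^ Nat.log 2 (a + L)) ≤ (a + L : ℕ) := by exact_mod_cast this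
          have h4 := Real.log_le_log (by positivity) h3
          rw [Real.log_pow] at h4
          have : (0 : ℝ) ≤ Nat.log 2 (a + L) := by positivity
          nlinarith
        calc (#(Q.filter IsPrimePow) : ℝ) ≤ (q * (Nat.log 2 (a + L) + 1) : ℕ) := by
              have : #(Icc 1 q ×ˢ range (Nat.log 2 (a + L) + 1)) = q * (Nat.log 2 (a + L) + 1) := by
                simp
              rw [this] at hcard
              exact_mod_cast hcard
          _ = q * (Nat.log 2 (a + L) + 1) := by push_cast; ring
          _ ≤ _ := by
              gcongr
              refine (add_le_add_left hlog2 1).trans ?_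
              rw [show 3 * l / 0.69 = (3 / 0.69) * l by ring]
              norm_num
              linarith
      calc ∑ n ∈ Q, Λ n = ∑ n ∈ Q.filter IsPrimePow, Λ n := by
            refine (sum_filter_of_ne fun n _ h => ?_).symm
            exact ArithmeticFunction.vonMangoldt_ne_zero_iff.1 h
        _ ≤ ∑ n ∈ Q.filter IsPrimePow, 3 * l :=
            sum_le_sum fun n hn => (hΛ n (mem_filter.1 (mem_filter.1 hn).1).1).trans hlogb3
        _ = #(Q.filter IsPrimePow) * (3 * l) := by rw [sum_const, nsmul_eq_mul]
        _ ≤ (L : ℝ) ^ (1 / 10 : ℝ) * (5 * l) * (3 * l) := by gcongr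
        _ = 15 * (L : ℝ) ^ (1 / 10 : ℝ) * l * l := by ring
        _ ≤ 15 * (L : ℝ) ^ (1 / 10 : ℝ) * (10 * (L : ℝ) ^ (1 / 10 : ℝ)) *
            (10 * (L : ℝ) ^ (1 / 10 : ℝ)) := by gcongr
        _ = 1500 * (L : ℝ) ^ (3 / 10 : ℝ) := by
            have : (L : ℝ) ^ (3 / 10 : ℝ) = ((L : ℝ) ^ (1 / 10 : ℝ)) ^ 3 := by
              rw [← Real.rpow_natCast, ← Real.rpow_mul hL0.le]; norm_num
            rw [this]; ring
        _ ≤ 1500 * L := by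
            gcongr
            calc (L : ℝ) ^ (3 / 10 : ℝ) ≤ (L : ℝ) ^ (1 : ℝ) :=
                  Real.rpow_le_rpow_of_exponent_le hL1 (by norm_num)
              _ = L := Real.rpow_one _
        _ ≤ 2400 * L := by linarith
    rw [hsplit]
    linarith

/-- A nonnegative multiplicative function. -/
structure IsNonnegMult (h : ℕ → ℝ) : Prop where
  nonneg : ∀ n, 0 ≤ h n
  one : h 1 = 1
  mul : ∀ m n : ℕ, m.Coprime n → h (m * n) = h m * h n

lemma rpow_pow_eq {p : ℕ} (c : ℝ) (e : ℕ) : ((p ^ e : ℕ) : ℝ) ^ c = ((p : ℝ) ^ c) ^ e := by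
  push_cast
  rw [← Real.rpow_natCast, ← Real.rpow_mul (by positivity), mul_comm, Real.rpow_mul (by positivity),
    Real.rpow_natCast]

lemma prime_rpow_neg_le {p : ℕ} (hp : p.Prime) : (p : ℝ) ^ (-(5 / 8) : ℝ) ≤ 2 / 3 := by
  have h2 : (2 : ℝ) ≤ p := by exact_mod_cast hp.two_le
  calc (p : ℝ) ^ (-(5 / 8) : ℝ) ≤ 2 ^ (-(5 / 8) : ℝ) :=
        Real.rpow_le_rpow_of_nonpos (by norm_num) h2 (by norm_num)
    _ ≤ 2 / 3 := by
        refine le_of_pow_le_pow_left₀ (n := 8) (by norm_num) (by norm_num) ?_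
        rw [← Real.rpow_natCast, ← Real.rpow_mul (by norm_num)]
        norm_num

lemma sum_prime_rpow_five_fourths_le (S : Finset ℕ) :
    ∑ p ∈ S, (p : ℝ) ^ (-(5 / 4) : ℝ) ≤ ∑' n : ℕ, (n : ℝ) ^ (-(5 / 4) : ℝ) :=
  (Real.summable_nat_rpow.2 (by norm_num)).sum_le_tsum _ fun _ _ => by positivity

/-- The bound for the contribution of the higher prime powers to an Euler product. -/
def powConst (C : ℝ) : ℝ := 3 * C * ∑' n : ℕ, (n : ℝ) ^ (-(5 / 4) : ℝ)

lemma powConst_nonneg {C : ℝ} (hC : 0 ≤ C) : 0 ≤ powConst C := by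
  have : 0 ≤ ∑' n : ℕ, (n : ℝ) ^ (-(5 / 4) : ℝ) := tsum_nonneg fun _ => by positivity
  unfold powConst
  positivity

/-- Rankin's bound for sums over smooth numbers. -/
lemma IsNonnegMult.sum_smooth_le {h : ℕ → ℝ} (hh : IsNonnegMult h) {C : ℝ} (hC : 0 ≤ C)
    (hpow : ∀ p e : ℕ, p.Prime → 2 ≤ e → h (p ^ e) ≤ C * ((p ^ e : ℕ) : ℝ) ^ (-(5 / 8) : ℝ))
    (N : ℕ) (S : Finset ℕ) (hS : ∀ n ∈ S, n ∈ Nat.smoothNumbers N) :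
    ∑ n ∈ S, h n ≤ Real.exp (∑ p ∈ N.primesBelow, h p + powConst C) := by
  have hgeo : ∀ p : ℕ, p.Prime → HasSum (fun e : ℕ => C * ((p ^ (e + 2) : ℕ) : ℝ) ^ (-(5 / 8) : ℝ))
      (C * ((p : ℝ) ^ (-(5 / 4) : ℝ) * (1 - (p : ℝ) ^ (-(5 / 8) : ℝ))⁻¹)) := by
    intro p hp
    have hlt : (p : ℝ) ^ (-(5 / 8) : ℝ) < 1 := (prime_rpow_neg_le hp).trans_lt (by norm_num)
    have := ((hasSum_geometric_of_lt_one (by positivity) hlt).mul_left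
      ((p : ℝ) ^ (-(5 / 4) : ℝ))).mul_left C
    have e2 : ∀ e : ℕ, C * ((p ^ (e + 2) : ℕ) : ℝ) ^ (-(5 / 8) : ℝ) =
        C * ((p : ℝ) ^ (-(5 / 4) : ℝ) * ((p : ℝ) ^ (-(5 / 8) : ℝ)) ^ e) := fun e => by
      rw [rpow_pow_eq, pow_add, mul_comm (_ ^ e)]
      congr 2
      rw [← Real.rpow_natCast, ← Real.rpow_mul (by positivity)]
      norm_num
    simpa only [e2] using this
  have hsum2 : ∀ p : ℕ, p.Prime → Summable fun e : ℕ => h (p ^ (e + 2)) := fun p hp =>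
    Summable.of_nonneg_of_le (fun e => hh.nonneg _) (fun e => hpow p (e + 2) hp (by omega))
      (hgeo p hp).summable
  have hsum : ∀ p : ℕ, p.Prime → Summable fun e : ℕ => h (p ^ e) := fun p hp =>
    (summable_nat_add_iff 2).1 (hsum2 p hp)
  have hnorm : ∀ n, ‖h n‖ = h n := fun n => Real.norm_of_nonneg (hh.nonneg n)
  obtain ⟨h1, h2⟩ := EulerProduct.summable_and_hasSum_smoothNumbers_prod_primesBelow_tsum (f := h)
    hh.one (fun {m n} hmn => hh.mul m n hmn) (fun {p} hp => by simpa [hnorm] using hsum p hp) N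
  have hfac : ∀ p ∈ N.primesBelow, ∑' e : ℕ, h (p ^ e) ≤
      Real.exp (h p + 3 * C * (p : ℝ) ^ (-(5 / 4) : ℝ)) := by
    intro p hp
    have hp' := Nat.prime_of_mem_primesBelow hp
    rw [← (hsum p hp').sum_add_tsum_nat_add 2]
    have h3 : ∑' e : ℕ, h (p ^ (e + 2)) ≤ 3 * C * (p : ℝ) ^ (-(5 / 4) : ℝ) := by
      refine ((hsum2 p hp').tsum_le_tsum (fun e => hpow p (e + 2) hp' (by omega))
        (hgeo p hp').summable).trans ?_
      rw [(hgeo p hp').tsum_eq]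
      have : (1 - (p : ℝ) ^ (-(5 / 8) : ℝ))⁻¹ ≤ 3 := by
        rw [inv_le_comm₀ _ (by norm_num)] <;> linarith [prime_rpow_neg_le hp']
      have h0 : 0 ≤ (p : ℝ) ^ (-(5 / 4) : ℝ) := by positivity
      calc C * ((p : ℝ) ^ (-(5 / 4) : ℝ) * (1 - (p : ℝ) ^ (-(5 / 8) : ℝ))⁻¹)
          ≤ C * ((p : ℝ) ^ (-(5 / 4) : ℝ) * 3) := by gcongr
        _ = _ := by ring
    have h4 : ∑ e ∈ range 2, h (p ^ e) = 1 + h p := by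
      simp [sum_range_succ, hh.one]
    have := Real.add_one_le_exp (h p + 3 * C * (p : ℝ) ^ (-(5 / 4) : ℝ))
    linarith
  calc ∑ n ∈ S, h n = ∑ n ∈ S.attach, h n := (sum_attach S h).symm
    _ = ∑ m ∈ S.attach.map ⟨fun n => (⟨n.1, hS n.1 n.2⟩ : Nat.smoothNumbers N), fun m n hmn => by
          ext; exact congrArg (fun z : Nat.smoothNumbers N => z.1) hmn⟩, h m := by
        rw [sum_map]; rfl
    _ ≤ ∑' m : Nat.smoothNumbers N, h m := h2.summable.sum_le_tsum _ fun _ _ => hh.nonneg _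
    _ = ∏ p ∈ N.primesBelow, ∑' e : ℕ, h (p ^ e) := h2.tsum_eq
    _ ≤ ∏ p ∈ N.primesBelow, Real.exp (h p + 3 * C * (p : ℝ) ^ (-(5 / 4) : ℝ)) :=
        prod_le_prod (fun p _ => tsum_nonneg fun e => hh.nonneg _) hfac
    _ = Real.exp (∑ p ∈ N.primesBelow, (h p + 3 * C * (p : ℝ) ^ (-(5 / 4) : ℝ))) :=
        (Real.exp_sum _ _).symm
    _ ≤ _ := by
        rw [sum_add_distrib, ← mul_sum]
        unfold powConst
        gcongr
        exact sum_prime_rpow_five_fourths_le _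

section SmoothPart

/-- The `y`-smooth part of `n`. -/
def sm (y n : ℕ) : ℕ := ∏ p ∈ (y + 1).primesBelow, p ^ n.factorization p

/-- The `y`-rough part of `n`. -/
def ro (y n : ℕ) : ℕ := n / sm y n

variable {y m n p : ℕ}

lemma sm_pos (y n : ℕ) : 0 < sm y n :=
  Nat.pos_of_ne_zero <| prod_ne_zero_iff.2 fun _ hp =>
    pow_ne_zero _ (Nat.prime_of_mem_primesBelow hp).ne_zero

lemma sm_mul (hm : m ≠ 0) (hn : n ≠ 0) : sm y (m * n) = sm y m * sm y n := by
  simp only [sm, Nat.factorization_mul hm hn, Finsupp.add_apply, pow_add, prod_mul_distrib]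

@[simp] lemma sm_one : sm y 1 = 1 := by simp [sm]

lemma factorization_sm (hp : p.Prime) :
    (sm y n).factorization p = if p ≤ y then n.factorization p else 0 := by
  unfold sm
  rw [Nat.factorization_prod fun q hq => pow_ne_zero _ (Nat.prime_of_mem_primesBelow hq).ne_zero,
    Finsupp.finsetSum_apply, sum_congr rfl fun q hq => by
      rw [(Nat.prime_of_mem_primesBelow hq).factorization_pow]]
  simp only [Finsupp.single_apply]
  rw [sum_ite_eq']
  simp [Nat.mem_primesBelow, hp]

lemma sm_dvd (hn : n ≠ 0) : sm y n ∣ n := by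
  rw [← Nat.factorization_prime_le_iff_dvd (sm_pos y n).ne' hn]
  intro p hp
  rw [factorization_sm hp]
  split_ifs <;> simp

lemma sm_mul_ro (hn : n ≠ 0) : sm y n * ro y n = n := Nat.mul_div_cancel' (sm_dvd hn)

lemma ro_pos (hn : n ≠ 0) : 0 < ro y n := by
  have := sm_mul_ro (y := y) hn
  rcases Nat.eq_zero_or_pos (ro y n) with h | h
  · rw [h] at this; omega
  · exact h

lemma ro_mul (hm : m ≠ 0) (hn : n ≠ 0) : ro y (m * n) = ro y m * ro y n := by
  apply Nat.eq_of_mul_eq_mul_left (sm_pos y (m * n))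
  rw [sm_mul_ro (mul_ne_zero hm hn), sm_mul hm hn]
  conv_lhs => rw [← sm_mul_ro (y := y) hm, ← sm_mul_ro (y := y) hn]
  ring

lemma sm_mem_smoothNumbers (y n : ℕ) : sm y n ∈ Nat.smoothNumbers (y + 1) := by
  rw [Nat.mem_smoothNumbers']
  intro p hp hpn
  have := (hp.dvd_iff_one_le_factorization (sm_pos y n).ne').1 hpn
  rw [factorization_sm hp] at this
  split_ifs at this <;> omega

lemma lt_of_prime_dvd_ro (hn : n ≠ 0) (hp : p.Prime) (hpn : p ∣ ro y n) : y < p := by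
  by_contra h
  have h1 := (hp.dvd_iff_one_le_factorization (ro_pos hn).ne').1 hpn
  have h2 := congrArg (fun k => k.factorization p) (sm_mul_ro (y := y) hn)
  simp only [Nat.factorization_mul (sm_pos y n).ne' (ro_pos hn).ne', Finsupp.add_apply,
    factorization_sm hp] at h2
  rw [if_pos (by omega)] at h2
  omega

lemma coprime_sm_ro (hn : n ≠ 0) : (sm y n).Coprime (ro y n) := by
  refine Nat.coprime_of_dvd fun p hp h1 h2 => ?_
  have := lt_of_prime_dvd_ro hn hp h2
  have := (Nat.mem_smoothNumbers'.1 (sm_mem_smoothNumbers y n)) p hp h1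
  omega

lemma sm_le (hn : n ≠ 0) : sm y n ≤ n := Nat.le_of_dvd (by omega) (sm_dvd hn)

lemma sm_prime_pow_of_le (hp : p.Prime) (h : p ≤ y) (e : ℕ) : sm y (p ^ e) = p ^ e := by
  refine Nat.eq_of_factorization_eq (sm_pos _ _).ne' (pow_ne_zero _ hp.ne_zero) fun q => ?_
  by_cases hq : q.Prime
  · rw [factorization_sm hq, hp.factorization_pow, Finsupp.single_apply]
    split_ifs <;> omega
  · rw [Nat.factorization_eq_zero_of_not_prime _ hq, Nat.factorization_eq_zero_of_not_prime _ hq]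

lemma sm_prime_pow_of_lt (hp : p.Prime) (h : y < p) (e : ℕ) : sm y (p ^ e) = 1 := by
  refine Nat.eq_of_factorization_eq (sm_pos _ _).ne' one_ne_zero fun q => ?_
  by_cases hq : q.Prime
  · rw [factorization_sm hq, hp.factorization_pow, Finsupp.single_apply]
    split_ifs <;> first | omega | simp
  · rw [Nat.factorization_eq_zero_of_not_prime _ hq, Nat.factorization_eq_zero_of_not_prime _ hq]

lemma sm_succ : sm (y + 1) n = sm y n * if (y + 1).Prime then (y + 1) ^ n.factorization (y + 1)
    else 1 := by
  unfold sm
  rw [Nat.primesBelow_succ]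
  split_ifs with h
  · rw [prod_insert (by simp [Nat.mem_primesBelow]), mul_comm]
  · simp

lemma sm_zero : sm 0 n = 1 := by
  simp [sm, Nat.primesBelow]

end SmoothPart

lemma IsNonnegMult.le_rpow {h : ℕ → ℝ} (hh : IsNonnegMult h) {D ε : ℝ} (hD : 1 ≤ D) {P : ℕ}
    (h1 : ∀ p e : ℕ, p.Prime → h (p ^ e) ≤ D * ((p ^ e : ℕ) : ℝ) ^ ε)
    (h2 : ∀ p e : ℕ, p.Prime → P < p → h (p ^ e) ≤ ((p ^ e : ℕ) : ℝ) ^ ε) {n : ℕ} (hn : n ≠ 0) :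
    h n ≤ D ^ (P + 1) * (n : ℝ) ^ ε := by
  rw [Nat.multiplicative_factorization h hh.mul hh.one hn]
  calc n.factorization.prod (fun p k => h (p ^ k))
      ≤ ∏ p ∈ n.primeFactors, ((if p ≤ P then D else 1) *
          ((p ^ n.factorization p : ℕ) : ℝ) ^ ε) := by
        refine prod_le_prod (fun _ _ => hh.nonneg _) fun p hp => ?_
        have hp' := Nat.prime_of_mem_primeFactors hp
        split_ifs with hpP
        · exact h1 p _ hp'
        · rw [one_mul]; exact h2 p _ hp' (by omega)
    _ = (∏ p ∈ n.primeFactors, if p ≤ P then D else 1) *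
          ∏ p ∈ n.primeFactors, ((p ^ n.factorization p : ℕ) : ℝ) ^ ε := prod_mul_distrib
    _ ≤ D ^ (P + 1) * (n : ℝ) ^ ε := by
        have e1 : ∏ p ∈ n.primeFactors, ((p ^ n.factorization p : ℕ) : ℝ) ^ ε = (n : ℝ) ^ ε := by
          rw [Real.finsetProd_rpow _ _ (fun _ _ => by positivity), ← Nat.cast_prod]
          congr 2
          exact Nat.prod_factorization_pow_eq_self hn
        rw [e1]
        gcongr
        rw [← prod_filter, prod_const]
        refine pow_le_pow_right₀ hD ?_
        calc #{p ∈ n.primeFactors | p ≤ P} ≤ #(range (P + 1)) := by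
              refine card_le_card fun p hp => ?_
              rw [mem_filter] at hp
              rw [mem_range]; omega
          _ = P + 1 := card_range _

section Recursion
variable {u : ℕ → ℝ} {κ K : ℝ}

lemma recursion_le_pow (h0 : u 0 = 1) (hK : 1 ≤ K)
    (hκK : κ ≤ K) (hκ : 0 ≤ κ)
    (hu : ∀ e : ℕ, (e : ℝ) * u e ≤ κ * ∑ i ∈ range e, u i) (e : ℕ) : u e ≤ K ^ e := by
  induction e using Nat.strong_induction_on with
  | _ e ih =>
    rcases Nat.eq_zero_or_pos e with rfl | he
    · simp [h0]
    · have he' : (0 : ℝ) < e := by exact_mod_cast he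
      refine le_of_mul_le_mul_left ((hu e).trans ?_) he'
      calc κ * ∑ i ∈ range e, u i ≤ K * ∑ i ∈ range e, K ^ (e - 1) := by
            have : ∑ i ∈ range e, u i ≤ ∑ i ∈ range e, K ^ (e - 1) := by
              refine sum_le_sum fun i hi => (ih i (mem_range.1 hi)).trans ?_
              exact pow_le_pow_right₀ hK (by have := mem_range.1 hi; omega)
            calc κ * ∑ i ∈ range e, u i ≤ κ * ∑ i ∈ range e, K ^ (e - 1) := by gcongr
              _ ≤ _ := by gcongr
        _ = e * K ^ e := by
            rw [sum_const, card_range, nsmul_eq_mul]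
            obtain ⟨k, rfl⟩ := Nat.exists_eq_succ_of_ne_zero he.ne'
            simp only [Nat.succ_eq_add_one, Nat.add_sub_cancel, pow_succ]
            ring

lemma recursion_le_geom (h0 : u 0 = 1) (hK : 1 ≤ K)
    (hκK : κ ≤ K) (hκ : 0 ≤ κ)
    (hu : ∀ e : ℕ, (e : ℝ) * u e ≤ κ * ∑ i ∈ range e, u i) {r : ℝ} (hr : 1 < r) {e0 : ℕ}
    (he0 : κ ≤ e0 * (r - 1)) (e : ℕ) : u e ≤ K ^ e0 * r ^ e := by
  induction e using Nat.strong_induction_on with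
  | _ e ih =>
    rcases lt_or_ge e e0 with he | he
    · calc u e ≤ K ^ e := recursion_le_pow h0 hK hκK hκ hu e
        _ ≤ K ^ e0 * 1 := by rw [mul_one]; exact pow_le_pow_right₀ hK he.le
        _ ≤ _ := by
          gcongr
          exact one_le_pow₀ hr.le
    rcases Nat.eq_zero_or_pos e with rfl | hepos
    · rw [h0, pow_zero, mul_one]
      exact one_le_pow₀ hK
    · have he' : (0 : ℝ) < e := by exact_mod_cast hepos
      have hr1 : 0 < r - 1 := by linarith
      refine le_of_mul_le_mul_left ((hu e).trans ?_) he'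
      calc κ * ∑ i ∈ range e, u i ≤ κ * ∑ i ∈ range e, K ^ e0 * r ^ i := by
            gcongr with i hi
            exact ih i (mem_range.1 hi)
        _ = κ * K ^ e0 * ((r ^ e - 1) / (r - 1)) := by
            rw [← mul_sum, geom_sum_eq hr.ne']; ring
        _ ≤ (e * (r - 1)) * K ^ e0 * (r ^ e / (r - 1)) := by
            have : (e0 : ℝ) ≤ e := by exact_mod_cast he
            have h1 : 1 ≤ r ^ e := one_le_pow₀ hr.le
            have h2 : κ ≤ e * (r - 1) := he0.trans (by gcongr)
            have h3 : 0 ≤ (r ^ e - 1) / (r - 1) := div_nonneg (by linarith) hr1.le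
            gcongr
            linarith
        _ = _ := by field_simp

end Recursion

section ClassBounds
variable {κ : ℝ} {f Λf : ℕ → ℂ}

lemma _root_.IsHalaszClass.isNonnegMult (hf : IsHalaszClass κ f Λf) : IsNonnegMult fun n => ‖f n‖ where
  nonneg _ := norm_nonneg _
  one := by simp [hf.map_one]
  mul m n h := by simp [hf.mult m n h]

lemma _root_.IsHalaszClass.recursion (hf : IsHalaszClass κ f Λf) {p : ℕ} (hp : p.Prime) (e : ℕ) :
    (e : ℝ) * ‖f (p ^ e)‖ ≤ κ * ∑ i ∈ range e, ‖f (p ^ i)‖ := by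
  have hlp : 0 < Real.log p := Real.log_pos (by exact_mod_cast hp.one_lt)
  have h := hf.conv (p ^ e) (Nat.one_le_pow _ _ hp.pos)
  rw [Nat.sum_divisors_prime_pow hp, sum_range_succ', pow_zero, hf.supp 1 not_isPrimePow_one,
    zero_mul, add_zero] at h
  have h' := congrArg norm h
  rw [norm_mul] at h'
  have e1 : ‖(Real.log ((p ^ e : ℕ) : ℝ) : ℂ)‖ = e * Real.log p := by
    rw [Complex.norm_real]
    push_cast
    rw [Real.log_pow, Real.norm_of_nonneg (by positivity)]
  rw [e1] at h'
  refine le_of_mul_le_mul_right ?_ hlp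
  calc (e : ℝ) * ‖f (p ^ e)‖ * Real.log p = ‖f (p ^ e)‖ * (e * Real.log p) := by ring
    _ = _ := h'
    _ ≤ ∑ k ∈ range e, ‖Λf (p ^ (k + 1)) * f (p ^ e / p ^ (k + 1))‖ := norm_sum_le _ _
    _ ≤ ∑ k ∈ range e, κ * Real.log p * ‖f (p ^ (e - 1 - k))‖ := by
        refine sum_le_sum fun k hk => ?_
        rw [mem_range] at hk
        rw [norm_mul, Nat.pow_div (by omega) hp.pos, show e - (k + 1) = e - 1 - k by omega]
        gcongr
        refine (hf.bound _ (Nat.one_le_pow _ _ hp.pos)).trans (le_of_eq ?_)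
        rw [ArithmeticFunction.vonMangoldt_apply_pow (by omega),
          ArithmeticFunction.vonMangoldt_apply_prime hp]
    _ = ∑ k ∈ range e, κ * Real.log p * ‖f (p ^ k)‖ :=
        sum_range_reflect (fun k => κ * Real.log p * ‖f (p ^ k)‖) e
    _ = _ := by rw [← mul_sum]; ring

lemma _root_.IsHalaszClass.norm_prime_le (hf : IsHalaszClass κ f Λf) {p : ℕ} (hp : p.Prime) :
    ‖f p‖ ≤ κ := by
  simpa [hf.map_one] using hf.recursion hp 1

lemma _root_.IsHalaszClass.norm_pow_le (hf : IsHalaszClass κ f Λf) (hκ : 0 < κ) {p : ℕ} (hp : p.Prime)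
    (e : ℕ) : ‖f (p ^ e)‖ ≤ (max κ 1) ^ e :=
  recursion_le_pow (u := fun e => ‖f (p ^ e)‖) (by simp [hf.map_one]) (le_max_right _ _)
    (le_max_left _ _) hκ.le (hf.recursion hp) e

lemma exists_norm_le_rpow (hκ : 0 < κ) {ε : ℝ} (hε : 0 < ε) : ∃ C : ℝ, 1 ≤ C ∧
    ∀ f Λf : ℕ → ℂ, IsHalaszClass κ f Λf → ∀ n : ℕ, n ≠ 0 → ‖f n‖ ≤ C * (n : ℝ) ^ ε := by
  set K := max κ 1
  have hK : 1 ≤ K := le_max_right _ _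
  have hr : 1 < (2 : ℝ) ^ ε := Real.one_lt_rpow (by norm_num) hε
  obtain ⟨e0, he0⟩ := exists_nat_ge (κ / ((2 : ℝ) ^ ε - 1))
  rw [div_le_iff₀ (by linarith)] at he0
  set P := ⌈K ^ (1 / ε)⌉₊
  refine ⟨(K ^ e0) ^ (P + 1), one_le_pow₀ (one_le_pow₀ hK), fun f Λf hf n hn => ?_⟩
  refine hf.isNonnegMult.le_rpow (one_le_pow₀ hK) (fun p e hp => ?_) (fun p e hp hpP => ?_) hn
  · refine (recursion_le_geom (u := fun e => ‖f (p ^ e)‖) (by simp [hf.map_one]) hK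
      (le_max_left _ _) hκ.le (hf.recursion hp) hr he0 e).trans ?_
    rw [rpow_pow_eq]
    have : (2 : ℝ) ≤ p := by exact_mod_cast hp.two_le
    gcongr
  · refine (hf.norm_pow_le hκ hp e).trans ?_
    rw [rpow_pow_eq]
    have h1 : K ^ (1 / ε) ≤ p := (Nat.le_ceil _).trans (by exact_mod_cast hpP.le)
    have h2 : K ≤ (p : ℝ) ^ ε := by
      calc K = (K ^ (1 / ε)) ^ ε := by
            rw [← Real.rpow_mul (by linarith), one_div_mul_cancel hε.ne', Real.rpow_one]
        _ ≤ _ := by gcongr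
    gcongr

end ClassBounds

/-- The weight `a^c b^d` where `n = a b` with `a` `y`-smooth and `b` `y`-rough. -/
def wt (y : ℕ) (c d : ℝ) (n : ℕ) : ℝ := (sm y n : ℝ) ^ c * (ro y n : ℝ) ^ d

lemma wt_nonneg (y : ℕ) (c d : ℝ) (n : ℕ) : 0 ≤ wt y c d n := by
  unfold wt; positivity

lemma ro_one (y : ℕ) : ro y 1 = 1 := by simp [ro]

lemma wt_one (y : ℕ) (c d : ℝ) : wt y c d 1 = 1 := by simp [wt, ro_one]

lemma wt_mul {y : ℕ} {c d : ℝ} {m n : ℕ} (hm : m ≠ 0) (hn : n ≠ 0) :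
    wt y c d (m * n) = wt y c d m * wt y c d n := by
  unfold wt
  rw [sm_mul hm hn, ro_mul hm hn]
  push_cast
  rw [Real.mul_rpow (by positivity) (by positivity), Real.mul_rpow (by positivity) (by positivity)]
  ring

lemma IsNonnegMult.mul_wt {h : ℕ → ℝ} (hh : IsNonnegMult h) (y : ℕ) (c d : ℝ) :
    IsNonnegMult fun n => h n * wt y c d n where
  nonneg n := mul_nonneg (hh.nonneg n) (wt_nonneg _ _ _ _)
  one := by simp [hh.one, wt_one]
  mul m n hmn := by
    rcases Nat.eq_zero_or_pos m with rfl | hm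
    · rw [Nat.coprime_zero_left] at hmn
      subst hmn
      simp [hh.one, wt_one]
    rcases Nat.eq_zero_or_pos n with rfl | hn
    · rw [Nat.coprime_zero_right] at hmn
      subst hmn
      simp [hh.one, wt_one]
    rw [hh.mul m n hmn, wt_mul hm.ne' hn.ne']
    ring

lemma IsNonnegMult.mul_rpow {h : ℕ → ℝ} (hh : IsNonnegMult h) (c : ℝ) :
    IsNonnegMult fun n => h n * (n : ℝ) ^ c where
  nonneg n := mul_nonneg (hh.nonneg n) (by positivity)
  one := by simp [hh.one]
  mul m n hmn := by
    rw [hh.mul m n hmn]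
    push_cast
    rw [Real.mul_rpow (by positivity) (by positivity)]
    ring

lemma wt_prime_pow_of_le {y : ℕ} {c d : ℝ} {p : ℕ} (hp : p.Prime) (h : p ≤ y) (e : ℕ) :
    wt y c d (p ^ e) = ((p ^ e : ℕ) : ℝ) ^ c := by
  have : 0 < p ^ e := Nat.pow_pos hp.pos
  rw [wt, ro, sm_prime_pow_of_le hp h, Nat.div_self this]
  simp

lemma wt_prime_pow_of_lt {y : ℕ} {c d : ℝ} {p : ℕ} (hp : p.Prime) (h : y < p) (e : ℕ) :
    wt y c d (p ^ e) = ((p ^ e : ℕ) : ℝ) ^ d := by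
  rw [wt, ro, sm_prime_pow_of_lt hp h, Nat.div_one]
  simp

lemma wt_le {y : ℕ} {c d : ℝ} (hc : 0 ≤ c) (hd : d ≤ 0) {n : ℕ} (hn : n ≠ 0) :
    wt y c d n ≤ (n : ℝ) ^ c := by
  have h1 : (1 : ℝ) ≤ ro y n := by exact_mod_cast ro_pos hn
  have h2 : (sm y n : ℝ) ≤ n := by exact_mod_cast sm_le hn
  calc wt y c d n ≤ (n : ℝ) ^ c * 1 := by
        unfold wt
        gcongr
        exact Real.rpow_le_one_of_one_le_of_nonpos h1 hd
    _ = _ := mul_one _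

lemma IsNonnegMult.le_of_rough {g : ℕ → ℝ} (hg : IsNonnegMult g) {K : ℝ} (hK : 1 ≤ K)
    (hgK : ∀ p e : ℕ, p.Prime → g (p ^ e) ≤ K ^ e) {t : ℝ} (ht : 1 < t) {v : ℕ} (hv : v ≠ 0)
    (hvt : ∀ p : ℕ, p.Prime → p ∣ v → t ≤ p) :
    g v ≤ (v : ℝ) ^ (Real.log K / Real.log t) := by
  set c := Real.log K / Real.log t with hc
  have hlt : 0 < Real.log t := Real.log_pos ht
  have hc0 : 0 ≤ c := div_nonneg (Real.log_nonneg hK) hlt.le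
  have htc : t ^ c = K := by
    rw [Real.rpow_def_of_pos (by linarith), hc, mul_div_cancel₀ _ hlt.ne', Real.exp_log (by linarith)]
  rw [Nat.multiplicative_factorization g hg.mul hg.one hv]
  calc v.factorization.prod (fun p k => g (p ^ k))
      ≤ ∏ p ∈ v.primeFactors, ((p ^ v.factorization p : ℕ) : ℝ) ^ c := by
        refine prod_le_prod (fun _ _ => hg.nonneg _) fun p hp => ?_
        have hp' := Nat.prime_of_mem_primeFactors hp
        refine (hgK p _ hp').trans ?_
        rw [rpow_pow_eq]
        have : K ≤ (p : ℝ) ^ c := by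
          rw [← htc]
          have := hvt p hp' (Nat.dvd_of_mem_primeFactors hp)
          gcongr
        gcongr
    _ = (v : ℝ) ^ c := by
        rw [Real.finsetProd_rpow _ _ (fun _ _ => by positivity), ← Nat.cast_prod]
        congr 2
        exact Nat.prod_factorization_pow_eq_self hv

lemma cast_div_sub_div_le (a L : ℕ) {u : ℕ} (hu : 0 < u) :
    (((a + L) / u : ℕ) : ℝ) - ((a / u : ℕ) : ℝ) ≤ (L : ℝ) / u + 1 := by
  have hu' : (0 : ℝ) < u := by exact_mod_cast hu
  have h1 : (((a + L) / u : ℕ) : ℝ) ≤ ((a + L : ℕ) : ℝ) / u := Nat.cast_div_le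
  have h2 : (a : ℝ) / u < ((a / u : ℕ) : ℝ) + 1 := by
    have := Nat.lt_floor_add_one ((a : ℝ) / u)
    rwa [Nat.floor_div_natCast, Nat.floor_natCast] at this
  push_cast at h1
  rw [add_div] at h1
  linarith

lemma card_rough_Ioc_div_le (a L : ℕ) {u w : ℕ} (hu : 0 < u) (hw : 2 ≤ w) :
    (#{v ∈ Ioc (a / u) ((a + L) / u) | ∀ p : ℕ, p.Prime → p ≤ w → ¬ p ∣ v} : ℝ) ≤
      ((L : ℝ) / u + 1) / Real.log w + (w : ℝ) ^ 4 := by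
  have hlw : 0 < Real.log w := Real.log_pos (by exact_mod_cast hw)
  refine (card_rough_le w _ _ (Nat.div_le_div_right (by omega)) hw).trans ?_
  have := cast_div_sub_div_le a L hu
  gcongr

lemma IsNonnegMult.sum_block_le {g : ℕ → ℝ} (hg : IsNonnegMult g) {a L w : ℕ} (hw : 2 ≤ w)
    {U S : Finset ℕ} {V : ℝ} (hV0 : 0 ≤ V) (hU : ∀ u ∈ U, 0 < u) (hSI : S ⊆ Ioc a (a + L))
    (hS : ∀ n ∈ S, ∃ u ∈ U, ∃ v, n = u * v ∧ u.Coprime v ∧ ∀ p : ℕ, p.Prime → p ∣ v → w < p)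
    (hV : ∀ v, 0 < v → v ≤ a + L → (∀ p : ℕ, p.Prime → p ∣ v → w < p) → g v ≤ V) :
    ∑ n ∈ S, g n ≤ V * ∑ u ∈ U, g u * (((L : ℝ) / u + 1) / Real.log w + (w : ℝ) ^ 4) := by
  let R : ℕ → ℕ → Prop := fun u n => ∃ v, n = u * v ∧ u.Coprime v ∧
    ∀ p : ℕ, p.Prime → p ∣ v → w < p
  calc ∑ n ∈ S, g n ≤ ∑ n ∈ S, ∑ u ∈ U, if R u n then V * g u else 0 := by
        refine sum_le_sum fun n hn => ?_
        obtain ⟨u, hu, v, hn', hc, hr⟩ := hS n hn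
        refine le_trans ?_ (single_le_sum (f := fun u => if R u n then V * g u else 0)
          (fun i _ => ?_) hu)
        · have hRu : R u n := ⟨v, hn', hc, hr⟩
          simp only [hRu, if_true]
          have h1 := mem_Ioc.1 (hSI hn)
          have hv : 0 < v := by
            rcases Nat.eq_zero_or_pos v with h | h
            · subst h; omega
            · exact h
          have hvn : v ≤ n := by rw [hn']; exact Nat.le_mul_of_pos_left v (hU u hu)
          rw [hn', hg.mul u v hc, mul_comm]
          exact mul_le_mul_of_nonneg_right (hV v hv (by omega) hr) (hg.nonneg _)
        · have := hg.nonneg i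
          split_ifs <;> positivity
    _ = ∑ u ∈ U, V * g u * #{n ∈ S | R u n} := by
        rw [sum_comm]
        refine sum_congr rfl fun u _ => ?_
        rw [← sum_filter, sum_const, nsmul_eq_mul, mul_comm]
    _ ≤ ∑ u ∈ U, V * g u * (((L : ℝ) / u + 1) / Real.log w + (w : ℝ) ^ 4) := by
        refine sum_le_sum fun u hu => ?_
        have hu' := hU u hu
        refine mul_le_mul_of_nonneg_left ?_ (mul_nonneg hV0 (hg.nonneg u))
        refine le_trans ?_ (card_rough_Ioc_div_le a L hu' hw)
        norm_cast
        refine le_trans (card_le_card (t := image (u * ·)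
          {v ∈ Ioc (a / u) ((a + L) / u) | ∀ p : ℕ, p.Prime → p ≤ w → ¬ p ∣ v}) ?_) card_image_le
        intro n hn
        rw [mem_filter] at hn
        obtain ⟨hnS, v, hn', hc, hr⟩ := hn
        have h1 := mem_Ioc.1 (hSI hnS)
        rw [mem_image]
        refine ⟨v, ?_, hn'.symm⟩
        rw [mem_filter, mem_Ioc, Nat.div_lt_iff_lt_mul hu', Nat.le_div_iff_mul_le hu', mul_comm v]
        refine ⟨by omega, fun p hp hpw hpv => ?_⟩
        have := hr p hp hpv
        omega
    _ = _ := by rw [mul_sum]; exact sum_congr rfl fun u _ => by ring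

lemma card_dvd_Ioc_le (a L : ℕ) {d : ℕ} (hd : 0 < d) :
    (#{n ∈ Ioc a (a + L) | d ∣ n} : ℝ) ≤ (L : ℝ) / d + 1 := by
  refine le_trans ?_ (cast_div_sub_div_le a L hd)
  rw [← Nat.cast_sub (Nat.div_le_div_right (by omega)), ← Nat.card_Ioc]
  norm_cast
  refine le_trans (card_le_card (t := image (d * ·) (Ioc (a / d) ((a + L) / d))) ?_) card_image_le
  intro n hn
  rw [mem_filter, mem_Ioc] at hn
  obtain ⟨h1, v, rfl⟩ := hn
  rw [mem_image]
  refine ⟨v, ?_, rfl⟩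
  rw [mem_Ioc, Nat.div_lt_iff_lt_mul hd, Nat.le_div_iff_mul_le hd, mul_comm v]
  exact h1

lemma sum_dvd_le {g : ℕ → ℝ} {a L : ℕ} {D S : Finset ℕ} {V : ℝ} (hV0 : 0 ≤ V)
    (hD : ∀ d ∈ D, 0 < d) (hSI : S ⊆ Ioc a (a + L)) (hS : ∀ n ∈ S, ∃ d ∈ D, d ∣ n)
    (hV : ∀ n ∈ S, g n ≤ V) :
    ∑ n ∈ S, g n ≤ V * ∑ d ∈ D, ((L : ℝ) / d + 1) := by
  calc ∑ n ∈ S, g n ≤ ∑ n ∈ S, ∑ d ∈ D, if d ∣ n then V else 0 := by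
        refine sum_le_sum fun n hn => ?_
        obtain ⟨d, hd, hdn⟩ := hS n hn
        refine le_trans ?_ (single_le_sum (f := fun d => if d ∣ n then V else 0)
          (fun i _ => ?_) hd)
        · simp only [hdn, if_true]; exact hV n hn
        · split_ifs <;> positivity
    _ = ∑ d ∈ D, V * #{n ∈ S | d ∣ n} := by
        rw [sum_comm]
        refine sum_congr rfl fun u _ => ?_
        rw [← sum_filter, sum_const, nsmul_eq_mul, mul_comm]
    _ ≤ ∑ d ∈ D, V * ((L : ℝ) / d + 1) := by
        refine sum_le_sum fun d hd => ?_
        refine mul_le_mul_of_nonneg_left ?_ hV0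
        refine le_trans ?_ (card_dvd_Ioc_le a L (hD d hd))
        norm_cast
        exact card_le_card (filter_subset_filter _ hSI)
    _ = _ := by rw [mul_sum]

lemma sum_le_sum_cover {ι : Type*} {g : ℕ → ℝ} (hg : ∀ n, 0 ≤ g n) (I : Finset ℕ) (J : Finset ι)
    (P : ι → ℕ → Prop) [∀ j, DecidablePred (P j)] (h : ∀ n ∈ I, ∃ j ∈ J, P j n) :
    ∑ n ∈ I, g n ≤ ∑ j ∈ J, ∑ n ∈ I with P j n, g n := by
  simp only [sum_filter]
  rw [sum_comm]
  refine sum_le_sum fun n hn => ?_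
  obtain ⟨j, hj, hP⟩ := h n hn
  refine le_trans ?_ (single_le_sum (f := fun j => if P j n then g n else 0)
    (fun i _ => ?_) hj)
  · simp [hP]
  · split_ifs
    · exact hg n
    · exact le_rfl

/-- The least cut-off at which the smooth part of `n` exceeds `W`. -/
lemma exists_cutoff {W z n : ℕ} (hW : 1 ≤ W) (hz : W < sm z n)
    (hpow : ∀ p : ℕ, p.Prime → p ≤ z → p ^ n.factorization p ≤ W) :
    ∃ q ≤ z, W < sm q n ∧ sm q n ≤ W * W := by
  have hex : ∃ q, W < sm q n := ⟨z, hz⟩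
  have hq := Nat.find_spec hex
  have hqz : Nat.find hex ≤ z := Nat.find_min' hex hz
  refine ⟨Nat.find hex, hqz, hq, ?_⟩
  rcases hfind : Nat.find hex with _ | m
  · rw [hfind, sm_zero] at hq; omega
  · have hm : sm m n ≤ W := by
      have := Nat.find_min hex (m := m) (by omega)
      omega
    rw [sm_succ]
    refine Nat.mul_le_mul hm ?_
    split_ifs with h
    · exact hpow _ h (by omega)
    · exact hW

lemma exists_between_of_le {z : ℕ → ℕ} {q : ℕ} (h1 : q ≤ z 1) (J : ℕ) (hJ : z (J + 1) < q) :
    ∃ j ∈ Icc 1 J, z (j + 1) < q ∧ q ≤ z j := by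
  induction J with
  | zero => simp at hJ; omega
  | succ J ih =>
    rcases lt_or_ge (z (J + 1)) q with h | h
    · obtain ⟨j, hj, hj'⟩ := ih h
      rw [mem_Icc] at hj
      exact ⟨j, mem_Icc.2 (by omega), hj'⟩
    · exact ⟨J + 1, by simp, hJ, h⟩

lemma exp_le_one_add_mul_exp (x : ℝ) : Real.exp x ≤ 1 + x * Real.exp x := by
  have h := Real.add_one_le_exp (-x)
  have h2 : Real.exp (-x) * Real.exp x = 1 := by rw [← Real.exp_add]; simp
  nlinarith [Real.exp_pos x]

lemma IsNonnegMult.sum_smooth_rpow_le {g : ℕ → ℝ} (hg : IsNonnegMult g) {K C₀ ρ B l : ℝ}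
    (hC₀ : 0 ≤ C₀) (hgp : ∀ p : ℕ, p.Prime → g p ≤ K)
    (hgC : ∀ n : ℕ, n ≠ 0 → g n ≤ C₀ * (n : ℝ) ^ (1 / 100 : ℝ)) (hρ0 : 0 ≤ ρ) (hρ : ρ ≤ 1 / 4)
    (hl : 1 ≤ l) (hρl : ρ * l ≤ B) {N a : ℕ} (hNa : N ≤ a) (hNl : Real.log N ≤ l)
    {U : Finset ℕ} (hU : ∀ u ∈ U, u ∈ Nat.smoothNumbers (N + 1)) :
    ∑ u ∈ U, g u * (u : ℝ) ^ (-1 + ρ) ≤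
      Real.exp (7 * K * B * Real.exp B + powConst C₀) *
        Real.exp (∑ p ∈ (a + 1).primesBelow, g p / p) := by
  have hK : 0 ≤ K := (hg.nonneg 2).trans (hgp 2 Nat.prime_two)
  have hB : 0 ≤ B := (mul_nonneg hρ0 (by linarith)).trans hρl
  refine ((hg.mul_rpow (-1 + ρ)).sum_smooth_le hC₀ (fun p e hp _ => ?_) (N + 1) U hU).trans ?_
  · have h0 : p ^ e ≠ 0 := pow_ne_zero _ hp.ne_zero
    have h1 : (1 : ℝ) ≤ ((p ^ e : ℕ) : ℝ) := by exact_mod_cast Nat.one_le_iff_ne_zero.2 h0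
    calc g (p ^ e) * ((p ^ e : ℕ) : ℝ) ^ (-1 + ρ)
        ≤ C₀ * ((p ^ e : ℕ) : ℝ) ^ (1 / 100 : ℝ) * ((p ^ e : ℕ) : ℝ) ^ (-1 + ρ) := by
          gcongr
          exact hgC _ h0
      _ = C₀ * ((p ^ e : ℕ) : ℝ) ^ (1 / 100 + (-1 + ρ)) := by
          rw [mul_assoc, ← Real.rpow_add (by linarith)]
      _ ≤ _ := by
          gcongr
          linarith
  · rw [← Real.exp_add]
    refine Real.exp_le_exp.2 ?_
    have key : ∀ p ∈ (N + 1).primesBelow, g p * (p : ℝ) ^ (-1 + ρ) ≤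
        g p / p + K * ρ * Real.exp B * (Real.log p / p) := by
      intro p hp
      have hp' := Nat.prime_of_mem_primesBelow hp
      have hp0 : (0 : ℝ) < p := by exact_mod_cast hp'.pos
      have hpN : (p : ℝ) ≤ N := by
        have := Nat.lt_of_mem_primesBelow hp
        exact_mod_cast (by omega : p ≤ N)
      have hlp : Real.log p ≤ l := (Real.log_le_log hp0 hpN).trans hNl
      have hlp0 : 0 ≤ Real.log p := Real.log_natCast_nonneg p
      have hx : Real.log p * ρ ≤ B := by nlinarith
      have h2 : (p : ℝ) ^ ρ ≤ 1 + Real.log p * ρ * Real.exp B := by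
        rw [Real.rpow_def_of_pos hp0]
        refine (exp_le_one_add_mul_exp _).trans ?_
        gcongr
      have h3 : (p : ℝ) ^ (-1 + ρ) = (p : ℝ) ^ ρ / p := by
        rw [Real.rpow_add hp0, Real.rpow_neg_one]; ring
      have hgp0 := hg.nonneg p
      calc g p * (p : ℝ) ^ (-1 + ρ) = g p / p * (p : ℝ) ^ ρ := by rw [h3]; ring
        _ ≤ g p / p * (1 + Real.log p * ρ * Real.exp B) := by gcongr
        _ = g p / p + g p * ρ * Real.exp B * (Real.log p / p) := by ring
        _ ≤ _ := by
          have := hgp p hp'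
          gcongr
    have hsub : (N + 1).primesBelow ⊆ (a + 1).primesBelow := by
      intro p hp
      rw [Nat.mem_primesBelow] at hp ⊢
      exact ⟨by omega, hp.2⟩
    calc ∑ p ∈ (N + 1).primesBelow, g p * (p : ℝ) ^ (-1 + ρ) + powConst C₀
        ≤ (∑ p ∈ (N + 1).primesBelow, g p / p +
          K * ρ * Real.exp B * ∑ p ∈ (N + 1).primesBelow, Real.log p / p) + powConst C₀ := by
          rw [mul_sum, ← sum_add_distrib]
          gcongr with p hp
          exact key p hp
      _ ≤ (∑ p ∈ (a + 1).primesBelow, g p / p + K * ρ * Real.exp B * (7 * l)) + powConst C₀ := by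
          gcongr
          · exact fun p _ _ => div_nonneg (hg.nonneg p) (Nat.cast_nonneg p)
          · refine sum_prime_log_div_le hl fun p hp => ?_
            have hp' := Nat.prime_of_mem_primesBelow hp
            refine ⟨hp', le_trans (Real.log_le_log (by exact_mod_cast hp'.pos) ?_) hNl⟩
            have := Nat.lt_of_mem_primesBelow hp
            exact_mod_cast (by omega : p ≤ N)
      _ ≤ _ := by
          have : K * ρ * Real.exp B * (7 * l) ≤ 7 * K * B * Real.exp B := by
            calc K * ρ * Real.exp B * (7 * l) = 7 * K * Real.exp B * (ρ * l) := by ring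
              _ ≤ 7 * K * Real.exp B * B := by gcongr
              _ = _ := by ring
          linarith

lemma IsNonnegMult.sum_rough_part_le {g : ℕ → ℝ} (hg : IsNonnegMult g) {K : ℝ} (hK : 1 ≤ K)
    (hgK : ∀ p e : ℕ, p.Prime → g (p ^ e) ≤ K ^ e) {a L w j : ℕ} (ha : 101 ≤ a)
    (haL : (a : ℝ) ^ (2 / 5 : ℝ) ≤ L) (hLa : L ≤ 100 * a) (hw : 2 ≤ w)
    (hwa : (w : ℝ) ≤ (a : ℝ) ^ (1 / 50 : ℝ))
    (haw : Real.exp (Real.log a / (50 * (j + 1))) ≤ w + 1)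
    {U S : Finset ℕ} (hU : ∀ u ∈ U, 0 < u ∧ (u : ℝ) ≤ (a : ℝ) ^ (1 / 5 : ℝ))
    (hSI : S ⊆ Ioc a (a + L))
    (hS : ∀ n ∈ S, ∃ u ∈ U, ∃ v, n = u * v ∧ u.Coprime v ∧ ∀ p : ℕ, p.Prime → p ∣ v → w < p) :
    ∑ n ∈ S, g n ≤ 300 * (j + 1) * K ^ (100 * (j + 1)) * (L / Real.log a) *
      ∑ u ∈ U, g u * (u : ℝ) ^ (-1 : ℝ) := by
  have ha' : (101 : ℝ) ≤ a := by exact_mod_cast ha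
  have ha0 : (0 : ℝ) < a := by linarith
  have hA : 0 < Real.log a := Real.log_pos (by linarith)
  have hw' : (2 : ℝ) ≤ w := by exact_mod_cast hw
  have hlw : 0 < Real.log w := Real.log_pos (by linarith)
  set t := Real.exp (Real.log a / (50 * (j + 1))) with ht
  have hlt : Real.log t = Real.log a / (50 * (j + 1)) := by rw [ht, Real.log_exp]
  have ht1 : 1 < t := Real.one_lt_exp_iff.2 (by positivity)
  have hlw2 : Real.log a / (100 * (j + 1)) ≤ Real.log w := by
    have h1 : Real.log t ≤ Real.log ((w : ℝ) ^ 2) :=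
      Real.log_le_log (by linarith) (haw.trans (by nlinarith))
    rw [hlt, Real.log_pow] at h1
    have : Real.log a / (100 * (j + 1)) = Real.log a / (50 * (j + 1)) / 2 := by
      field_simp; norm_num
    rw [this]
    push_cast at h1
    linarith
  have hV : ∀ v, 0 < v → v ≤ a + L → (∀ p : ℕ, p.Prime → p ∣ v → w < p) →
      g v ≤ K ^ (100 * (j + 1)) := by
    intro v hv hva hvr
    refine (hg.le_of_rough hK hgK ht1 hv.ne' fun p hp hpv => haw.trans ?_).trans ?_
    · exact_mod_cast hvr p hp hpv
    · have h1 : (v : ℝ) ≤ (a : ℝ) ^ 2 := by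
        have : v ≤ a ^ 2 := by nlinarith
        exact_mod_cast this
      have hv0 : (0 : ℝ) < v := by exact_mod_cast hv
      have hc0 : 0 ≤ Real.log K / Real.log t := div_nonneg (Real.log_nonneg hK) (Real.log_pos ht1).le
      calc (v : ℝ) ^ (Real.log K / Real.log t) ≤ ((a : ℝ) ^ 2) ^ (Real.log K / Real.log t) := by
            gcongr
        _ = Real.exp (Real.log K * (100 * (j + 1) : ℕ)) := by
            rw [Real.rpow_def_of_pos (by positivity), Real.log_pow, hlt]
            congr 1
            push_cast
            field_simp
            ring
        _ = _ := by
            rw [← Real.rpow_def_of_pos (by linarith), Real.rpow_natCast]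
  refine (hg.sum_block_le hw (by positivity) (fun u hu => (hU u hu).1) hSI hS hV).trans ?_
  rw [mul_sum, mul_sum]
  refine sum_le_sum fun u hu => ?_
  obtain ⟨hu0, hua⟩ := hU u hu
  have hu0' : (0 : ℝ) < u := by exact_mod_cast hu0
  have hLu : (a : ℝ) ^ (1 / 5 : ℝ) ≤ (L : ℝ) / u := by
    rw [le_div_iff₀ hu0']
    calc (a : ℝ) ^ (1 / 5 : ℝ) * u ≤ (a : ℝ) ^ (1 / 5 : ℝ) * (a : ℝ) ^ (1 / 5 : ℝ) := by gcongr
      _ = (a : ℝ) ^ (2 / 5 : ℝ) := by rw [← Real.rpow_add ha0]; norm_num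
      _ ≤ L := haL
  have h1 : 1 ≤ (L : ℝ) / u := le_trans (Real.one_le_rpow (by linarith) (by norm_num)) hLu
  have h2 : (w : ℝ) ^ 4 * Real.log w ≤ (L : ℝ) / u := by
    calc (w : ℝ) ^ 4 * Real.log w ≤ (w : ℝ) ^ 4 * w := by
          gcongr
          exact (Real.log_le_sub_one_of_pos (by linarith)).trans (by linarith)
      _ = (w : ℝ) ^ 5 := by ring
      _ ≤ ((a : ℝ) ^ (1 / 50 : ℝ)) ^ 5 := by gcongr
      _ = (a : ℝ) ^ (1 / 10 : ℝ) := by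
          rw [← Real.rpow_natCast, ← Real.rpow_mul ha0.le]; norm_num
      _ ≤ (a : ℝ) ^ (1 / 5 : ℝ) := Real.rpow_le_rpow_of_exponent_le (by linarith) (by norm_num)
      _ ≤ _ := hLu
  have h3 : ((L : ℝ) / u + 1) / Real.log w + (w : ℝ) ^ 4 ≤
      300 * (j + 1) * (L / Real.log a) * (u : ℝ) ^ (-1 : ℝ) := by
    calc ((L : ℝ) / u + 1) / Real.log w + (w : ℝ) ^ 4
        = ((L : ℝ) / u + 1 + (w : ℝ) ^ 4 * Real.log w) / Real.log w := by field_simp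
      _ ≤ (3 * ((L : ℝ) / u)) / (Real.log a / (100 * (j + 1))) := by
          gcongr
          linarith
      _ = _ := by
          rw [Real.rpow_neg_one]
          field_simp
          ring
  calc K ^ (100 * (j + 1)) * (g u * (((L : ℝ) / u + 1) / Real.log w + (w : ℝ) ^ 4))
      ≤ K ^ (100 * (j + 1)) * (g u * (300 * (j + 1) * (L / Real.log a) * (u : ℝ) ^ (-1 : ℝ))) := by
        have := hg.nonneg u
        gcongr
    _ = _ := by ring

section Shiu

/-- `⌊a^(1/(50 j))⌋`. -/
def zlev (a j : ℕ) : ℕ := ⌊Real.exp (Real.log a / (50 * j))⌋₊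

/-- `⌊a^(1/10)⌋`. -/
def wlev (a : ℕ) : ℕ := ⌊(a : ℝ) ^ (1 / 10 : ℝ)⌋₊

variable {g : ℕ → ℝ} {K C₀ : ℝ} {a L : ℕ}

lemma wlev_sq_le (a : ℕ) : ((wlev a * wlev a : ℕ) : ℝ) ≤ (a : ℝ) ^ (1 / 5 : ℝ) := by
  have h : (wlev a : ℝ) ≤ (a : ℝ) ^ (1 / 10 : ℝ) := Nat.floor_le (by positivity)
  push_cast
  calc (wlev a : ℝ) * wlev a ≤ (a : ℝ) ^ (1 / 10 : ℝ) * (a : ℝ) ^ (1 / 10 : ℝ) := by gcongr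
    _ = (a : ℝ) ^ (1 / 5 : ℝ) := by
      rw [← Real.rpow_add_of_nonneg (by positivity) (by norm_num) (by norm_num)]; norm_num

lemma lt_of_wlev_lt {u : ℕ} (h : wlev a < u) : (a : ℝ) ^ (1 / 10 : ℝ) < u :=
  (Nat.floor_lt (by positivity)).1 h

lemma one_le_wlev (ha : 1 ≤ a) : 1 ≤ wlev a := by
  refine Nat.le_floor ?_
  push_cast
  exact Real.one_le_rpow (by exact_mod_cast ha) (by norm_num)

lemma zlev_le (ha : 1 ≤ a) (j : ℕ) : (zlev a (j + 1) : ℝ) ≤ (a : ℝ) ^ (1 / 50 : ℝ) := by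
  have ha' : (1 : ℝ) ≤ a := by exact_mod_cast ha
  refine (Nat.floor_le (by positivity)).trans ?_
  rw [Real.rpow_def_of_pos (by linarith)]
  refine Real.exp_le_exp.2 ?_
  rw [div_eq_mul_one_div]
  have := Real.log_nonneg ha'
  gcongr
  push_cast
  linarith [Nat.cast_nonneg (α := ℝ) j]

lemma exp_le_zlev_add_one (a j : ℕ) :
    Real.exp (Real.log a / (50 * (j + 1))) ≤ zlev a (j + 1) + 1 := by
  have := (Nat.lt_floor_add_one (Real.exp (Real.log a / (50 * (j + 1 : ℕ))))).le
  push_cast at this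
  unfold zlev
  push_cast
  exact this

lemma two_le_zlev {j : ℕ} (h : 50 * ((j : ℝ) + 1) ≤ Real.log a) : 2 ≤ zlev a (j + 1) := by
  refine Nat.le_floor ?_
  push_cast
  have h1 : 1 ≤ Real.log a / (50 * (j + 1)) := by
    rw [le_div_iff₀ (by positivity)]; linarith
  linarith [Real.add_one_le_exp (Real.log a / (50 * (j + 1)))]

lemma log_zlev_le (ha : 1 ≤ a) (j : ℕ) : Real.log (zlev a j) ≤ Real.log a / (50 * j) := by
  have h : (zlev a j : ℝ) ≤ Real.exp (Real.log a / (50 * j)) := Nat.floor_le (by positivity)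
  rcases Nat.eq_zero_or_pos (zlev a j) with h0 | h0
  · rw [h0]
    have := Real.log_nonneg (by exact_mod_cast ha : (1 : ℝ) ≤ a)
    simp only [Nat.cast_zero, Real.log_zero]
    positivity
  · exact (Real.log_le_iff_le_exp (by exact_mod_cast h0)).2 h

lemma zlev_le_self (ha : 1 ≤ a) (j : ℕ) : zlev a (j + 1) ≤ a := by
  have ha' : (1 : ℝ) ≤ a := by exact_mod_cast ha
  have h := zlev_le ha j
  have h2 : (a : ℝ) ^ (1 / 50 : ℝ) ≤ (a : ℝ) ^ (1 : ℝ) :=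
    Real.rpow_le_rpow_of_exponent_le ha' (by norm_num)
  rw [Real.rpow_one] at h2
  exact_mod_cast h.trans h2

lemma IsNonnegMult.sum_smooth_part_small_le (hg : IsNonnegMult g) (hK : 1 ≤ K)
    (hgK : ∀ p e : ℕ, p.Prime → g (p ^ e) ≤ K ^ e) (hC₀ : 0 ≤ C₀)
    (hgC : ∀ n : ℕ, n ≠ 0 → g n ≤ C₀ * (n : ℝ) ^ (1 / 100 : ℝ)) (ha : 101 ≤ a)
    (haL : (a : ℝ) ^ (2 / 5 : ℝ) ≤ L) (hLa : L ≤ 100 * a) (hla : 200 ≤ Real.log a) :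
    ∑ n ∈ Ioc a (a + L) with sm (zlev a 1) n ≤ wlev a, g n ≤
      300 * K ^ 100 * Real.exp (powConst C₀) *
        ((L / Real.log a) * Real.exp (∑ p ∈ (a + 1).primesBelow, g p / p)) := by
  have hz : ((zlev a 1 : ℕ) : ℝ) ≤ (a : ℝ) ^ (1 / 50 : ℝ) := zlev_le (by omega) 0
  set U := {u ∈ Icc 1 (wlev a) | u ∈ Nat.smoothNumbers (zlev a 1 + 1)} with hUdef
  refine (hg.sum_rough_part_le (j := 0) (w := zlev a 1) (U := U) hK hgK ha haL hLa
    (two_le_zlev (by push_cast; linarith)) hz (exp_le_zlev_add_one a 0) (fun u hu => ?_)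
    (filter_subset _ _) fun n hn => ?_).trans ?_
  · rw [hUdef, mem_filter, mem_Icc] at hu
    refine ⟨by omega, le_trans ?_ (wlev_sq_le a)⟩
    have : u ≤ wlev a * wlev a := hu.1.2.trans (Nat.le_mul_self _)
    exact_mod_cast this
  · rw [mem_filter, mem_Ioc] at hn
    have hn0 : n ≠ 0 := by omega
    refine ⟨sm (zlev a 1) n, ?_, ro (zlev a 1) n, (sm_mul_ro hn0).symm, coprime_sm_ro hn0,
      fun p hp hpn => lt_of_prime_dvd_ro hn0 hp hpn⟩
    rw [hUdef, mem_filter, mem_Icc]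
    exact ⟨⟨sm_pos _ _, hn.2⟩, sm_mem_smoothNumbers _ _⟩
  · have h := hg.sum_smooth_rpow_le (K := K) (ρ := 0) (B := 0) (l := max 1 (Real.log (zlev a 1)))
      (N := zlev a 1) (a := a) (U := U) hC₀
      (fun p hp => by simpa using hgK p 1 hp) hgC le_rfl (by norm_num) (le_max_left _ _) (by simp)
      (zlev_le_self (by omega) 0) (le_max_right _ _) (fun u hu => (mem_filter.1 hu).2)
    simp only [mul_zero, zero_mul, zero_add, add_zero] at h
    have hA : 0 ≤ (L : ℝ) / Real.log a := by positivity
    calc _ = 300 * K ^ 100 * (L / Real.log a) * ∑ u ∈ U, g u * (u : ℝ) ^ (-1 : ℝ) := by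
          norm_num
      _ ≤ 300 * K ^ 100 * (L / Real.log a) * _ := mul_le_mul_of_nonneg_left h (by positivity)
      _ = _ := by ring

lemma IsNonnegMult.sum_smooth_part_mid_le (hg : IsNonnegMult g) (hK : 1 ≤ K)
    (hgK : ∀ p e : ℕ, p.Prime → g (p ^ e) ≤ K ^ e) (hC₀ : 0 ≤ C₀)
    (hgC : ∀ n : ℕ, n ≠ 0 → g n ≤ C₀ * (n : ℝ) ^ (1 / 100 : ℝ)) (ha : 101 ≤ a)
    (haL : (a : ℝ) ^ (2 / 5 : ℝ) ≤ L) (hLa : L ≤ 100 * a) {B : ℝ}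
    (hB : B = 20 * Real.log K + 1) {j : ℕ} (hj : 1 ≤ j) (hjB : 200 * B * j ≤ Real.log a) :
    ∑ n ∈ Ioc a (a + L) with ∃ q, zlev a (j + 1) < q ∧ q ≤ zlev a j ∧ wlev a < sm q n ∧
      sm q n ≤ wlev a * wlev a, g n ≤
      300 * K ^ 100 * Real.exp (7 * K * B * Real.exp B + powConst C₀) * (1 / 2) ^ j *
        ((L / Real.log a) * Real.exp (∑ p ∈ (a + 1).primesBelow, g p / p)) := by
  have hlK := Real.log_nonneg hK
  have hB1 : 1 ≤ B := by linarith
  have hj' : (1 : ℝ) ≤ j := by exact_mod_cast hj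
  have hA : 0 < Real.log a := by nlinarith
  have ha0 : (0 : ℝ) < a := by exact_mod_cast (by omega : 0 < a)
  have hjA : 50 * ((j : ℝ) + 1) ≤ Real.log a := by nlinarith
  set U := {u ∈ Icc 1 (wlev a * wlev a) | wlev a < u ∧ u ∈ Nat.smoothNumbers (zlev a j + 1)}
    with hUdef
  refine (hg.sum_rough_part_le (j := j) (w := zlev a (j + 1)) (U := U) hK hgK ha haL hLa
    (two_le_zlev hjA) (zlev_le (by omega) j) (exp_le_zlev_add_one a j) (fun u hu => ?_)
    (filter_subset _ _) fun n hn => ?_).trans ?_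
  · rw [hUdef, mem_filter, mem_Icc] at hu
    exact ⟨by omega, le_trans (by exact_mod_cast hu.1.2) (wlev_sq_le a)⟩
  · rw [mem_filter, mem_Ioc] at hn
    obtain ⟨hn1, q, hq1, hq2, hq3, hq4⟩ := hn
    have hn0 : n ≠ 0 := by omega
    refine ⟨sm q n, ?_, ro q n, (sm_mul_ro hn0).symm, coprime_sm_ro hn0,
      fun p hp hpn => hq1.trans (lt_of_prime_dvd_ro hn0 hp hpn)⟩
    rw [hUdef, mem_filter, mem_Icc]
    exact ⟨⟨sm_pos _ _, hq4⟩, hq3, Nat.smoothNumbers_mono (by omega) (sm_mem_smoothNumbers _ _)⟩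
  · set ρ := 50 * B * j / Real.log a with hρdef
    have hρ0 : 0 ≤ ρ := by positivity
    have hρ : ρ ≤ 1 / 4 := by
      rw [hρdef, div_le_iff₀ hA]; linarith
    obtain ⟨i, rfl⟩ : ∃ i, j = i + 1 := ⟨j - 1, by omega⟩
    have h := hg.sum_smooth_rpow_le (K := K) (ρ := ρ) (B := B) (l := Real.log a / (50 * (i + 1 : ℕ)))
      (N := zlev a (i + 1)) (a := a) (U := U) hC₀
      (fun p hp => by simpa using hgK p 1 hp) hgC hρ0 hρ
      (by rw [le_div_iff₀ (by positivity)]; nlinarith)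
      (le_of_eq (by rw [hρdef]; field_simp)) (zlev_le_self (by omega) i) (log_zlev_le (by omega) _)
      (fun u hu => (mem_filter.1 hu).2.2)
    have h2 : ∑ u ∈ U, g u * (u : ℝ) ^ (-1 : ℝ) ≤ Real.exp (-(5 * B * (i + 1 : ℕ))) *
        ∑ u ∈ U, g u * (u : ℝ) ^ (-1 + ρ) := by
      rw [mul_sum]
      refine sum_le_sum fun u hu => ?_
      have hu' := (mem_filter.1 hu).2.1
      have hu2 := lt_of_wlev_lt hu'
      have hu0 : (0 : ℝ) < u := by exact_mod_cast (by omega : 0 < u)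
      have e1 : (u : ℝ) ^ (-1 : ℝ) = (u : ℝ) ^ (-ρ) * (u : ℝ) ^ (-1 + ρ) := by
        rw [← Real.rpow_add hu0]; congr 1; ring
      have e2 : (u : ℝ) ^ (-ρ) ≤ Real.exp (-(5 * B * (i + 1 : ℕ))) := by
        calc (u : ℝ) ^ (-ρ) ≤ ((a : ℝ) ^ (1 / 10 : ℝ)) ^ (-ρ) :=
              Real.rpow_le_rpow_of_nonpos (by positivity) hu2.le (by linarith)
          _ = Real.exp (-(5 * B * (i + 1 : ℕ))) := by
              rw [← Real.rpow_mul ha0.le, Real.rpow_def_of_pos ha0]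
              congr 1
              rw [hρdef]
              field_simp
              ring
      have := hg.nonneg u
      calc g u * (u : ℝ) ^ (-1 : ℝ) = (u : ℝ) ^ (-ρ) * (g u * (u : ℝ) ^ (-1 + ρ)) := by
            rw [e1]; ring
        _ ≤ _ := by gcongr
    have h3 : ((i + 1 : ℕ) + 1 : ℝ) * K ^ (100 * ((i + 1) + 1)) *
        Real.exp (-(5 * B * (i + 1 : ℕ))) ≤ K ^ 100 * (1 / 2) ^ (i + 1) := by
      have e1 : K ^ (100 * ((i + 1) + 1)) * Real.exp (-(5 * B * (i + 1 : ℕ))) =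
          K ^ 100 * Real.exp (-5) ^ (i + 1) := by
        rw [← Real.exp_nat_mul, show 100 * ((i + 1) + 1) = 100 * (i + 1) + 100 by ring, pow_add]
        rw [← Real.rpow_natCast K (100 * (i + 1)), Real.rpow_def_of_pos (by linarith),
          mul_right_comm, ← Real.exp_add, mul_comm, hB]
        congr 2
        push_cast
        ring
      have e2 : ((i + 1 : ℕ) + 1 : ℝ) ≤ Real.exp 1 ^ (i + 1) := by
        rw [← Real.exp_nat_mul, mul_one]
        exact Real.add_one_le_exp _
      have e3 : Real.exp 1 * Real.exp (-5) ≤ 1 / 2 := by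
        rw [← Real.exp_add, show (1 : ℝ) + -5 = -4 by norm_num, Real.exp_neg]
        rw [inv_le_comm₀ (Real.exp_pos _) (by norm_num)]
        linarith [Real.add_one_le_exp (4 : ℝ)]
      calc _ = ((i + 1 : ℕ) + 1 : ℝ) * (K ^ 100 * Real.exp (-5) ^ (i + 1)) := by rw [← e1]; ring
        _ ≤ Real.exp 1 ^ (i + 1) * (K ^ 100 * Real.exp (-5) ^ (i + 1)) := by gcongr
        _ = K ^ 100 * (Real.exp 1 * Real.exp (-5)) ^ (i + 1) := by rw [mul_pow]; ring
        _ ≤ _ := by gcongr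
    have hLA : 0 ≤ (L : ℝ) / Real.log a := by positivity
    set Q := Real.exp (7 * K * B * Real.exp B + powConst C₀) *
        Real.exp (∑ p ∈ (a + 1).primesBelow, g p / p) with hQ
    calc _ ≤ 300 * ((i + 1 : ℕ) + 1 : ℝ) * K ^ (100 * ((i + 1) + 1)) * (L / Real.log a) *
          (Real.exp (-(5 * B * (i + 1 : ℕ))) * Q) := by
          gcongr
          exact h2.trans (by gcongr)
      _ = 300 * (((i + 1 : ℕ) + 1 : ℝ) * K ^ (100 * ((i + 1) + 1)) *
          Real.exp (-(5 * B * (i + 1 : ℕ)))) * (L / Real.log a) * Q := by ring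
      _ ≤ 300 * (K ^ 100 * (1 / 2) ^ (i + 1)) * (L / Real.log a) * Q := by gcongr
      _ = _ := by rw [hQ]; ring

end Shiu

lemma sum_le_four {g : ℕ → ℝ} (hg : ∀ n, 0 ≤ g n) {I : Finset ℕ} {P Q R S : ℕ → Prop}
    [DecidablePred P] [DecidablePred Q] [DecidablePred R] [DecidablePred S]
    (h : ∀ n ∈ I, P n ∨ Q n ∨ R n ∨ S n) {b₁ b₂ b₃ b₄ : ℝ} (h₁ : ∑ n ∈ I with P n, g n ≤ b₁)
    (h₂ : ∑ n ∈ I with Q n, g n ≤ b₂) (h₃ : ∑ n ∈ I with R n, g n ≤ b₃)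
    (h₄ : ∑ n ∈ I with S n, g n ≤ b₄) : ∑ n ∈ I, g n ≤ b₁ + b₂ + b₃ + b₄ := by
  refine le_trans ?_ (add_le_add (add_le_add (add_le_add h₁ h₂) h₃) h₄)
  simp only [sum_filter]
  rw [← sum_add_distrib, ← sum_add_distrib, ← sum_add_distrib]
  refine sum_le_sum fun n hn => ?_
  have := hg n
  rcases h n hn with h | h | h | h <;> simp only [h, if_true] <;> split_ifs <;> linarith

section Shiu
variable {g : ℕ → ℝ} {K C₀ : ℝ} {a L : ℕ}

lemma le_of_mem_Ioc_of_le (hC₀ : 0 ≤ C₀)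
    (hgC : ∀ n : ℕ, n ≠ 0 → g n ≤ C₀ * (n : ℝ) ^ (1 / 100 : ℝ)) (hLa : L ≤ 100 * a) {n : ℕ}
    (hn : n ∈ Ioc a (a + L)) : g n ≤ C₀ * 101 * (a : ℝ) ^ (1 / 100 : ℝ) := by
  rw [mem_Ioc] at hn
  refine (hgC n (by omega)).trans ?_
  rw [mul_assoc]
  refine mul_le_mul_of_nonneg_left ?_ hC₀
  have h1 : (n : ℝ) ≤ 101 * a := by exact_mod_cast (by omega : n ≤ 101 * a)
  calc (n : ℝ) ^ (1 / 100 : ℝ) ≤ (101 * (a : ℝ)) ^ (1 / 100 : ℝ) := by gcongr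
    _ = 101 ^ (1 / 100 : ℝ) * (a : ℝ) ^ (1 / 100 : ℝ) :=
      Real.mul_rpow (by norm_num) (by positivity)
    _ ≤ 101 ^ (1 : ℝ) * (a : ℝ) ^ (1 / 100 : ℝ) := by
      gcongr
      · norm_num
      · norm_num
    _ = _ := by rw [Real.rpow_one]

lemma rpow_neg_le_div_log (ha : 101 ≤ a) {c : ℝ} (hc : c ≤ -(1 / 100)) :
    (a : ℝ) ^ c ≤ 100 / Real.log a := by
  have ha' : (101 : ℝ) ≤ a := by exact_mod_cast ha
  have hA : 0 < Real.log a := Real.log_pos (by linarith)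
  have h1 := Real.log_le_rpow_div (x := a) (by linarith) (ε := 1 / 100) (by norm_num)
  calc (a : ℝ) ^ c ≤ (a : ℝ) ^ (-(1 / 100) : ℝ) :=
        Real.rpow_le_rpow_of_exponent_le (by linarith) hc
    _ ≤ 100 / Real.log a := by
      rw [Real.rpow_neg (by linarith), le_div_iff₀ hA, inv_mul_le_iff₀ (by positivity)]
      linarith

lemma sum_large_prime_power_le (hC₀ : 0 ≤ C₀)
    (hgC : ∀ n : ℕ, n ≠ 0 → g n ≤ C₀ * (n : ℝ) ^ (1 / 100 : ℝ)) (ha : 101 ≤ a)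
    (haL : (a : ℝ) ^ (2 / 5 : ℝ) ≤ L) (hLa : L ≤ 100 * a) :
    ∑ n ∈ Ioc a (a + L) with ∃ p : ℕ, p.Prime ∧ p ≤ zlev a 1 ∧ wlev a < p ^ n.factorization p,
      g n ≤ 20200 * C₀ * (L / Real.log a) := by
  have ha' : (101 : ℝ) ≤ a := by exact_mod_cast ha
  have ha0 : (0 : ℝ) < a := by linarith
  have hA : 0 < Real.log a := Real.log_pos (by linarith)
  have hL0 : (0 : ℝ) < L := lt_of_lt_of_le (by positivity) haL
  have hW := one_le_wlev (a := a) (by omega)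
  set D := image (fun p => p ^ (Nat.log p (wlev a) + 1)) (zlev a 1 + 1).primesBelow with hDdef
  have hDW : ∀ d ∈ D, wlev a < d := by
    intro d hd
    rw [hDdef, mem_image] at hd
    obtain ⟨p, hp, rfl⟩ := hd
    exact Nat.lt_pow_succ_log_self (Nat.prime_of_mem_primesBelow hp).one_lt _
  have hz : ((zlev a 1 : ℕ) : ℝ) ≤ (a : ℝ) ^ (1 / 50 : ℝ) := zlev_le (by omega) 0
  have hDcard : (#D : ℝ) ≤ (a : ℝ) ^ (1 / 50 : ℝ) := by
    refine le_trans ?_ hz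
    norm_cast
    refine card_image_le.trans ?_
    rw [Nat.primesBelow]
    calc #{n ∈ range (zlev a 1 + 1) | n.Prime} ≤ #(Icc 1 (zlev a 1)) := by
          refine card_le_card fun p hp => ?_
          rw [mem_filter, mem_range] at hp
          rw [mem_Icc]
          have := hp.2.pos
          omega
      _ = zlev a 1 := by simp
  refine (sum_dvd_le (D := D) (V := C₀ * 101 * (a : ℝ) ^ (1 / 100 : ℝ)) (by positivity)
    (fun d hd => by have := hDW d hd; omega) (filter_subset _ _) (fun n hn => ?_)
    fun n hn => le_of_mem_Ioc_of_le hC₀ hgC hLa (mem_filter.1 hn).1).trans ?_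
  · rw [mem_filter, mem_Ioc] at hn
    obtain ⟨hn1, p, hp, hpz, hpW⟩ := hn
    refine ⟨p ^ (Nat.log p (wlev a) + 1), mem_image.2 ⟨p, ?_, rfl⟩, ?_⟩
    · rw [Nat.mem_primesBelow]
      exact ⟨by omega, hp⟩
    · have h1 : Nat.log p (wlev a) + 1 ≤ n.factorization p := by
        by_contra h
        have h2 : p ^ n.factorization p ≤ p ^ Nat.log p (wlev a) :=
          Nat.pow_le_pow_right hp.pos (by omega)
        have := Nat.pow_log_le_self p (x := wlev a) (by omega)
        omega
      exact (Nat.pow_dvd_pow p h1).trans (Nat.ordProj_dvd n p)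
  · have hterm : ∀ d ∈ D, (L : ℝ) / d + 1 ≤ 2 * (L * (a : ℝ) ^ (-(1 / 10) : ℝ)) := by
      intro d hd
      have hd1 := lt_of_wlev_lt (hDW d hd)
      have e1 : (L : ℝ) / d ≤ L * (a : ℝ) ^ (-(1 / 10) : ℝ) := by
        rw [Real.rpow_neg ha0.le, ← div_eq_mul_inv]
        gcongr
      have e2 : 1 ≤ L * (a : ℝ) ^ (-(1 / 10) : ℝ) := by
        calc (1 : ℝ) ≤ (a : ℝ) ^ (2 / 5 + -(1 / 10) : ℝ) :=
              Real.one_le_rpow (by linarith) (by norm_num)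
          _ = (a : ℝ) ^ (2 / 5 : ℝ) * (a : ℝ) ^ (-(1 / 10) : ℝ) := Real.rpow_add ha0 _ _
          _ ≤ _ := by gcongr
      linarith
    calc C₀ * 101 * (a : ℝ) ^ (1 / 100 : ℝ) * ∑ d ∈ D, ((L : ℝ) / d + 1)
        ≤ C₀ * 101 * (a : ℝ) ^ (1 / 100 : ℝ) *
          (#D * (2 * (L * (a : ℝ) ^ (-(1 / 10) : ℝ)))) := by
          gcongr
          rw [← nsmul_eq_mul]
          exact sum_le_card_nsmul _ _ _ hterm
      _ ≤ C₀ * 101 * (a : ℝ) ^ (1 / 100 : ℝ) *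
          ((a : ℝ) ^ (1 / 50 : ℝ) * (2 * (L * (a : ℝ) ^ (-(1 / 10) : ℝ)))) := by gcongr
      _ = 202 * C₀ * L * ((a : ℝ) ^ (1 / 100 : ℝ) * (a : ℝ) ^ (1 / 50 : ℝ) *
          (a : ℝ) ^ (-(1 / 10) : ℝ)) := by ring
      _ = 202 * C₀ * L * (a : ℝ) ^ (1 / 100 + 1 / 50 + -(1 / 10) : ℝ) := by
          rw [← Real.rpow_add ha0, ← Real.rpow_add ha0]
      _ ≤ 202 * C₀ * L * (100 / Real.log a) := by
          gcongr
          exact rpow_neg_le_div_log ha (by norm_num)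
      _ = _ := by ring

lemma sum_very_smooth_le (hC₀ : 0 ≤ C₀)
    (hgC : ∀ n : ℕ, n ≠ 0 → g n ≤ C₀ * (n : ℝ) ^ (1 / 100 : ℝ)) (ha : 101 ≤ a)
    (haL : (a : ℝ) ^ (2 / 5 : ℝ) ≤ L) (hLa : L ≤ 100 * a) (M : ℕ) :
    ∑ n ∈ Ioc a (a + L) with ∃ q ≤ M, wlev a < sm q n ∧ sm q n ≤ wlev a * wlev a,
      g n ≤ 20200 * C₀ * Real.exp (∑ p ∈ (M + 1).primesBelow, (p : ℝ) ^ (-(3 / 4) : ℝ) +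
        powConst 1) * (L / Real.log a) := by
  have ha' : (101 : ℝ) ≤ a := by exact_mod_cast ha
  have ha0 : (0 : ℝ) < a := by linarith
  have hA : 0 < Real.log a := Real.log_pos (by linarith)
  have hL0 : (0 : ℝ) < L := lt_of_lt_of_le (by positivity) haL
  set U := {u ∈ Icc 1 (wlev a * wlev a) | wlev a < u ∧ u ∈ Nat.smoothNumbers (M + 1)}
    with hUdef
  have hone : IsNonnegMult fun _ => (1 : ℝ) := ⟨fun _ => zero_le_one, rfl, fun _ _ _ => by simp⟩
  have hsm : ∑ u ∈ U, (u : ℝ) ^ (-(3 / 4) : ℝ) ≤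
      Real.exp (∑ p ∈ (M + 1).primesBelow, (p : ℝ) ^ (-(3 / 4) : ℝ) + powConst 1) := by
    have := (hone.mul_rpow (-(3 / 4))).sum_smooth_le zero_le_one (fun p e hp _ => ?_) (M + 1) U
      (fun u hu => (mem_filter.1 hu).2.2)
    · simpa using this
    · rw [one_mul, one_mul]
      refine Real.rpow_le_rpow_of_exponent_le ?_ (by norm_num)
      exact_mod_cast Nat.one_le_pow _ _ hp.pos
  refine (sum_dvd_le (D := U) (V := C₀ * 101 * (a : ℝ) ^ (1 / 100 : ℝ)) (by positivity)
    (fun d hd => (mem_Icc.1 (mem_filter.1 hd).1).1) (filter_subset _ _) (fun n hn => ?_)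
    fun n hn => le_of_mem_Ioc_of_le hC₀ hgC hLa (mem_filter.1 hn).1).trans ?_
  · rw [mem_filter, mem_Ioc] at hn
    obtain ⟨hn1, q, hq, hq1, hq2⟩ := hn
    refine ⟨sm q n, ?_, sm_dvd (by omega)⟩
    rw [hUdef, mem_filter, mem_Icc]
    exact ⟨⟨sm_pos _ _, hq2⟩, hq1, Nat.smoothNumbers_mono (by omega) (sm_mem_smoothNumbers _ _)⟩
  · have hterm : ∀ u ∈ U, (L : ℝ) / u + 1 ≤
        2 * (L * (a : ℝ) ^ (-(1 / 40) : ℝ)) * (u : ℝ) ^ (-(3 / 4) : ℝ) := by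
      intro u hu
      rw [hUdef, mem_filter, mem_Icc] at hu
      have hu1 := lt_of_wlev_lt hu.2.1
      have hu0 : (0 : ℝ) < u := by exact_mod_cast (by omega : 0 < u)
      have e1 : 1 ≤ (L : ℝ) / u := by
        rw [one_le_div hu0]
        refine le_trans (by exact_mod_cast hu.1.2) ((wlev_sq_le a).trans (le_trans ?_ haL))
        exact Real.rpow_le_rpow_of_exponent_le (by linarith) (by norm_num)
      have e2 : (1 : ℝ) / u ≤ (a : ℝ) ^ (-(1 / 40) : ℝ) * (u : ℝ) ^ (-(3 / 4) : ℝ) := by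
        calc (1 : ℝ) / u = (u : ℝ) ^ (-(1 / 4) : ℝ) * (u : ℝ) ^ (-(3 / 4) : ℝ) := by
              rw [← Real.rpow_add hu0, one_div, ← Real.rpow_neg_one]; norm_num
          _ ≤ ((a : ℝ) ^ (1 / 10 : ℝ)) ^ (-(1 / 4) : ℝ) * (u : ℝ) ^ (-(3 / 4) : ℝ) := by
              gcongr ?_ * _
              exact Real.rpow_le_rpow_of_nonpos (by positivity) hu1.le (by norm_num)
          _ = _ := by rw [← Real.rpow_mul ha0.le]; norm_num
      calc (L : ℝ) / u + 1 ≤ 2 * (L * (1 / u)) := by rw [mul_one_div]; linarith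
        _ ≤ 2 * (L * ((a : ℝ) ^ (-(1 / 40) : ℝ) * (u : ℝ) ^ (-(3 / 4) : ℝ))) := by gcongr
        _ = _ := by ring
    set S0 := Real.exp (∑ p ∈ (M + 1).primesBelow, (p : ℝ) ^ (-(3 / 4) : ℝ) + powConst 1)
    calc C₀ * 101 * (a : ℝ) ^ (1 / 100 : ℝ) * ∑ d ∈ U, ((L : ℝ) / d + 1)
        ≤ C₀ * 101 * (a : ℝ) ^ (1 / 100 : ℝ) *
          (2 * (L * (a : ℝ) ^ (-(1 / 40) : ℝ)) * S0) := by
          gcongr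
          refine (sum_le_sum hterm).trans ?_
          rw [← mul_sum]
          gcongr
      _ = 202 * C₀ * S0 * L * ((a : ℝ) ^ (1 / 100 : ℝ) * (a : ℝ) ^ (-(1 / 40) : ℝ)) := by ring
      _ = 202 * C₀ * S0 * L * (a : ℝ) ^ (1 / 100 + -(1 / 40) : ℝ) := by
          rw [← Real.rpow_add ha0]
      _ ≤ 202 * C₀ * S0 * L * (100 / Real.log a) := by
          gcongr
          exact rpow_neg_le_div_log ha (by norm_num)
      _ = _ := by ring

/-- Shiu's theorem on sums of multiplicative functions over short intervals. -/
theorem exists_sum_Ioc_le (K C₀ : ℝ) (hK : 1 ≤ K) (hC₀ : 0 ≤ C₀) : ∃ C : ℝ, 1 ≤ C ∧ ∃ X : ℕ,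
    101 ≤ X ∧ ∀ g : ℕ → ℝ, IsNonnegMult g → (∀ p e : ℕ, p.Prime → g (p ^ e) ≤ K ^ e) →
    (∀ n : ℕ, n ≠ 0 → g n ≤ C₀ * (n : ℝ) ^ (1 / 100 : ℝ)) → ∀ a L : ℕ, X ≤ a →
    (a : ℝ) ^ (2 / 5 : ℝ) ≤ L → L ≤ 100 * a →
    ∑ n ∈ Ioc a (a + L), g n ≤
      C * ((L / Real.log a) * Real.exp (∑ p ∈ (a + 1).primesBelow, g p / p)) := by
  set B := 20 * Real.log K + 1 with hB
  have hB1 : 1 ≤ B := by have := Real.log_nonneg hK; linarith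
  set M := ⌊Real.exp (4 * B)⌋₊ with hM
  set c1 := 300 * K ^ 100 * Real.exp (powConst C₀)
  set c2 := 20200 * C₀
  set c3 := 300 * K ^ 100 * Real.exp (7 * K * B * Real.exp B + powConst C₀)
  set c4 := 20200 * C₀ * Real.exp (∑ p ∈ (M + 1).primesBelow, (p : ℝ) ^ (-(3 / 4) : ℝ) +
        powConst 1)
  refine ⟨c1 + c2 + 2 * c3 + c4 + 1, ?_, max 101 ⌈Real.exp 200⌉₊, le_max_left _ _,
    fun g hg hgK hgC a L ha haL hLa => ?_⟩
  · have : 0 ≤ c1 := by positivity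
    have : 0 ≤ c2 := by positivity
    have : 0 ≤ c3 := by positivity
    have : 0 ≤ c4 := by positivity
    linarith
  have ha1 : 101 ≤ a := (le_max_left _ _).trans ha
  have ha' : (101 : ℝ) ≤ a := by exact_mod_cast ha1
  have hla : 200 ≤ Real.log a := by
    rw [Real.le_log_iff_exp_le (by linarith)]
    exact (Nat.le_ceil _).trans (by exact_mod_cast (le_max_right _ _).trans ha)
  set E := Real.exp (∑ p ∈ (a + 1).primesBelow, g p / p)
  have hE : 1 ≤ E := Real.one_le_exp (sum_nonneg fun p _ => div_nonneg (hg.nonneg p) (by positivity))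
  have hLA : 0 ≤ (L : ℝ) / Real.log a := by positivity
  set J := ⌊Real.log a / (200 * B)⌋₊ with hJ
  have hJM : zlev a (J + 1) ≤ M := by
    refine Nat.floor_le_floor (Real.exp_le_exp.2 ?_)
    have h1 := (Nat.lt_floor_add_one (Real.log a / (200 * B))).le
    rw [div_le_iff₀ (by positivity)] at h1
    rw [div_le_iff₀ (by positivity)]
    push_cast
    linarith
  have T1 := hg.sum_smooth_part_small_le hK hgK hC₀ hgC ha1 haL hLa hla
  have T2 := sum_large_prime_power_le hC₀ hgC ha1 haL hLa
  have T4 := sum_very_smooth_le hC₀ hgC ha1 haL hLa M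
  have T3 : ∑ n ∈ Ioc a (a + L) with ∃ j ∈ Icc 1 J, ∃ q, zlev a (j + 1) < q ∧ q ≤ zlev a j ∧
      wlev a < sm q n ∧ sm q n ≤ wlev a * wlev a, g n ≤ 2 * c3 * ((L / Real.log a) * E) := by
    refine (sum_le_sum_cover hg.nonneg _ (Icc 1 J) (fun j n => ∃ q, zlev a (j + 1) < q ∧
      q ≤ zlev a j ∧ wlev a < sm q n ∧ sm q n ≤ wlev a * wlev a)
      fun n hn => (mem_filter.1 hn).2).trans ?_
    calc _ ≤ ∑ j ∈ Icc 1 J, c3 * (1 / 2) ^ j * ((L / Real.log a) * E) := by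
          refine sum_le_sum fun j hj => le_trans ?_ (hg.sum_smooth_part_mid_le hK hgK hC₀ hgC ha1
            haL hLa hB (mem_Icc.1 hj).1 ?_)
          · refine sum_le_sum_of_subset_of_nonneg (fun n hn => ?_) fun n _ _ => hg.nonneg n
            rw [mem_filter] at hn ⊢
            exact ⟨(mem_filter.1 hn.1).1, hn.2⟩
          · have h1 : (j : ℝ) ≤ Real.log a / (200 * B) :=
              (Nat.le_floor_iff (by positivity)).1 (mem_Icc.1 hj).2
            rw [le_div_iff₀ (by positivity)] at h1
            linarith
      _ = c3 * ((L / Real.log a) * E) * ∑ j ∈ Icc 1 J, (1 / 2 : ℝ) ^ j := by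
          rw [mul_sum]; exact sum_congr rfl fun j _ => by ring
      _ ≤ c3 * ((L / Real.log a) * E) * 2 := by
          gcongr
          have := summable_geometric_two.sum_le_tsum (Icc 1 J) fun _ _ => by positivity
          rwa [tsum_geometric_two] at this
      _ = _ := by ring
  have hcov : ∀ n ∈ Ioc a (a + L), sm (zlev a 1) n ≤ wlev a ∨
      (∃ p : ℕ, p.Prime ∧ p ≤ zlev a 1 ∧ wlev a < p ^ n.factorization p) ∨
      (∃ j ∈ Icc 1 J, ∃ q, zlev a (j + 1) < q ∧ q ≤ zlev a j ∧ wlev a < sm q n ∧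
        sm q n ≤ wlev a * wlev a) ∨
      ∃ q ≤ M, wlev a < sm q n ∧ sm q n ≤ wlev a * wlev a := by
    intro n hn
    rcases le_or_gt (sm (zlev a 1) n) (wlev a) with h | h
    · exact Or.inl h
    refine Or.inr ?_
    by_cases hp : ∃ p : ℕ, p.Prime ∧ p ≤ zlev a 1 ∧ wlev a < p ^ n.factorization p
    · exact Or.inl hp
    refine Or.inr ?_
    push Not at hp
    obtain ⟨q, hqz, hq1, hq2⟩ := exists_cutoff (one_le_wlev (by omega)) h hp
    rcases le_or_gt q M with hqM | hqM
    · exact Or.inr ⟨q, hqM, hq1, hq2⟩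
    · obtain ⟨j, hj, h1, h2⟩ := exists_between_of_le (z := zlev a) hqz J (by omega)
      exact Or.inl ⟨j, hj, q, h1, h2, hq1, hq2⟩
  have hall := sum_le_four hg.nonneg hcov T1 T2 T3 T4
  have hLE : (L : ℝ) / Real.log a ≤ (L / Real.log a) * E := le_mul_of_one_le_right hLA hE
  have T2' : c2 * ((L : ℝ) / Real.log a) ≤ c2 * ((L / Real.log a) * E) := by gcongr
  have T4' : c4 * ((L : ℝ) / Real.log a) ≤ c4 * ((L / Real.log a) * E) := by gcongr
  have hpos : 0 ≤ ((L : ℝ) / Real.log a) * E := hLA.trans hLE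
  refine hall.trans ?_
  linarith

end Shiu

section Applications
variable {κ : ℝ} {f Λf : ℕ → ℂ} {y : ℕ}

/-- `|f(n)| a^η b^{-η}`, where `η = 1 / log y` and `n = a b` with `a` `y`-smooth, `b` `y`-rough. -/
def gw (f : ℕ → ℂ) (y n : ℕ) : ℝ := ‖f n‖ * wt y (1 / Real.log y) (-(1 / Real.log y)) n

lemma isNonnegMult_gw (hf : IsHalaszClass κ f Λf) (y : ℕ) : IsNonnegMult (gw f y) :=
  hf.isNonnegMult.mul_wt y _ _

lemma wt_prime_pow_le (hy : 1 ≤ Real.log y) {p : ℕ} (hp : p.Prime) (e : ℕ) :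
    wt y (1 / Real.log y) (-(1 / Real.log y)) (p ^ e) ≤ 3 ^ e := by
  have hp1 : (1 : ℝ) ≤ p := by exact_mod_cast hp.one_lt.le
  have hy0 : 0 < Real.log y := by linarith
  rcases le_or_gt p y with h | h
  · rw [wt_prime_pow_of_le hp h, rpow_pow_eq]
    gcongr
    rw [Real.rpow_def_of_pos (by linarith), mul_one_div]
    calc Real.exp (Real.log p / Real.log y) ≤ Real.exp 1 := by
          refine Real.exp_le_exp.2 ((div_le_one hy0).2 ?_)
          exact Real.log_le_log (by linarith) (by exact_mod_cast h)
      _ ≤ 3 := Real.exp_one_lt_three.le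
  · rw [wt_prime_pow_of_lt hp h]
    refine le_trans (Real.rpow_le_one_of_one_le_of_nonpos ?_ ?_) (one_le_pow₀ (by norm_num))
    · exact_mod_cast Nat.one_le_pow _ _ hp.pos
    · rw [neg_nonpos]; positivity

lemma gw_prime_pow_le (hf : IsHalaszClass κ f Λf) (hκ : 0 < κ) (hy : 1 ≤ Real.log y) {p : ℕ}
    (hp : p.Prime) (e : ℕ) : gw f y (p ^ e) ≤ (max κ 1 * 3) ^ e := by
  rw [mul_pow]
  exact mul_le_mul (hf.norm_pow_le hκ hp e) (wt_prime_pow_le hy hp e) (wt_nonneg _ _ _ _)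
    (by positivity)

lemma sum_gw_prime_div_le (hf : IsHalaszClass κ f Λf) (hκ : 0 < κ) (hy : 1 ≤ Real.log y)
    {S : Finset ℕ} (hS : ∀ p ∈ S, p.Prime) :
    ∑ p ∈ S, gw f y p / p ≤ κ * (Real.log (Real.log y) + 81) := by
  set l := Real.log y with hl
  have hl0 : 0 < l := by linarith
  have hy0 : 0 < y := by
    rcases Nat.eq_zero_or_pos y with h | h
    · rw [h] at hl; simp at hl; linarith
    · exact h
  have hy0' : (0 : ℝ) < y := by exact_mod_cast hy0
  rw [← sum_filter_add_sum_filter_not S (fun p => p ≤ y)]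
  have hsm : ∀ p ∈ S.filter (fun p => p ≤ y), p.Prime ∧ Real.log p ≤ l := by
    intro p hp
    rw [mem_filter] at hp
    have := hS p hp.1
    exact ⟨this, Real.log_le_log (by exact_mod_cast this.pos) (by exact_mod_cast hp.2)⟩
  have hla : ∀ p ∈ S.filter (fun p => ¬ p ≤ y), p.Prime ∧ l ≤ Real.log p := by
    intro p hp
    rw [mem_filter, not_le] at hp
    exact ⟨hS p hp.1, Real.log_le_log hy0' (by exact_mod_cast hp.2.le)⟩
  have h1 : ∑ p ∈ S with p ≤ y, gw f y p / p ≤ κ * ((Real.log l + 12) + 3 / l * (7 * l)) := by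
    calc ∑ p ∈ S with p ≤ y, gw f y p / p
        ≤ ∑ p ∈ S with p ≤ y, κ * ((1 : ℝ) / p + 3 / l * (Real.log p / p)) := by
          refine sum_le_sum fun p hp => ?_
          obtain ⟨hp', hpl⟩ := hsm p hp
          have hp0 : (0 : ℝ) < p := by exact_mod_cast hp'.pos
          have hpy := (mem_filter.1 hp).2
          have e1 : wt y (1 / l) (-(1 / l)) p = (p : ℝ) ^ (1 / l) := by
            simpa using wt_prime_pow_of_le (c := 1 / l) (d := -(1 / l)) hp' hpy 1
          have e2 : (p : ℝ) ^ (1 / l) ≤ 1 + 3 / l * Real.log p := by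
            rw [Real.rpow_def_of_pos hp0, mul_one_div]
            refine (exp_le_one_add_mul_exp _).trans ?_
            have h0 : 0 ≤ Real.log p := Real.log_natCast_nonneg p
            have : Real.exp (Real.log p / l) ≤ 3 :=
              (Real.exp_le_exp.2 ((div_le_one hl0).2 hpl)).trans Real.exp_one_lt_three.le
            calc 1 + Real.log p / l * Real.exp (Real.log p / l) ≤ 1 + Real.log p / l * 3 := by
                  gcongr
              _ = _ := by ring
          have e3 : gw f y p ≤ κ * (1 + 3 / l * Real.log p) := by
            rw [gw, ← hl, e1]
            exact mul_le_mul (hf.norm_prime_le hp') e2 (by positivity) hκ.le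
          calc gw f y p / p ≤ κ * (1 + 3 / l * Real.log p) / p := by gcongr
            _ = _ := by ring
      _ = κ * (∑ p ∈ S with p ≤ y, (1 : ℝ) / p +
          3 / l * ∑ p ∈ S with p ≤ y, Real.log p / p) := by
          rw [← mul_sum, sum_add_distrib, ← mul_sum]
      _ ≤ _ := by
          gcongr
          · exact sum_prime_inv_le hy hsm
          · exact sum_prime_log_div_le hy hsm
  have h2 : ∑ p ∈ S with ¬ p ≤ y, gw f y p / p ≤ κ * 48 := by
    calc ∑ p ∈ S with ¬ p ≤ y, gw f y p / p
        ≤ ∑ p ∈ S with ¬ p ≤ y, κ * (p : ℝ) ^ (-1 - 1 / l) := by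
          refine sum_le_sum fun p hp => ?_
          obtain ⟨hp', hpl⟩ := hla p hp
          have hp0 : (0 : ℝ) < p := by exact_mod_cast hp'.pos
          have hpy := (mem_filter.1 hp).2
          have e1 : wt y (1 / l) (-(1 / l)) p = (p : ℝ) ^ (-(1 / l)) := by
            simpa using wt_prime_pow_of_lt (c := 1 / l) (d := -(1 / l)) hp' (not_le.1 hpy) 1
          rw [gw, ← hl, e1, sub_eq_add_neg, Real.rpow_add hp0, Real.rpow_neg_one, mul_div_assoc,
            div_eq_mul_inv, mul_comm ((p : ℝ)⁻¹)]
          gcongr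
          exact hf.norm_prime_le hp'
      _ ≤ _ := by
          rw [← mul_sum]
          gcongr
          exact sum_prime_rpow_le hy hla
  have h3 : 3 / l * (7 * l) = 21 := by field_simp; norm_num
  rw [h3] at h1
  linarith

lemma exp_mul_log_add {κ l c : ℝ} (hl : 0 < l) :
    Real.exp (κ * (Real.log l + c)) = Real.exp (κ * c) * l ^ κ := by
  rw [Real.rpow_def_of_pos hl, ← Real.exp_add]
  congr 1; ring

lemma exists_gw_le_rpow (hκ : 0 < κ) : ∃ C : ℝ, 1 ≤ C ∧ ∀ f Λf : ℕ → ℂ, IsHalaszClass κ f Λf →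
    ∀ y : ℕ, 200 ≤ Real.log y → ∀ n : ℕ, n ≠ 0 → gw f y n ≤ C * (n : ℝ) ^ (1 / 100 : ℝ) := by
  obtain ⟨C, hC, h⟩ := exists_norm_le_rpow hκ (ε := 1 / 200) (by norm_num)
  refine ⟨C, hC, fun f Λf hf y hy n hn => ?_⟩
  have hn1 : (1 : ℝ) ≤ n := by exact_mod_cast Nat.one_le_iff_ne_zero.2 hn
  have h0 : 0 ≤ 1 / Real.log y := by positivity
  calc gw f y n ≤ (C * (n : ℝ) ^ (1 / 200 : ℝ)) * (n : ℝ) ^ (1 / Real.log y) := by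
        unfold gw
        exact mul_le_mul (h f Λf hf n hn) (wt_le h0 (by linarith) hn) (wt_nonneg _ _ _ _)
          (by positivity)
    _ ≤ (C * (n : ℝ) ^ (1 / 200 : ℝ)) * (n : ℝ) ^ (1 / 200 : ℝ) := by
        gcongr
    _ = _ := by
        rw [mul_assoc, ← Real.rpow_add (by linarith)]
        norm_num

lemma exists_sum_gw_Ioc_le (hκ : 0 < κ) : ∃ C : ℝ, 1 ≤ C ∧ ∃ X : ℕ, 101 ≤ X ∧
    ∀ f Λf : ℕ → ℂ, IsHalaszClass κ f Λf → ∀ y : ℕ, 200 ≤ Real.log y → ∀ a L : ℕ, X ≤ a →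
    (a : ℝ) ^ (2 / 5 : ℝ) ≤ L → L ≤ 100 * a →
    ∑ n ∈ Ioc a (a + L), gw f y n ≤ C * (L / Real.log a) * Real.log y ^ κ := by
  obtain ⟨C₀, hC₀, h₀⟩ := exists_gw_le_rpow hκ
  obtain ⟨C, hC, X, hX, h⟩ := exists_sum_Ioc_le (max κ 1 * 3) C₀
    (by nlinarith [le_max_right κ 1]) (by linarith)
  refine ⟨C * Real.exp (κ * 81), one_le_mul_of_one_le_of_one_le hC (Real.one_le_exp (by positivity)),
    X, hX, fun f Λf hf y hy a L ha haL hLa => ?_⟩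
  refine (h (gw f y) (isNonnegMult_gw hf y) (fun p e hp => gw_prime_pow_le hf hκ (by linarith) hp e)
    (h₀ f Λf hf y hy) a L ha haL hLa).trans ?_
  have hla : 0 ≤ Real.log a := Real.log_natCast_nonneg a
  calc C * ((L / Real.log a) * Real.exp (∑ p ∈ (a + 1).primesBelow, gw f y p / p))
      ≤ C * ((L / Real.log a) * Real.exp (κ * (Real.log (Real.log y) + 81))) := by
        gcongr
        exact sum_gw_prime_div_le hf hκ (by linarith) fun p hp => Nat.prime_of_mem_primesBelow hp
    _ = _ := by rw [exp_mul_log_add (by linarith)]; ring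

lemma exists_sum_norm_Ioc_le (hκ : 0 < κ) : ∃ C : ℝ, 1 ≤ C ∧ ∃ X : ℕ, 101 ≤ X ∧
    ∀ f Λf : ℕ → ℂ, IsHalaszClass κ f Λf → ∀ a L : ℕ, X ≤ a →
    (a : ℝ) ^ (2 / 5 : ℝ) ≤ L → L ≤ 100 * a →
    ∑ n ∈ Ioc a (a + L), ‖f n‖ ≤ C * (L / Real.log a) * Real.log a ^ κ := by
  obtain ⟨C₀, hC₀, h₀⟩ := exists_norm_le_rpow hκ (ε := 1 / 100) (by norm_num)
  obtain ⟨C, hC, X, hX, h⟩ := exists_sum_Ioc_le (max κ 1) C₀ (le_max_right _ _) (by linarith)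
  refine ⟨C * Real.exp (κ * 12), one_le_mul_of_one_le_of_one_le hC (Real.one_le_exp (by positivity)),
    X, hX, fun f Λf hf a L ha haL hLa => ?_⟩
  refine (h (fun n => ‖f n‖) hf.isNonnegMult (fun p e hp => hf.norm_pow_le hκ hp e)
    (h₀ f Λf hf) a L ha haL hLa).trans ?_
  have ha' : (101 : ℝ) ≤ a := by exact_mod_cast hX.trans ha
  have hla : 1 ≤ Real.log a := by
    rw [Real.le_log_iff_exp_le (by linarith)]
    linarith [Real.exp_one_lt_three]
  calc C * ((L / Real.log a) * Real.exp (∑ p ∈ (a + 1).primesBelow, ‖f p‖ / p))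
      ≤ C * ((L / Real.log a) * Real.exp (κ * (Real.log (Real.log a) + 12))) := by
        gcongr
        calc ∑ p ∈ (a + 1).primesBelow, ‖f p‖ / p ≤ ∑ p ∈ (a + 1).primesBelow, κ * ((1 : ℝ) / p) := by
              refine sum_le_sum fun p hp => ?_
              rw [mul_one_div]
              gcongr
              exact hf.norm_prime_le (Nat.prime_of_mem_primesBelow hp)
          _ ≤ _ := by
              rw [← mul_sum]
              gcongr
              refine sum_prime_inv_le hla fun p hp => ?_
              have hp' := Nat.prime_of_mem_primesBelow hp
              refine ⟨hp', Real.log_le_log (by exact_mod_cast hp'.pos) ?_⟩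
              have := Nat.lt_of_mem_primesBelow hp
              exact_mod_cast (by omega : p ≤ a)
    _ = _ := by rw [exp_mul_log_add (by linarith)]; ring

lemma mem_smoothNumbers_of_le {n N : ℕ} (hn : n ≠ 0) (h : n ≤ N) :
    n ∈ Nat.smoothNumbers (N + 1) := by
  rw [Nat.mem_smoothNumbers']
  intro p _ hpn
  have := Nat.le_of_dvd (by omega) hpn
  omega

lemma exists_sum_gw_div_le (hκ : 0 < κ) : ∃ C : ℝ, 1 ≤ C ∧
    ∀ f Λf : ℕ → ℂ, IsHalaszClass κ f Λf → ∀ y : ℕ, 200 ≤ Real.log y → ∀ S : Finset ℕ,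
    (∀ n ∈ S, n ≠ 0) → ∑ n ∈ S, gw f y n / n ≤ C * Real.log y ^ κ := by
  obtain ⟨C₀, hC₀, h₀⟩ := exists_gw_le_rpow hκ
  refine ⟨Real.exp (powConst C₀) * Real.exp (κ * 81), one_le_mul_of_one_le_of_one_le
    (Real.one_le_exp (powConst_nonneg (by linarith))) (Real.one_le_exp (by positivity)),
    fun f Λf hf y hy S hS => ?_⟩
  have hsup : ∀ n ∈ S, n ≤ S.sup id := fun n hn => le_sup (f := id) hn
  have := (isNonnegMult_gw hf y).sum_smooth_rpow_le (K := max κ 1 * 3) (C₀ := C₀) (ρ := 0) (B := 0)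
    (l := max 1 (Real.log (S.sup id : ℕ))) (N := S.sup id) (a := S.sup id) (U := S) (by linarith)
    (fun p hp => by simpa using gw_prime_pow_le hf hκ (by linarith : 1 ≤ Real.log y) hp 1)
    (h₀ f Λf hf y hy) le_rfl (by norm_num) (le_max_left _ _) (by simp) le_rfl (le_max_right _ _)
    (fun n hn => mem_smoothNumbers_of_le (hS n hn) (hsup n hn))
  simp only [mul_zero, zero_mul, zero_add, add_zero, Real.rpow_neg_one] at this
  calc ∑ n ∈ S, gw f y n / n = ∑ n ∈ S, gw f y n * (n : ℝ)⁻¹ := by simp only [div_eq_mul_inv]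
    _ ≤ _ := this
    _ ≤ Real.exp (powConst C₀) * Real.exp (κ * (Real.log (Real.log y) + 81)) := by
        gcongr
        exact sum_gw_prime_div_le hf hκ (by linarith) fun p hp => Nat.prime_of_mem_primesBelow hp
    _ = _ := by rw [exp_mul_log_add (by linarith)]; ring

lemma sum_prime_rpow_sub_le {σ : ℝ} (hσ : 0 < σ) (hσ1 : σ ≤ 1) {S : Finset ℕ}
    (hS : ∀ p ∈ S, p.Prime) :
    ∑ p ∈ S, (p : ℝ) ^ (-1 - σ) ≤ Real.log (1 / σ) + 60 := by
  have hl : 1 ≤ 1 / σ := by rw [le_div_iff₀ hσ]; linarith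
  rw [← sum_filter_add_sum_filter_not S (fun p : ℕ => Real.log p ≤ 1 / σ)]
  have h1 : ∑ p ∈ S with Real.log (p : ℕ) ≤ 1 / σ, (p : ℝ) ^ (-1 - σ) ≤ Real.log (1 / σ) + 12 := by
    refine le_trans (sum_le_sum fun p hp => ?_)
      (sum_prime_inv_le hl (S := S.filter (fun p : ℕ => Real.log p ≤ 1 / σ)) fun p hp => ?_)
    · have : (1 : ℝ) ≤ p := by exact_mod_cast (hS p (mem_filter.1 hp).1).one_lt.le
      rw [one_div, ← Real.rpow_neg_one]
      exact Real.rpow_le_rpow_of_exponent_le this (by linarith)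
    · rw [mem_filter] at hp
      exact ⟨hS p hp.1, hp.2⟩
  have h2 : ∑ p ∈ S with ¬ Real.log (p : ℕ) ≤ 1 / σ, (p : ℝ) ^ (-1 - σ) ≤ 48 := by
    have := sum_prime_rpow_le hl (S := S.filter (fun p : ℕ => ¬ Real.log p ≤ 1 / σ))
      fun p hp => by
        rw [mem_filter, not_le] at hp
        exact ⟨hS p hp.1, hp.2.le⟩
    rwa [one_div_one_div] at this
  linarith

lemma exists_sum_norm_rpow_le (hκ : 0 < κ) : ∃ C : ℝ, 1 ≤ C ∧
    ∀ f Λf : ℕ → ℂ, IsHalaszClass κ f Λf → ∀ σ : ℝ, 0 < σ → σ ≤ 1 → ∀ S : Finset ℕ,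
    (∀ n ∈ S, n ≠ 0) → ∑ n ∈ S, ‖f n‖ * (n : ℝ) ^ (-1 - σ) ≤ C * σ ^ (-κ) := by
  obtain ⟨C₀, hC₀, h₀⟩ := exists_norm_le_rpow hκ (ε := 1 / 100) (by norm_num)
  refine ⟨Real.exp (powConst C₀) * Real.exp (κ * 60), one_le_mul_of_one_le_of_one_le
    (Real.one_le_exp (powConst_nonneg (by linarith))) (Real.one_le_exp (by positivity)),
    fun f Λf hf σ hσ hσ1 S hS => ?_⟩
  have hsup : ∀ n ∈ S, n ≤ S.sup id := fun n hn => le_sup (f := id) hn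
  refine ((hf.isNonnegMult.mul_rpow (-1 - σ)).sum_smooth_le (C := C₀) (by linarith)
    (fun p e hp _ => ?_) _ S
    (fun n hn => mem_smoothNumbers_of_le (hS n hn) (hsup n hn))).trans ?_
  · have h0 : p ^ e ≠ 0 := pow_ne_zero _ hp.ne_zero
    have h1 : (1 : ℝ) ≤ ((p ^ e : ℕ) : ℝ) := by exact_mod_cast Nat.one_le_iff_ne_zero.2 h0
    calc ‖f (p ^ e)‖ * ((p ^ e : ℕ) : ℝ) ^ (-1 - σ)
        ≤ C₀ * ((p ^ e : ℕ) : ℝ) ^ (1 / 100 : ℝ) * ((p ^ e : ℕ) : ℝ) ^ (-1 - σ) := by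
          gcongr
          exact h₀ f Λf hf _ h0
      _ = C₀ * ((p ^ e : ℕ) : ℝ) ^ (1 / 100 + (-1 - σ)) := by
          rw [mul_assoc, ← Real.rpow_add (by linarith)]
      _ ≤ _ := by
          gcongr
          linarith
  · calc Real.exp (∑ p ∈ (S.sup id + 1).primesBelow, ‖f p‖ * (p : ℝ) ^ (-1 - σ) + powConst C₀)
        ≤ Real.exp (κ * (Real.log (1 / σ) + 60) + powConst C₀) := by
          gcongr
          calc ∑ p ∈ (S.sup id + 1).primesBelow, ‖f p‖ * (p : ℝ) ^ (-1 - σ)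
              ≤ ∑ p ∈ (S.sup id + 1).primesBelow, κ * (p : ℝ) ^ (-1 - σ) := by
                refine sum_le_sum fun p hp => ?_
                gcongr
                exact hf.norm_prime_le (Nat.prime_of_mem_primesBelow hp)
            _ ≤ _ := by
                rw [← mul_sum]
                gcongr
                exact sum_prime_rpow_sub_le hσ hσ1 fun p hp => Nat.prime_of_mem_primesBelow hp
      _ = _ := by
          rw [Real.exp_add, exp_mul_log_add (by positivity), one_div, Real.inv_rpow hσ.le,
            ← Real.rpow_neg hσ.le]
          ring

end Applications

section Kernels

lemma integrable_one_div_mul_add_one {c : ℝ} (hc : 0 < c) :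
    Integrable fun t : ℝ => 1 / (((c : ℂ) + t * I) * ((c : ℂ) + t * I + 1)) := by
  have hb : Integrable fun t : ℝ => (max 1 (1 / c ^ 2)) * (1 + t ^ 2)⁻¹ :=
    integrable_inv_one_add_sq.const_mul _
  have hne : ∀ t : ℝ, ((c : ℂ) + t * I) * ((c : ℂ) + t * I + 1) ≠ 0 := fun t h => by
    have := congrArg Complex.re h
    have := congrArg Complex.im h
    simp at *
    nlinarith [sq_nonneg t]
  refine hb.mono' (Continuous.aestronglyMeasurable (by
    refine Continuous.div continuous_const (by fun_prop) hne)) (Filter.Eventually.of_forall fun t => ?_)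
  rw [norm_div, norm_mul, norm_one]
  have h1 : Real.sqrt (c ^ 2 + t ^ 2) = ‖(c : ℂ) + t * I‖ := by
    rw [Complex.norm_add_mul_I]
  have h2 : ‖(c : ℂ) + t * I‖ ≤ ‖(c : ℂ) + t * I + 1‖ := by
    rw [Complex.norm_add_mul_I, show (c : ℂ) + t * I + 1 = ((c + 1 : ℝ) : ℂ) + t * I by push_cast; ring,
      Complex.norm_add_mul_I]
    apply Real.sqrt_le_sqrt
    nlinarith
  have h3 : 0 < c ^ 2 + t ^ 2 := by positivity
  have h4 : c ^ 2 + t ^ 2 ≤ ‖(c : ℂ) + t * I‖ * ‖(c : ℂ) + t * I + 1‖ := by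
    calc c ^ 2 + t ^ 2 = ‖(c : ℂ) + t * I‖ * ‖(c : ℂ) + t * I‖ := by
          rw [← h1, Real.mul_self_sqrt h3.le]
      _ ≤ _ := by gcongr
  calc 1 / (‖(c : ℂ) + t * I‖ * ‖(c : ℂ) + t * I + 1‖) ≤ 1 / (c ^ 2 + t ^ 2) := by gcongr
    _ ≤ (max 1 (1 / c ^ 2)) * (1 + t ^ 2)⁻¹ := by
        rw [← div_eq_mul_inv, div_le_div_iff₀ h3 (by positivity), one_mul]
        have hm1 := le_max_left 1 (1 / c ^ 2)
        have hm2 := le_max_right 1 (1 / c ^ 2)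
        have : 1 ≤ max 1 (1 / c ^ 2) * c ^ 2 := by
          calc 1 = 1 / c ^ 2 * c ^ 2 := by field_simp
            _ ≤ _ := by gcongr
        nlinarith [sq_nonneg t]

open Set in
lemma integral_perron {c r : ℝ} (hc : 0 < c) (hr : 0 < r) :
    ∫ t : ℝ, (r : ℂ) ^ ((c : ℂ) + t * I) / (((c : ℂ) + t * I) * ((c : ℂ) + t * I + 1)) =
      2 * Real.pi * (max (1 - 1 / r) 0 : ℝ) := by
  set φ : ℝ → ℂ := fun u => (Ioc (0 : ℝ) 1).indicator (fun _ => (1 : ℂ)) u -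
    (Ioc (0 : ℝ) 1).indicator (fun u : ℝ => (u : ℂ) ^ (1 : ℂ)) u
  have hM : ∀ s : ℂ, 0 < s.re → HasMellin φ s (1 / (s * (s + 1))) := by
    intro s hs
    have h1 := hasMellin_one_Ioc hs
    have h2 := hasMellin_cpow_Ioc 1 (s := s) (by simp; linarith)
    have := hasMellin_sub h1.1 h2.1
    rw [h1.2, h2.2] at this
    have hs0 : s ≠ 0 := fun h => by simp [h] at hs
    have hs1 : s + 1 ≠ 0 := fun h => by
      have := congrArg Complex.re h
      simp at this; linarith
    rwa [show 1 / s - 1 / (s + 1) = 1 / (s * (s + 1)) by field_simp; ring] at this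
  have hre : ∀ t : ℝ, 0 < ((c : ℂ) + t * I).re := fun t => by simpa using hc
  have hcont : ContinuousAt φ (1 / r) := by
    have heq : φ =ᶠ[nhds (1 / r)] fun u => ((max (1 - u) 0 : ℝ) : ℂ) := by
      filter_upwards [lt_mem_nhds (one_div_pos.2 hr)] with u hu
      simp only [φ, indicator, Set.mem_Ioc, hu, true_and, cpow_one]
      split_ifs with h
      · rw [max_eq_left (by linarith)]; push_cast; ring
      · rw [max_eq_right (by linarith)]; simp
    refine ContinuousAt.congr ?_ heq.symm
    fun_prop
  have hval : φ (1 / r) = (max (1 - 1 / r) 0 : ℝ) := by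
    simp only [φ, indicator, Set.mem_Ioc, one_div_pos.2 hr, true_and, cpow_one]
    split_ifs with h
    · rw [max_eq_left (by linarith)]; push_cast; ring
    · rw [max_eq_right (by linarith)]; simp
  have hV : VerticalIntegrable (mellin φ) c := by
    unfold VerticalIntegrable
    simp only [(hM _ (hre _)).2]
    exact integrable_one_div_mul_add_one hc
  have key := mellinInv_mellin_eq c φ (one_div_pos.2 hr) (hM c (by simpa using hc)).1 hV hcont
  rw [hval, mellinInv] at key
  have hpi_two : 2 * (Real.pi : ℂ) ≠ 0 := by simp
  rw [← key, real_smul]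
  push_cast
  rw [← mul_assoc, mul_one_div_cancel hpi_two, one_mul]
  congr 1
  ext t
  have harg : (r : ℂ).arg ≠ Real.pi := by
    rw [Complex.arg_ofReal_of_nonneg hr.le]
    exact Real.pi_ne_zero.symm
  rw [(hM _ (hre t)).2, smul_eq_mul, mul_one_div, one_div (r : ℂ), Complex.inv_cpow _ _ harg,
    ← Complex.cpow_neg, neg_neg]

open Set in
lemma integral_poisson {r : ℝ} (hr : 0 < r) :
    ∫ t : ℝ, (r : ℂ) ^ ((t : ℂ) * I) * ((1 + t ^ 2)⁻¹ : ℝ) = Real.pi * (min r r⁻¹ : ℝ) := by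
  set ψ : ℝ → ℂ := (Ioc (0 : ℝ) 1).indicator (fun u : ℝ => (u : ℂ) ^ (1 : ℂ))
  set φ : ℝ → ℂ := fun u => ((min u u⁻¹ : ℝ) : ℂ)
  have hM : ∀ t : ℝ, HasMellin φ (t * I) (2 * ((1 + t ^ 2)⁻¹ : ℝ)) := by
    intro t
    have h1 := hasMellin_cpow_Ioc 1 (s := t * I) (by simp)
    have h2 := hasMellin_cpow_Ioc 1 (s := -(t * I)) (by simp)
    have h3 : MellinConvergent (fun u => ψ u⁻¹) (t * I) := by
      have := (MellinConvergent.comp_rpow (f := ψ) (s := t * I) (a := -1) (by norm_num)).2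
        (by rw [show (t : ℂ) * I / ((-1 : ℝ) : ℂ) = -(t * I) by push_cast; ring]; exact h2.1)
      simpa only [Real.rpow_neg_one] using this
    have h4 := mellin_comp_inv ψ (t * I)
    rw [h2.2] at h4
    have h5 := hasMellin_add h1.1 h3
    rw [h1.2, h4] at h5
    have hne : (1 : ℂ) + (t : ℂ) ^ 2 ≠ 0 := by
      norm_cast
      positivity
    have hne1 : (t : ℂ) * I + 1 ≠ 0 := fun h => by simpa using congrArg Complex.re h
    have hne2 : -((t : ℂ) * I) + 1 ≠ 0 := fun h => by simpa using congrArg Complex.re h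
    have hsum : 1 / ((t : ℂ) * I + 1) + 1 / (-((t : ℂ) * I) + 1) = 2 * ((1 + t ^ 2)⁻¹ : ℝ) := by
      rw [div_add_div _ _ hne1 hne2, div_eq_iff (mul_ne_zero hne1 hne2)]
      push_cast
      field_simp
      linear_combination (2 : ℂ) * t ^ 2 * I_sq
    rw [hsum] at h5
    have hae : ∀ᵐ u ∂(volume.restrict (Ioi (0 : ℝ))), ψ u + ψ u⁻¹ = φ u := by
      have : ∀ᵐ u : ℝ ∂(volume.restrict (Ioi (0 : ℝ))), u ≠ 1 :=
        ae_restrict_of_ae (measure_eq_zero_iff_ae_notMem.1 (measure_singleton (1 : ℝ)))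
      filter_upwards [this, ae_restrict_mem measurableSet_Ioi] with u hu1 hu0
      have hu0 : (0 : ℝ) < u := hu0
      simp only [ψ, φ, indicator, Set.mem_Ioc, hu0, inv_pos.2 hu0, true_and, cpow_one]
      rcases lt_or_gt_of_ne hu1 with h | h
      · have h' := one_lt_inv_iff₀.2 ⟨hu0, h⟩
        rw [if_pos h.le, if_neg (not_le.2 h'), min_eq_left (by linarith), add_zero]
      · have h' := inv_lt_one_of_one_lt₀ h
        rw [if_neg (not_le.2 h), if_pos h'.le, min_eq_right (by linarith), zero_add]
    constructor
    · refine Integrable.congr h5.1 ?_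
      filter_upwards [hae] with u hu
      rw [← hu]
    · rw [← h5.2]
      refine integral_congr_ae ?_
      filter_upwards [hae] with u hu
      rw [← hu]
  have hcont : ContinuousAt φ r⁻¹ := by
    have := (inv_pos.2 hr).ne'
    fun_prop (disch := assumption)
  have hV : VerticalIntegrable (mellin φ) (0 : ℝ) := by
    unfold VerticalIntegrable
    simp only [ofReal_zero, zero_add, (hM _).2]
    exact (integrable_inv_one_add_sq.ofReal).const_mul 2
  have key := mellinInv_mellin_eq 0 φ (inv_pos.2 hr) (by simpa using (hM 0).1) hV hcont
  simp only [mellinInv, ofReal_zero, zero_add, (hM _).2, φ, inv_inv] at key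
  have harg : (r : ℂ).arg ≠ Real.pi := by
    rw [Complex.arg_ofReal_of_nonneg hr.le]
    exact Real.pi_ne_zero.symm
  have hpi : (Real.pi : ℂ) ≠ 0 := by simp
  rw [min_comm r, ← key, real_smul]
  simp only [ofReal_inv, Complex.inv_cpow _ _ harg, ← Complex.cpow_neg, neg_neg, smul_eq_mul,
    mul_left_comm _ (2 : ℂ), integral_const_mul]
  push_cast
  field_simp
  simp only [mul_comm I]

/-- The Poisson kernel of width `T`. -/
def poissonKer (T t : ℝ) : ℝ := (1 + (t / T) ^ 2)⁻¹

lemma poissonKer_pos (T t : ℝ) : 0 < poissonKer T t := by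
  unfold poissonKer; positivity

lemma integrable_poissonKer {T : ℝ} (hT : 0 < T) : Integrable (poissonKer T) :=
  integrable_inv_one_add_sq.comp_div hT.ne'

@[fun_prop]
lemma continuous_poissonKer (T : ℝ) : Continuous (poissonKer T) := by
  unfold poissonKer
  exact Continuous.inv₀ (by fun_prop) fun t => by positivity

lemma integral_cpow_mul_poissonKer {r T : ℝ} (hr : 0 < r) (hT : 0 < T) :
    ∫ t : ℝ, (r : ℂ) ^ ((t : ℂ) * I) * poissonKer T t =
      (Real.pi * T * Real.exp (-(T * |Real.log r|)) : ℝ) := by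
  have h1 := integral_poisson (r := r ^ T) (by positivity)
  have h2 := Measure.integral_comp_div (fun t : ℝ => ((r ^ T : ℝ) : ℂ) ^ ((t : ℂ) * I) *
    ((1 + t ^ 2)⁻¹ : ℝ)) T
  rw [h1, abs_of_pos hT, real_smul] at h2
  have h3 : min (r ^ T) (r ^ T)⁻¹ = Real.exp (-(T * |Real.log r|)) := by
    rw [Real.rpow_def_of_pos hr, ← Real.exp_neg, ← (Real.exp_monotone).map_min]
    congr 1
    rcases le_total 0 (Real.log r) with h | h
    · rw [abs_of_nonneg h, min_eq_right (by nlinarith)]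
      ring
    · rw [abs_of_nonpos h, min_eq_left (by nlinarith)]
      ring
  rw [h3] at h2
  calc _ = _ := ?_
    _ = _ := h2
    _ = _ := by push_cast; ring
  refine integral_congr_ae (Filter.Eventually.of_forall fun t => ?_)
  simp only [poissonKer]
  congr 1
  have hrT : 0 < r ^ T := by positivity
  rw [cpow_def_of_ne_zero (by exact_mod_cast hr.ne'), cpow_def_of_ne_zero (by exact_mod_cast hrT.ne'),
    ← ofReal_log hr.le, ← ofReal_log hrT.le, Real.log_rpow hr]
  have : (T : ℂ) ≠ 0 := by exact_mod_cast hT.ne'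
  congr 1
  push_cast
  field_simp

end Kernels

section MeanValue

variable {S : Finset ℕ} {T U y : ℝ}

lemma sum_vonMangoldt_window_le (hT : 2 ≤ T) (hU : T ^ 2 ≤ U)
    (hS : ∀ m ∈ S, U * (1 - 1 / T) ≤ m ∧ (m : ℝ) ≤ U) : ∑ m ∈ S, Λ m ≤ 9000 * (U / T) := by
  have hT0 : 0 < T := by linarith
  have hU0 : 0 < U := by nlinarith
  have hUT : T ≤ U / T := by rw [le_div_iff₀ hT0]; nlinarith
  have hUU : U ≤ (U / T) ^ 2 := by
    rw [div_pow, le_div_iff₀ (by positivity)]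
    nlinarith
  set L := ⌈2 * (U / T)⌉₊
  have hL : 2 * (U / T) ≤ L := Nat.le_ceil _
  have hL' : (L : ℝ) ≤ 3 * (U / T) := by
    have := (Nat.ceil_lt_add_one (by positivity : 0 ≤ 2 * (U / T))).le
    linarith
  have hL1 : (1 : ℝ) ≤ L := by linarith
  have hsub : S ⊆ Ioc (⌊U⌋₊ - L) (⌊U⌋₊ - L + L) := by
    intro m hm
    obtain ⟨h1, h2⟩ := hS m hm
    have hm : m ≤ ⌊U⌋₊ := Nat.le_floor h2
    have hU1 : U * (1 - 1 / T) = U - U / T := by ring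
    have hm0 : (0 : ℝ) < m := lt_of_lt_of_le (mul_pos hU0 (by
      have : 1 / T < 1 := by rw [div_lt_one hT0]; linarith
      linarith)) h1
    have hm0 : 0 < m := by exact_mod_cast hm0
    have hlt : ⌊U⌋₊ < m + L := by
      have : (⌊U⌋₊ : ℝ) < m + L := by
        have := Nat.floor_le hU0.le
        linarith
      exact_mod_cast this
    rw [mem_Ioc]
    omega
  calc ∑ m ∈ S, Λ m ≤ ∑ m ∈ Ioc (⌊U⌋₊ - L) (⌊U⌋₊ - L + L), Λ m :=
        sum_le_sum_of_subset_of_nonneg hsub fun _ _ _ => ArithmeticFunction.vonMangoldt_nonneg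
    _ ≤ 3000 * L := by
        refine sum_vonMangoldt_Ioc_le _ _ (by exact_mod_cast hL1) ?_
        calc ((⌊U⌋₊ - L : ℕ) : ℝ) ≤ ⌊U⌋₊ := by exact_mod_cast Nat.sub_le _ _
          _ ≤ U := Nat.floor_le hU0.le
          _ ≤ (U / T) ^ 2 := hUU
          _ ≤ (L : ℝ) ^ 2 := by gcongr; linarith
          _ = (L : ℝ) ^ (2 : ℝ) := by norm_cast
          _ ≤ _ := Real.rpow_le_rpow_of_exponent_le hL1 (by norm_num)
    _ ≤ _ := by linarith

lemma sum_vonMangoldt_div_window_le (hT : 2 ≤ T) (hy : T ^ 2 ≤ y)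
    (hS : ∀ m ∈ S, y ≤ m ∧ U * (1 - 1 / T) ≤ m ∧ (m : ℝ) ≤ U) :
    ∑ m ∈ S, Λ m / m ≤ 18000 / T := by
  have hT0 : 0 < T := by linarith
  rcases S.eq_empty_or_nonempty with rfl | ⟨m, hm⟩
  · simp only [sum_empty]; positivity
  have hU : T ^ 2 ≤ U := by
    have := hS m hm
    linarith
  have hU0 : 0 < U := by nlinarith
  calc ∑ m ∈ S, Λ m / m ≤ ∑ m ∈ S, Λ m / (U / 2) := by
        refine sum_le_sum fun m hm => ?_
        refine div_le_div_of_nonneg_left ArithmeticFunction.vonMangoldt_nonneg (by positivity) ?_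
        refine le_trans ?_ (hS m hm).2.1
        rw [div_eq_mul_one_div]
        gcongr
        have : 1 / T ≤ 1 / 2 := by gcongr
        linarith
    _ ≤ 9000 * (U / T) / (U / 2) := by
        rw [← sum_div]
        gcongr
        exact sum_vonMangoldt_window_le hT hU fun m hm => (hS m hm).2
    _ = _ := by
        field_simp
        ring

lemma sum_vonMangoldt_exp_le (hT : 2 ≤ T) (hy : T ^ 2 ≤ y) (hS : ∀ m ∈ S, y ≤ m)
    {n : ℝ} (hn : 0 < n) :
    ∑ m ∈ S, Λ m * Real.exp (-(T * |Real.log (m / n)|)) ≤ 108000 * (n / T) := by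
  have hT0 : 0 < T := by linarith
  have hm0 : ∀ m ∈ S, (0 : ℝ) < m := fun m hm => by nlinarith [hS m hm]
  set i : ℕ → ℕ := fun m => ⌊T * |Real.log (m / n)|⌋₊
  have hi : ∀ m : ℕ, (i m : ℝ) ≤ T * |Real.log (m / n)| := fun m => Nat.floor_le (by positivity)
  have hi' : ∀ m : ℕ, T * |Real.log (m / n)| ≤ i m + 1 := fun m => (Nat.lt_floor_add_one _).le
  have he : Real.exp (-(1 / 2)) ≤ 2 / 3 := by
    rw [Real.exp_neg, inv_le_comm₀ (by positivity) (by norm_num)]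
    have := Real.add_one_le_exp (1 / 2 : ℝ)
    linarith
  have heT : 1 - 1 / T ≤ Real.exp (-(1 / T)) := by
    have := Real.add_one_le_exp (-(1 / T))
    linarith
  have key := sum_mul_le_of_levels (S := S) (i := i) (a := fun m => Λ m / m)
    (w := fun m => m / n * Real.exp (-(T * |Real.log (m / n)|))) (r := Real.exp (-(1 / 2)))
    (K := 36000 / T) (fun k _ => div_nonneg ArithmeticFunction.vonMangoldt_nonneg (by positivity))
    (by positivity) (by linarith) (fun j => ?_) (fun m hm => ?_)
  · calc ∑ m ∈ S, Λ m * Real.exp (-(T * |Real.log (m / n)|))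
        = n * ∑ m ∈ S, Λ m / m * (m / n * Real.exp (-(T * |Real.log (m / n)|))) := by
          rw [mul_sum]
          refine sum_congr rfl fun m hm => ?_
          have := hm0 m hm
          field_simp
      _ ≤ n * (36000 / T / (1 - Real.exp (-(1 / 2)))) := by gcongr
      _ ≤ n * (36000 / T / (1 / 3)) := by gcongr; linarith
      _ = _ := by ring
  · rw [← sum_filter_add_sum_filter_not (S.filter fun m => i m = j) (fun m : ℕ => n ≤ m)]
    have h1 : ∑ m ∈ (S.filter fun m => i m = j) with n ≤ (m : ℕ), Λ m / m ≤ 18000 / T := by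
      refine sum_vonMangoldt_div_window_le (U := n * Real.exp ((j + 1) / T)) hT hy fun m hm => ?_
      rw [mem_filter, mem_filter] at hm
      obtain ⟨⟨hm, hj⟩, hnm⟩ := hm
      have hm0 := hm0 m hm
      have hab : |Real.log (m / n)| = Real.log (m / n) :=
        abs_of_nonneg (Real.log_nonneg (by rwa [le_div_iff₀ hn, one_mul]))
      have e1 := hi m
      have e2 := hi' m
      rw [hj, hab] at e1 e2
      have hmn : (m : ℝ) = n * Real.exp (Real.log (m / n)) := by
        rw [Real.exp_log (by positivity)]
        field_simp
      refine ⟨hS m hm, ?_, ?_⟩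
      · calc n * Real.exp ((j + 1) / T) * (1 - 1 / T)
            ≤ n * Real.exp ((j + 1) / T) * Real.exp (-(1 / T)) := by gcongr
          _ = n * Real.exp (j / T) := by
              rw [mul_assoc, ← Real.exp_add]
              congr 2
              ring
          _ ≤ n * Real.exp (Real.log (m / n)) := by
              gcongr
              rw [div_le_iff₀ hT0]
              linarith
          _ = m := hmn.symm
      · calc (m : ℝ) = n * Real.exp (Real.log (m / n)) := hmn
          _ ≤ _ := by
              gcongr
              rw [le_div_iff₀ hT0]
              linarith
    have h2 : ∑ m ∈ (S.filter fun m => i m = j) with ¬ n ≤ (m : ℕ), Λ m / m ≤ 18000 / T := by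
      refine sum_vonMangoldt_div_window_le (U := n * Real.exp (-(j / T))) hT hy fun m hm => ?_
      rw [mem_filter, mem_filter, not_le] at hm
      obtain ⟨⟨hm, hj⟩, hnm⟩ := hm
      have hm0 := hm0 m hm
      have hab : |Real.log (m / n)| = -Real.log (m / n) :=
        abs_of_nonpos (Real.log_nonpos (by positivity) (by rw [div_le_iff₀ hn]; linarith))
      have e1 := hi m
      have e2 := hi' m
      rw [hj, hab] at e1 e2
      have hmn : (m : ℝ) = n * Real.exp (Real.log (m / n)) := by
        rw [Real.exp_log (by positivity)]
        field_simp
      refine ⟨hS m hm, ?_, ?_⟩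
      · calc n * Real.exp (-(j / T)) * (1 - 1 / T)
            ≤ n * Real.exp (-(j / T)) * Real.exp (-(1 / T)) := by gcongr
          _ = n * Real.exp (-((j + 1) / T)) := by
              rw [mul_assoc, ← Real.exp_add]
              congr 2
              ring
          _ ≤ n * Real.exp (Real.log (m / n)) := by
              gcongr
              rw [neg_le, le_div_iff₀ hT0]
              linarith
          _ = m := hmn.symm
      · calc (m : ℝ) = n * Real.exp (Real.log (m / n)) := hmn
          _ ≤ _ := by
              gcongr
              rw [le_neg, div_le_iff₀ hT0]
              linarith
    calc _ ≤ 18000 / T + 18000 / T := add_le_add h1 h2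
      _ = 36000 / T := by ring
  · have hm0 := hm0 m hm
    have e1 := hi m
    calc (m : ℝ) / n * Real.exp (-(T * |Real.log (m / n)|))
        = Real.exp (Real.log (m / n) - T * |Real.log (m / n)|) := by
          rw [sub_eq_add_neg, Real.exp_add, Real.exp_log (by positivity)]
      _ ≤ Real.exp (-(1 / 2) * i m) := by
          gcongr
          have := le_abs_self (Real.log (m / n))
          have := abs_nonneg (Real.log (m / n))
          nlinarith
      _ = _ := by rw [mul_comm, Real.exp_nat_mul]

lemma norm_natCast_cpow_neg_mul_I {n : ℕ} (hn : 0 < n) (t : ℝ) :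
    ‖(n : ℂ) ^ (-((t : ℂ) * I))‖ = 1 := by
  rw [Complex.norm_natCast_cpow_of_pos hn]
  simp

lemma continuous_natCast_cpow {n : ℕ} (hn : 0 < n) {g : ℝ → ℂ} (hg : Continuous g) :
    Continuous fun t => (n : ℂ) ^ g t :=
  hg.const_cpow (Or.inl (by exact_mod_cast hn.ne.symm))

/-- A mean value theorem for Dirichlet polynomials supported on large prime powers. -/
lemma integral_norm_sq_le (hT : 2 ≤ T) (hy : T ^ 2 ≤ y) (hS : ∀ m ∈ S, y ≤ m)
    {a : ℕ → ℂ} {c : ℕ → ℝ} (ha : ∀ n ∈ S, ‖a n‖ ≤ c n * Λ n) (hc : ∀ n ∈ S, 0 ≤ c n) :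
    Integrable (fun t : ℝ => ‖∑ n ∈ S, a n * (n : ℂ) ^ (-((t : ℂ) * I))‖ ^ 2 * poissonKer T t) ∧
    ∫ t : ℝ, ‖∑ n ∈ S, a n * (n : ℂ) ^ (-((t : ℂ) * I))‖ ^ 2 * poissonKer T t ≤
      108000 * Real.pi * ∑ n ∈ S, c n ^ 2 * Λ n * n := by
  have hT0 : 0 < T := by linarith
  have hn0 : ∀ m ∈ S, 0 < m := fun m hm => by
    have : (0 : ℝ) < m := by nlinarith [hS m hm]
    exact_mod_cast this
  have hcont : Continuous fun t : ℝ => ∑ n ∈ S, a n * (n : ℂ) ^ (-((t : ℂ) * I)) :=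
    continuous_finsetSum _ fun n hn => continuous_const.mul
      (continuous_natCast_cpow (hn0 n hn) (by fun_prop))
  constructor
  · refine ((integrable_poissonKer hT0).const_mul ((∑ n ∈ S, ‖a n‖) ^ 2)).mono'
      (by fun_prop) (Filter.Eventually.of_forall fun t => ?_)
    rw [Real.norm_of_nonneg (mul_nonneg (by positivity) (poissonKer_pos T t).le)]
    have := (poissonKer_pos T t).le
    gcongr
    refine (norm_sum_le _ _).trans (sum_le_sum fun n hn => ?_)
    rw [norm_mul, norm_natCast_cpow_neg_mul_I (hn0 n hn), mul_one]
  have hexp : ∀ t : ℝ, ((‖∑ n ∈ S, a n * (n : ℂ) ^ (-((t : ℂ) * I))‖ ^ 2 * poissonKer T t : ℝ) : ℂ) =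
      ∑ m ∈ S, ∑ n ∈ S, a n * (starRingEnd ℂ) (a m) *
        ((((m : ℝ) / n : ℝ) : ℂ) ^ ((t : ℂ) * I) * poissonKer T t) := by
    intro t
    push_cast
    rw [← Complex.mul_conj', map_sum, sum_mul_sum, sum_comm, sum_mul]
    refine sum_congr rfl fun m hm => ?_
    rw [sum_mul]
    refine sum_congr rfl fun n hn => ?_
    have hm' : (0 : ℝ) < m := by exact_mod_cast hn0 m hm
    have hn' : (0 : ℝ) < n := by exact_mod_cast hn0 n hn
    have hr : (0 : ℝ) < m / n := by positivity
    have hcast : (m : ℂ) / n = ((m / n : ℝ) : ℂ) := by push_cast; rfl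
    have hlog : ∀ {u : ℝ}, 0 < u → ∀ z : ℂ, (u : ℂ) ^ z = Complex.exp (Real.log u * z) := by
      intro u hu z
      rw [Complex.cpow_def_of_ne_zero (by exact_mod_cast hu.ne'), Complex.ofReal_log hu.le]
    have e : (n : ℂ) ^ (-((t : ℂ) * I)) * (starRingEnd ℂ) ((m : ℂ) ^ (-((t : ℂ) * I))) =
        ((m : ℂ) / n) ^ ((t : ℂ) * I) := by
      rw [hcast, hlog hr, ← Complex.ofReal_natCast n, ← Complex.ofReal_natCast m, hlog hn', hlog hm',
        ← Complex.exp_conj, ← Complex.exp_add, Real.log_div hm'.ne' hn'.ne']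
      congr 1
      simp only [map_mul, map_neg, conj_ofReal, conj_I, ofReal_sub]
      ring
    rw [map_mul, ← e]
    ring
  have hInt : ((∫ t : ℝ, ‖∑ n ∈ S, a n * (n : ℂ) ^ (-((t : ℂ) * I))‖ ^ 2 * poissonKer T t : ℝ) : ℂ) =
      ∑ m ∈ S, ∑ n ∈ S, a n * (starRingEnd ℂ) (a m) *
        (Real.pi * T * Real.exp (-(T * |Real.log (m / n)|)) : ℝ) := by
    have hI : ∀ m ∈ S, ∀ n ∈ S, Integrable fun t : ℝ => a n * (starRingEnd ℂ) (a m) *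
        ((((m : ℝ) / n : ℝ) : ℂ) ^ ((t : ℂ) * I) * poissonKer T t) := by
      intro m hm n hn
      have hr : (0 : ℝ) < (m : ℝ) / n := div_pos (by exact_mod_cast hn0 m hm) (by exact_mod_cast hn0 n hn)
      refine Integrable.const_mul ?_ _
      refine (integrable_poissonKer hT0).mono' (Continuous.aestronglyMeasurable ?_)
        (Filter.Eventually.of_forall fun t => ?_)
      · refine Continuous.mul (Continuous.const_cpow (by fun_prop) (Or.inl ?_)) (by fun_prop)
        exact_mod_cast hr.ne'
      · rw [norm_mul, Complex.norm_cpow_eq_rpow_re_of_pos hr, Complex.norm_real,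
          Real.norm_of_nonneg (poissonKer_pos T t).le]
        simp
    rw [← integral_complex_ofReal]
    simp_rw [hexp]
    rw [integral_finsetSum _ fun m hm => integrable_finsetSum _ fun n hn => hI m hm n hn]
    refine sum_congr rfl fun m hm => ?_
    rw [integral_finsetSum _ fun n hn => hI m hm n hn]
    refine sum_congr rfl fun n hn => ?_
    rw [integral_const_mul, integral_cpow_mul_poissonKer (div_pos (by exact_mod_cast hn0 m hm)
      (by exact_mod_cast hn0 n hn)) hT0]
  set E : ℕ → ℕ → ℝ := fun m n => Real.exp (-(T * |Real.log (m / n)|))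
  have hE : ∀ m ∈ S, ∀ n ∈ S, E m n = E n m := by
    intro m hm n hn
    simp only [E]
    rw [← inv_div, Real.log_inv, abs_neg]
  have hb : ∀ n ∈ S, ∑ m ∈ S, Λ m * E m n ≤ 108000 * (n / T) := fun n hn =>
    sum_vonMangoldt_exp_le hT hy hS (by exact_mod_cast hn0 n hn)
  have hQ : ∑ m ∈ S, ∑ n ∈ S, c n ^ 2 * (Λ n * (Λ m * E m n)) ≤
      108000 / T * ∑ n ∈ S, c n ^ 2 * Λ n * n := by
    rw [sum_comm, mul_sum]
    refine sum_le_sum fun n hn => ?_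
    rw [← mul_sum, ← mul_sum]
    calc c n ^ 2 * (Λ n * ∑ m ∈ S, Λ m * E m n) ≤ c n ^ 2 * (Λ n * (108000 * (n / T))) := by
          have := ArithmeticFunction.vonMangoldt_nonneg (n := n)
          gcongr
          exact hb n hn
      _ = _ := by ring
  calc ∫ t : ℝ, ‖∑ n ∈ S, a n * (n : ℂ) ^ (-((t : ℂ) * I))‖ ^ 2 * poissonKer T t
      ≤ ‖((∫ t : ℝ, ‖∑ n ∈ S, a n * (n : ℂ) ^ (-((t : ℂ) * I))‖ ^ 2 * poissonKer T t : ℝ) : ℂ)‖ := by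
        rw [Complex.norm_real]; exact Real.le_norm_self _
    _ ≤ ∑ m ∈ S, ∑ n ∈ S, ‖a n‖ * ‖a m‖ * (Real.pi * T * E m n) := by
        rw [hInt]
        refine (norm_sum_le _ _).trans (sum_le_sum fun m hm => ?_)
        refine (norm_sum_le _ _).trans (sum_le_sum fun n hn => ?_)
        rw [norm_mul, norm_mul, RCLike.norm_conj, Complex.norm_real, Real.norm_of_nonneg (by positivity)]
    _ ≤ ∑ m ∈ S, ∑ n ∈ S, Real.pi * T / 2 *
          (c n ^ 2 * (Λ n * (Λ m * E m n)) + c m ^ 2 * (Λ m * (Λ n * E n m))) := by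
        refine sum_le_sum fun m hm => sum_le_sum fun n hn => ?_
        have h1 := ArithmeticFunction.vonMangoldt_nonneg (n := n)
        have h2 := ArithmeticFunction.vonMangoldt_nonneg (n := m)
        have h3 : 0 ≤ E m n := by positivity
        have h4 : 0 ≤ Real.pi * T := by positivity
        rw [hE n hn m hm]
        calc ‖a n‖ * ‖a m‖ * (Real.pi * T * E m n)
            ≤ (c n * Λ n) * (c m * Λ m) * (Real.pi * T * E m n) := by
              have := ha n hn
              have := ha m hm
              have := hc n hn
              gcongr
          _ = Real.pi * T * (c n * c m * (Λ n * Λ m * E m n)) := by ring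
          _ ≤ Real.pi * T * ((c n ^ 2 + c m ^ 2) / 2 * (Λ n * Λ m * E m n)) := by
              gcongr
              nlinarith [sq_nonneg (c n - c m)]
          _ = _ := by ring
    _ = Real.pi * T * ∑ m ∈ S, ∑ n ∈ S, c n ^ 2 * (Λ n * (Λ m * E m n)) := by
        have hs : ∑ m ∈ S, ∑ n ∈ S, c m ^ 2 * (Λ m * (Λ n * E n m)) =
            ∑ m ∈ S, ∑ n ∈ S, c n ^ 2 * (Λ n * (Λ m * E m n)) := sum_comm
        calc _ = Real.pi * T / 2 * (∑ m ∈ S, ∑ n ∈ S, c n ^ 2 * (Λ n * (Λ m * E m n)) +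
              ∑ m ∈ S, ∑ n ∈ S, c m ^ 2 * (Λ m * (Λ n * E n m))) := by
              simp_rw [← sum_add_distrib, mul_sum]
          _ = _ := by rw [hs]; ring
    _ ≤ Real.pi * T * (108000 / T * ∑ n ∈ S, c n ^ 2 * Λ n * n) := by gcongr
    _ = _ := by
        field_simp

end MeanValue

section Trapezoid

variable {x h Δ : ℝ}

/-- The trapezoidal weight equal to `1` on `[x, x + h]`, with slopes of length `Δ`. -/
def trap (x h Δ u : ℝ) : ℝ :=
  (max (x + h + Δ - u) 0 - max (x + h - u) 0 - max (x - u) 0 + max (x - Δ - u) 0) / Δ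

/-- The Mellin transform of `trap x h Δ`. -/
def trapHat (x h Δ : ℝ) (s : ℂ) : ℂ :=
  (((x + h + Δ : ℝ) : ℂ) ^ (s + 1) - ((x + h : ℝ) : ℂ) ^ (s + 1) - ((x : ℝ) : ℂ) ^ (s + 1) +
    ((x - Δ : ℝ) : ℂ) ^ (s + 1)) / (Δ * (s * (s + 1)))

lemma trap_nonneg (hΔ : 0 < Δ) (hh : 0 ≤ h) (u : ℝ) : 0 ≤ trap x h Δ u := by
  unfold trap
  refine div_nonneg ?_ hΔ.le
  rcases max_cases (x + h + Δ - u) 0 with h1 | h1 <;> rcases max_cases (x + h - u) 0 with h2 | h2 <;>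
  rcases max_cases (x - u) 0 with h3 | h3 <;> rcases max_cases (x - Δ - u) 0 with h4 | h4 <;>
  linarith

lemma trap_le_one (hΔ : 0 < Δ) (hh : 0 ≤ h) (u : ℝ) : trap x h Δ u ≤ 1 := by
  unfold trap
  rw [div_le_one hΔ]
  rcases max_cases (x + h + Δ - u) 0 with h1 | h1 <;> rcases max_cases (x + h - u) 0 with h2 | h2 <;>
  rcases max_cases (x - u) 0 with h3 | h3 <;> rcases max_cases (x - Δ - u) 0 with h4 | h4 <;>
  linarith

lemma trap_eq_one (hΔ : 0 < Δ) {u : ℝ} (h1 : x ≤ u) (h2 : u ≤ x + h) : trap x h Δ u = 1 := by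
  unfold trap
  rw [max_eq_left (by linarith), max_eq_left (by linarith), max_eq_right (by linarith),
    max_eq_right (by linarith), div_eq_one_iff_eq hΔ.ne']
  ring

lemma trap_eq_zero_of_le (hΔ : 0 < Δ) (hh : 0 ≤ h) {u : ℝ} (hu : u ≤ x - Δ) : trap x h Δ u = 0 := by
  unfold trap
  rw [max_eq_left (by linarith), max_eq_left (by linarith), max_eq_left (by linarith),
    max_eq_left (by linarith)]
  ring

lemma trap_eq_zero_of_ge (hΔ : 0 < Δ) (hh : 0 ≤ h) {u : ℝ} (hu : x + h + Δ ≤ u) :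
    trap x h Δ u = 0 := by
  unfold trap
  rw [max_eq_right (by linarith), max_eq_right (by linarith), max_eq_right (by linarith),
    max_eq_right (by linarith)]
  simp

lemma integral_perron_cpow {c X N : ℝ} (hc : 0 < c) (hX : 0 < X) (hN : 0 < N) :
    Integrable (fun t : ℝ => (X : ℂ) ^ ((c : ℂ) + t * I + 1) * (N : ℂ) ^ (-((c : ℂ) + t * I)) /
      (((c : ℂ) + t * I) * ((c : ℂ) + t * I + 1))) ∧
    ∫ t : ℝ, (X : ℂ) ^ ((c : ℂ) + t * I + 1) * (N : ℂ) ^ (-((c : ℂ) + t * I)) /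
      (((c : ℂ) + t * I) * ((c : ℂ) + t * I + 1)) = 2 * Real.pi * (max (X - N) 0 : ℝ) := by
  have hX0 : (X : ℂ) ≠ 0 := by exact_mod_cast hX.ne'
  have hN0 : (N : ℂ) ≠ 0 := by exact_mod_cast hN.ne'
  have hr : 0 < X / N := by positivity
  have e : ∀ t : ℝ, (X : ℂ) ^ ((c : ℂ) + t * I + 1) * (N : ℂ) ^ (-((c : ℂ) + t * I)) /
      (((c : ℂ) + t * I) * ((c : ℂ) + t * I + 1)) =
      X * (((X / N : ℝ) : ℂ) ^ ((c : ℂ) + t * I) / (((c : ℂ) + t * I) * ((c : ℂ) + t * I + 1))) := by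
    intro t
    rw [Complex.cpow_add _ _ hX0, Complex.cpow_one, Complex.cpow_neg, Complex.ofReal_div,
      Complex.div_cpow_ofReal_nonneg hX.le hN.le]
    ring
  simp only [e]
  constructor
  · refine Integrable.const_mul ?_ _
    have h1 := (integrable_one_div_mul_add_one hc).norm.const_mul ((X / N) ^ c)
    have hne : ∀ t : ℝ, ((c : ℂ) + t * I) * ((c : ℂ) + t * I + 1) ≠ 0 := fun t h => by
      have := congrArg Complex.re h
      have := congrArg Complex.im h
      simp at *
      nlinarith [sq_nonneg t]
    refine h1.mono' (Continuous.aestronglyMeasurable (Continuous.div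
      (Continuous.const_cpow (by fun_prop) (Or.inl (by exact_mod_cast hr.ne'))) (by fun_prop) hne))
      (Filter.Eventually.of_forall fun t => ?_)
    rw [norm_div, norm_div, norm_one, Complex.norm_cpow_eq_rpow_re_of_pos hr, mul_one_div]
    simp
  · rw [integral_const_mul, integral_perron hc hr]
    have : max (X - N) 0 = X * max (1 - 1 / (X / N)) 0 := by
      rw [mul_max_of_nonneg _ _ hX.le, mul_zero]
      congr 1
      field_simp
    rw [this]
    push_cast
    ring

lemma integral_trapHat {c N : ℝ} (hc : 0 < c) (hN : 0 < N) (hΔ : 0 < Δ) (hh : 0 ≤ h) (hx : Δ < x) :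
    Integrable (fun t : ℝ => trapHat x h Δ ((c : ℂ) + t * I) * (N : ℂ) ^ (-((c : ℂ) + t * I))) ∧
    ∫ t : ℝ, trapHat x h Δ ((c : ℂ) + t * I) * (N : ℂ) ^ (-((c : ℂ) + t * I)) =
      2 * Real.pi * (trap x h Δ N : ℝ) := by
  obtain ⟨i1, j1⟩ := integral_perron_cpow (X := x + h + Δ) hc (by linarith) hN
  obtain ⟨i2, j2⟩ := integral_perron_cpow (X := x + h) hc (by linarith) hN
  obtain ⟨i3, j3⟩ := integral_perron_cpow (X := x) hc (by linarith) hN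
  obtain ⟨i4, j4⟩ := integral_perron_cpow (X := x - Δ) hc (by linarith) hN
  have hΔ0 : (Δ : ℂ) ≠ 0 := by exact_mod_cast hΔ.ne'
  have e : ∀ t : ℝ, trapHat x h Δ ((c : ℂ) + t * I) * (N : ℂ) ^ (-((c : ℂ) + t * I)) =
      (Δ : ℂ)⁻¹ *
      (((x + h + Δ : ℝ) : ℂ) ^ ((c : ℂ) + t * I + 1) * (N : ℂ) ^ (-((c : ℂ) + t * I)) /
        (((c : ℂ) + t * I) * ((c : ℂ) + t * I + 1)) -
      ((x + h : ℝ) : ℂ) ^ ((c : ℂ) + t * I + 1) * (N : ℂ) ^ (-((c : ℂ) + t * I)) /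
        (((c : ℂ) + t * I) * ((c : ℂ) + t * I + 1)) -
      ((x : ℝ) : ℂ) ^ ((c : ℂ) + t * I + 1) * (N : ℂ) ^ (-((c : ℂ) + t * I)) /
        (((c : ℂ) + t * I) * ((c : ℂ) + t * I + 1)) +
      ((x - Δ : ℝ) : ℂ) ^ ((c : ℂ) + t * I + 1) * (N : ℂ) ^ (-((c : ℂ) + t * I)) /
        (((c : ℂ) + t * I) * ((c : ℂ) + t * I + 1))) := by
    intro t
    unfold trapHat
    rw [← div_div]
    simp only [div_eq_mul_inv]
    ring
  simp only [e]
  refine ⟨(((i1.sub i2).sub i3).add i4).const_mul _, ?_⟩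
  have k1 := integral_sub i1 i2
  have k2 := integral_sub (i1.sub i2) i3
  have k3 := integral_add ((i1.sub i2).sub i3) i4
  simp only [Pi.sub_apply] at k1 k2 k3
  rw [integral_const_mul, k3, k2, k1, j1, j2, j3, j4, trap]
  push_cast
  field_simp

lemma rpow_le_three_mul {u p : ℝ} (hx : 0 < x) (h1 : x / 2 ≤ u) (h2 : u ≤ 3 * x)
    (hp1 : -1 ≤ p) (hp2 : p ≤ 1) : u ^ p ≤ 3 * x ^ p := by
  have hu : 0 < u := by linarith
  have hux : 0 < u / x := by positivity
  have e : u ^ p = (u / x) ^ p * x ^ p := by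
    rw [← Real.mul_rpow hux.le hx.le]
    congr 1
    field_simp
  rw [e]
  gcongr
  rcases le_total 1 (u / x) with h | h
  · calc (u / x) ^ p ≤ (u / x) ^ (1 : ℝ) := Real.rpow_le_rpow_of_exponent_le h hp2
      _ ≤ 3 := by rw [Real.rpow_one, div_le_iff₀ hx]; exact h2
  · calc (u / x) ^ p ≤ (u / x) ^ (-1 : ℝ) := Real.rpow_le_rpow_of_exponent_ge hux h hp1
      _ ≤ 3 := by
          rw [Real.rpow_neg_one, inv_div, div_le_iff₀ hu]
          linarith

lemma norm_cpow_sub_cpow_le {a b K : ℝ} {s : ℂ} (ha : 0 < a) (hab : a ≤ b) (hs : s ≠ 0)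
    (hK : ∀ u ∈ Set.Icc a b, u ^ (s.re - 1) ≤ K) :
    ‖(b : ℂ) ^ s - (a : ℂ) ^ s‖ ≤ ‖s‖ * K * (b - a) := by
  refine norm_image_sub_le_of_norm_deriv_le_segment' (f := fun u : ℝ => (u : ℂ) ^ s)
    (f' := fun u : ℝ => s * (u : ℂ) ^ (s - 1)) (fun u hu => ?_) (fun u hu => ?_) b ⟨hab, le_rfl⟩
  · exact (hasDerivAt_ofReal_cpow_const (by linarith [hu.1]) hs).hasDerivWithinAt
  · rw [norm_mul, Complex.norm_cpow_eq_rpow_re_of_pos (by linarith [hu.1])]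
    gcongr
    simpa using hK u ⟨hu.1, hu.2.le⟩

lemma norm_trapHat_le {c : ℝ} (hc1 : 1 / 2 ≤ c) (hc2 : c ≤ 2) (hΔ : 0 < Δ) (hΔh : Δ ≤ h)
    (hhx : h ≤ x) (hΔx : Δ ≤ x / 2) (t : ℝ) :
    ‖trapHat x h Δ ((c : ℂ) + t * I)‖ ≤ 6 * x ^ (c - 1) * h := by
  have hx : 0 < x := by linarith
  set s : ℂ := (c : ℂ) + t * I with hs
  have hsre : s.re = c := by simp [hs]
  have hs0 : s ≠ 0 := fun h => by rw [h] at hsre; simp at hsre; linarith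
  have hs1 : s + 1 ≠ 0 := fun h => by
    have := congrArg Complex.re h
    simp [hsre] at this; linarith
  have hg : ‖((((x + h + Δ : ℝ) : ℂ) ^ (s + 1) - ((x - Δ + Δ : ℝ) : ℂ) ^ (s + 1)) -
      (((x + h + 0 : ℝ) : ℂ) ^ (s + 1) - ((x - Δ + 0 : ℝ) : ℂ) ^ (s + 1)))‖ ≤
      (‖s + 1‖ * (‖s‖ * (3 * x ^ (c - 1)) * (2 * h))) * (Δ - 0) := by
    refine norm_image_sub_le_of_norm_deriv_le_segment'
      (f := fun v : ℝ => ((x + h + v : ℝ) : ℂ) ^ (s + 1) - ((x - Δ + v : ℝ) : ℂ) ^ (s + 1))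
      (f' := fun v : ℝ => (s + 1) * ((x + h + v : ℝ) : ℂ) ^ (s + 1 - 1) -
        (s + 1) * ((x - Δ + v : ℝ) : ℂ) ^ (s + 1 - 1)) (fun v hv => ?_) (fun v hv => ?_) Δ ⟨hΔ.le, le_rfl⟩
    · have d1 := (hasDerivAt_ofReal_cpow_const (x := x + h + v) (by linarith [hv.1]) hs1).scomp v
        ((hasDerivAt_id v).const_add (x + h))
      have d2 := (hasDerivAt_ofReal_cpow_const (x := x - Δ + v) (by linarith [hv.1]) hs1).scomp v
        ((hasDerivAt_id v).const_add (x - Δ))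
      rw [one_smul] at d1 d2
      exact (d1.sub d2).hasDerivWithinAt
    · rw [← mul_sub, norm_mul, add_sub_cancel_right]
      gcongr
      refine (norm_cpow_sub_cpow_le (K := 3 * x ^ (c - 1)) (by linarith [hv.1]) (by linarith) hs0
        fun u hu => ?_).trans ?_
      · rw [hsre]
        exact rpow_le_three_mul hx (by linarith [hu.1, hv.1]) (by linarith [hu.2, hv.2])
          (by linarith) (by linarith)
      · gcongr
        linarith
  rw [trapHat, norm_div, norm_mul, norm_mul, Complex.norm_real, Real.norm_of_nonneg hΔ.le]
  have hp0 : 0 < ‖s‖ := norm_pos_iff.2 hs0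
  have hp1 : 0 < ‖s + 1‖ := norm_pos_iff.2 hs1
  rw [div_le_iff₀ (by positivity)]
  refine le_trans (le_of_eq ?_) (hg.trans (le_of_eq (by ring)))
  congr 1
  simp only [sub_add_cancel, add_zero]
  ring

lemma norm_trapHat_le' {c : ℝ} (hc1 : 1 / 2 ≤ c) (hc2 : c ≤ 2) (hΔ : 0 < Δ) (hΔh : Δ ≤ h)
    (hhx : h ≤ x) (hΔx : Δ ≤ x / 2) {t : ℝ} (ht : t ≠ 0) :
    ‖trapHat x h Δ ((c : ℂ) + t * I)‖ ≤ 108 * x ^ (c + 1) / (Δ * t ^ 2) := by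
  have hx : 0 < x := by linarith
  set s : ℂ := (c : ℂ) + t * I with hs
  have hX : ∀ X : ℝ, 0 < X → X ≤ 3 * x → ‖(X : ℂ) ^ (s + 1)‖ ≤ 27 * x ^ (c + 1) := by
    intro X hX1 hX2
    rw [Complex.norm_cpow_eq_rpow_re_of_pos hX1]
    have : (s + 1).re = c + 1 := by simp [hs]
    rw [this]
    calc X ^ (c + 1) ≤ (3 * x) ^ (c + 1) := by gcongr
      _ = 3 ^ (c + 1) * x ^ (c + 1) := by rw [Real.mul_rpow (by norm_num) hx.le]
      _ ≤ 3 ^ (3 : ℝ) * x ^ (c + 1) := by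
          gcongr
          · norm_num
          · linarith
      _ = _ := by norm_num
  have h1 : |t| ≤ ‖s‖ := by simpa [hs] using Complex.abs_im_le_norm s
  have h2 : |t| ≤ ‖s + 1‖ := by simpa [hs] using Complex.abs_im_le_norm (s + 1)
  have ht0 : 0 < |t| := abs_pos.2 ht
  rw [trapHat, norm_div, norm_mul, norm_mul, Complex.norm_real, Real.norm_of_nonneg hΔ.le]
  have hden : Δ * t ^ 2 ≤ Δ * (‖s‖ * ‖s + 1‖) := by
    rw [← sq_abs, sq]
    gcongr
  refine div_le_div₀ (by positivity) ?_ (by positivity) hden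
  calc _ ≤ ‖((x + h + Δ : ℝ) : ℂ) ^ (s + 1)‖ + ‖((x + h : ℝ) : ℂ) ^ (s + 1)‖ +
        ‖((x : ℝ) : ℂ) ^ (s + 1)‖ + ‖((x - Δ : ℝ) : ℂ) ^ (s + 1)‖ := by
        refine (norm_add_le _ _).trans ?_
        gcongr
        refine (norm_sub_le _ _).trans ?_
        gcongr
        exact norm_sub_le _ _
    _ ≤ 27 * x ^ (c + 1) + 27 * x ^ (c + 1) + 27 * x ^ (c + 1) + 27 * x ^ (c + 1) := by
        gcongr
        · exact hX _ (by linarith) (by linarith)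
        · exact hX _ (by linarith) (by linarith)
        · exact hX _ (by linarith) (by linarith)
        · exact hX _ (by linarith) (by linarith)
    _ = _ := by ring

end Trapezoid

section Identities

variable {κ : ℝ} {f Λf : ℕ → ℂ} {y : ℕ}

/-- The part of `Λf` supported on powers of primes exceeding `y`. -/
def bigPart (y : ℕ) (Λf : ℕ → ℂ) (k : ℕ) : ℂ := if y < k.minFac then Λf k else 0

/-- The part of `Λf` supported on powers of primes at most `y`. -/
def smallPart (y : ℕ) (Λf : ℕ → ℂ) (k : ℕ) : ℂ := if k.minFac ≤ y then Λf k else 0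

lemma _root_.IsHalaszClass.norm_bigPart_le (hf : IsHalaszClass κ f Λf) (hκ : 0 < κ) (k : ℕ) :
    ‖bigPart y Λf k‖ ≤ κ * Λ k := by
  have h0 : 0 ≤ κ * Λ k := mul_nonneg hκ.le ArithmeticFunction.vonMangoldt_nonneg
  unfold bigPart
  split_ifs
  · rcases Nat.eq_zero_or_pos k with rfl | h
    · rw [hf.supp 0 not_isPrimePow_zero]; simp
    · exact hf.bound k h
  · simpa using h0

lemma _root_.IsHalaszClass.norm_smallPart_le (hf : IsHalaszClass κ f Λf) (hκ : 0 < κ) (k : ℕ) :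
    ‖smallPart y Λf k‖ ≤ κ * Λ k := by
  have h0 : 0 ≤ κ * Λ k := mul_nonneg hκ.le ArithmeticFunction.vonMangoldt_nonneg
  unfold smallPart
  split_ifs
  · rcases Nat.eq_zero_or_pos k with rfl | h
    · rw [hf.supp 0 not_isPrimePow_zero]; simp
    · exact hf.bound k h
  · simpa using h0

lemma _root_.IsHalaszClass.isPrimePow_of_bigPart_ne_zero (hf : IsHalaszClass κ f Λf) {k : ℕ}
    (hk : bigPart y Λf k ≠ 0) : IsPrimePow k ∧ y < k.minFac := by
  unfold bigPart at hk
  split_ifs at hk with h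
  · refine ⟨?_, h⟩
    by_contra h'
    exact hk (hf.supp k h')
  · exact absurd rfl hk

lemma _root_.IsHalaszClass.isPrimePow_of_smallPart_ne_zero (hf : IsHalaszClass κ f Λf) {k : ℕ}
    (hk : smallPart y Λf k ≠ 0) : IsPrimePow k ∧ k.minFac ≤ y := by
  unfold smallPart at hk
  split_ifs at hk with h
  · refine ⟨?_, h⟩
    by_contra h'
    exact hk (hf.supp k h')
  · exact absurd rfl hk

lemma _root_.IsHalaszClass.mul_log_of_coprime (hf : IsHalaszClass κ f Λf) {a b : ℕ}
    (hab : a.Coprime b) (hb : b ≠ 0) :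
    f (a * b) * (Real.log b : ℂ) = ∑ d ∈ b.divisors, Λf d * f (a * b / d) := by
  rw [hf.mult a b hab, mul_assoc, hf.conv b (by omega), mul_sum]
  refine sum_congr rfl fun d hd => ?_
  have hdb := (Nat.mem_divisors.1 hd).1
  rw [Nat.mul_div_assoc a hdb, hf.mult a (b / d) (hab.coprime_dvd_right (Nat.div_dvd_of_dvd hdb))]
  ring

lemma bigPart_eq_of_dvd (hf : IsHalaszClass κ f Λf) {n d : ℕ} (hn : n ≠ 0) (hd : d ∣ ro y n) :
    bigPart y Λf d = Λf d := by
  unfold bigPart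
  split_ifs with h
  · rfl
  · by_contra h'
    have hp : IsPrimePow d := by
      by_contra h2
      exact h' (hf.supp d h2).symm
    have := lt_of_prime_dvd_ro hn (Nat.minFac_prime hp.ne_one) (d.minFac_dvd.trans hd)
    exact h this

lemma smallPart_eq_of_dvd (hf : IsHalaszClass κ f Λf) {n d : ℕ} (hd : d ∣ sm y n) :
    smallPart y Λf d = Λf d := by
  unfold smallPart
  split_ifs with h
  · rfl
  · by_contra h'
    have hp : IsPrimePow d := by
      by_contra h2
      exact h' (hf.supp d h2).symm
    have := (Nat.mem_smoothNumbers'.1 (sm_mem_smoothNumbers y n)) _ (Nat.minFac_prime hp.ne_one)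
      (d.minFac_dvd.trans hd)
    omega

lemma dvd_of_isPrimePow_dvd_mul {a b d : ℕ} (hab : a.Coprime b) (hd : IsPrimePow d)
    (hdab : d ∣ a * b) (hdb : ¬ d ∣ b) : d.minFac ∣ a := by
  rcases (hab.isPrimePow_dvd_mul hd).1 hdab with h | h
  · exact d.minFac_dvd.trans h
  · exact absurd h hdb

lemma _root_.IsHalaszClass.mul_log_ro (hf : IsHalaszClass κ f Λf) {n : ℕ} (hn : n ≠ 0) :
    f n * (Real.log (ro y n) : ℂ) = ∑ d ∈ n.divisors, bigPart y Λf d * f (n / d) := by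
  have hn' := sm_mul_ro (y := y) hn
  have h := hf.mul_log_of_coprime (coprime_sm_ro (y := y) hn) (ro_pos hn).ne'
  rw [hn'] at h
  rw [h]
  refine (sum_subset_zero_on_sdiff (Nat.divisors_subset_of_dvd hn (Dvd.intro_left _ hn'))
    (fun d hd => ?_) fun d hd => ?_)
  · rw [mem_sdiff, Nat.mem_divisors, Nat.mem_divisors] at hd
    have : bigPart y Λf d = 0 := by
      by_contra h0
      obtain ⟨h1, h2⟩ := hf.isPrimePow_of_bigPart_ne_zero h0
      have h3 := dvd_of_isPrimePow_dvd_mul (coprime_sm_ro (y := y) hn) h1 (hn'.symm ▸ hd.1.1)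
        fun h => hd.2 ⟨h, (ro_pos hn).ne'⟩
      have := (Nat.mem_smoothNumbers'.1 (sm_mem_smoothNumbers y n)) _
        (Nat.minFac_prime h1.ne_one) h3
      omega
    rw [this, zero_mul]
  · rw [bigPart_eq_of_dvd hf hn (Nat.mem_divisors.1 hd).1]

lemma _root_.IsHalaszClass.mul_log_sm (hf : IsHalaszClass κ f Λf) {n : ℕ} (hn : n ≠ 0) :
    f n * (Real.log (sm y n) : ℂ) = ∑ d ∈ n.divisors, smallPart y Λf d * f (n / d) := by
  have hn' : ro y n * sm y n = n := by rw [mul_comm]; exact sm_mul_ro hn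
  have h := hf.mul_log_of_coprime (coprime_sm_ro (y := y) hn).symm (sm_pos y n).ne'
  rw [hn'] at h
  rw [h]
  refine (sum_subset_zero_on_sdiff (Nat.divisors_subset_of_dvd hn (Dvd.intro_left _ hn'))
    (fun d hd => ?_) fun d hd => ?_)
  · rw [mem_sdiff, Nat.mem_divisors, Nat.mem_divisors] at hd
    have : smallPart y Λf d = 0 := by
      by_contra h0
      obtain ⟨h1, h2⟩ := hf.isPrimePow_of_smallPart_ne_zero h0
      have h3 := dvd_of_isPrimePow_dvd_mul (coprime_sm_ro (y := y) hn).symm h1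
        (hn'.symm ▸ hd.1.1) fun h => hd.2 ⟨h, (sm_pos y n).ne'⟩
      have := lt_of_prime_dvd_ro hn (Nat.minFac_prime h1.ne_one) h3
      omega
    rw [this, zero_mul]
  · rw [smallPart_eq_of_dvd hf (Nat.mem_divisors.1 hd).1]

lemma ro_eq_self_of_isPrimePow {k : ℕ} (hk : IsPrimePow k) (h : y < k.minFac) : ro y k = k := by
  have h1 : sm y k = 1 := by
    rw [isPrimePow_eq_minFac_pow hk]
    exact sm_prime_pow_of_lt (Nat.minFac_prime hk.ne_one) h _
  have := sm_mul_ro (y := y) hk.ne_zero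
  rwa [h1, one_mul] at this

lemma sm_eq_self_of_isPrimePow {k : ℕ} (hk : IsPrimePow k) (h : k.minFac ≤ y) : sm y k = k := by
  rw [isPrimePow_eq_minFac_pow hk]
  exact sm_prime_pow_of_le (Nat.minFac_prime hk.ne_one) h _

lemma sum_divisors_Ioc_eq {N : ℕ} {g : ℕ → ℕ → ℂ} {v : ℕ → ℝ} (hv : ∀ n, N < n → v n = 0) :
    ∑ n ∈ Ioc 0 N, (v n : ℂ) * ∑ d ∈ n.divisors, g d (n / d) =
      ∑ k ∈ Ioc 0 N, ∑ m ∈ Ioc 0 N, (v (k * m) : ℂ) * g k m := by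
  have e : ∀ n ∈ Ioc 0 N, (v n : ℂ) * ∑ d ∈ n.divisors, g d (n / d) =
      ∑ p ∈ n.divisorsAntidiagonal, (v (p.1 * p.2) : ℂ) * g p.1 p.2 := by
    intro n hn
    rw [← Nat.sum_divisorsAntidiagonal (fun a b => g a b), mul_sum]
    refine sum_congr rfl fun p hp => ?_
    rw [(Nat.mem_divisorsAntidiagonal.1 hp).1]
  rw [sum_congr rfl e, ← sum_product', sum_sigma']
  refine sum_bij_ne_zero (fun p _ _ => p.2) (fun p hp _ => ?_) (fun p hp _ q hq _ h => ?_)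
    (fun p hp h0 => ?_) fun p hp _ => rfl
  · rw [mem_sigma, Nat.mem_divisorsAntidiagonal, mem_Ioc] at hp
    obtain ⟨⟨h1, h2⟩, h3, h4⟩ := hp
    have hne : p.2.1 * p.2.2 ≠ 0 := by rw [h3]; exact h4
    have ha := Nat.pos_of_ne_zero (left_ne_zero_of_mul hne)
    have hb := Nat.pos_of_ne_zero (right_ne_zero_of_mul hne)
    rw [mem_product, mem_Ioc, mem_Ioc]
    exact ⟨⟨ha, by nlinarith⟩, hb, by nlinarith⟩
  · rw [mem_sigma, Nat.mem_divisorsAntidiagonal] at hp hq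
    obtain ⟨n, p⟩ := p
    obtain ⟨m, q⟩ := q
    simp only at hp hq h
    subst h
    obtain rfl : n = m := hp.2.1.symm.trans hq.2.1
    rfl
  · rw [mem_product, mem_Ioc, mem_Ioc] at hp
    have hN : p.1 * p.2 ≤ N := by
      by_contra h
      rw [hv _ (by omega)] at h0
      simp at h0
    have hpos := Nat.mul_pos hp.1.1 hp.2.1
    exact ⟨⟨p.1 * p.2, p⟩, by
      simp only [mem_sigma, mem_Ioc, Nat.mem_divisorsAntidiagonal]
      exact ⟨⟨hpos, hN⟩, trivial, by omega⟩, h0, rfl⟩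

lemma _root_.IsHalaszClass.sum_mul_log_ro (hf : IsHalaszClass κ f Λf) {N : ℕ} {v : ℕ → ℝ}
    (hv : ∀ n, N < n → v n = 0) (γ : ℝ) :
    ∑ n ∈ Ioc 0 N, (v n : ℂ) * f n * ((ro y n : ℝ) ^ (-γ) : ℝ) * (Real.log (ro y n) : ℂ) =
      ∑ k ∈ Ioc 0 N, ∑ m ∈ Ioc 0 N, (v (k * m) : ℂ) *
        (bigPart y Λf k * ((k : ℝ) ^ (-γ) : ℝ) * (f m * ((ro y m : ℝ) ^ (-γ) : ℝ))) := by
  rw [← sum_divisors_Ioc_eq (g := fun k m => bigPart y Λf k * ((k : ℝ) ^ (-γ) : ℝ) *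
    (f m * ((ro y m : ℝ) ^ (-γ) : ℝ))) hv]
  refine sum_congr rfl fun n hn => ?_
  have hn0 : n ≠ 0 := by have := mem_Ioc.1 hn; omega
  have e : (v n : ℂ) * f n * ((ro y n : ℝ) ^ (-γ) : ℝ) * (Real.log (ro y n) : ℂ) =
      (v n : ℂ) * (((ro y n : ℝ) ^ (-γ) : ℝ) * (f n * (Real.log (ro y n) : ℂ))) := by ring
  rw [e, hf.mul_log_ro hn0, mul_sum (s := n.divisors)]
  congr 1
  refine sum_congr rfl fun d hd => ?_
  by_cases h0 : bigPart y Λf d = 0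
  · simp [h0]
  obtain ⟨h1, h2⟩ := hf.isPrimePow_of_bigPart_ne_zero h0
  obtain ⟨m, rfl⟩ := (Nat.mem_divisors.1 hd).1
  have hm : m ≠ 0 := right_ne_zero_of_mul hn0
  rw [Nat.mul_div_cancel_left m (Nat.pos_of_ne_zero h1.ne_zero), ro_mul h1.ne_zero hm,
    ro_eq_self_of_isPrimePow h1 h2]
  push_cast
  rw [Real.mul_rpow (by positivity) (by positivity)]
  push_cast
  ring

lemma sum_rpow_neg_eq {ι : Type*} (S : Finset ι) (c : ι → ℂ) {b : ι → ℝ} (hb : ∀ i ∈ S, 0 < b i)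
    (α η : ℝ) :
    ∑ i ∈ S, c i * (b i ^ (-α) : ℝ) = ∑ i ∈ S, c i * (b i ^ (-(α + η)) : ℝ) +
      ∫ β in (0 : ℝ)..η, ∑ i ∈ S, c i * (b i ^ (-(α + β)) : ℝ) * (Real.log (b i) : ℂ) := by
  have hd : ∀ β : ℝ, HasDerivAt (fun β : ℝ => -∑ i ∈ S, c i * (b i ^ (-(α + β)) : ℝ))
      (∑ i ∈ S, c i * (b i ^ (-(α + β)) : ℝ) * (Real.log (b i) : ℂ)) β := by
    intro β
    rw [← neg_neg (∑ i ∈ S, c i * (b i ^ (-(α + β)) : ℝ) * (Real.log (b i) : ℂ)), ← sum_neg_distrib]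
    refine (HasDerivAt.fun_sum fun i hi => ?_).neg
    have h1 : HasDerivAt (fun β : ℝ => -(α + β)) (-1) β := ((hasDerivAt_id β).const_add α).neg
    have h2 := (h1.const_rpow (hb i hi)).ofReal_comp.const_mul (c i)
    refine h2.congr_deriv ?_
    push_cast
    ring
  rw [intervalIntegral.integral_eq_sub_of_hasDerivAt (fun β _ => hd β)]
  · simp
  · refine Continuous.intervalIntegrable (continuous_finsetSum _ fun i hi => ?_) _ _
    have := (hb i hi).ne'
    have h3 : Continuous fun β : ℝ => b i ^ (-(α + β)) :=
      Continuous.rpow continuous_const (by fun_prop) fun _ => Or.inl this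
    fun_prop

end Identities

section Hyperbola

variable {κ : ℝ} {f Λf : ℕ → ℂ} {y : ℕ}

lemma gw_nonneg (f : ℕ → ℂ) (y n : ℕ) : 0 ≤ gw f y n :=
  mul_nonneg (norm_nonneg _) (wt_nonneg _ _ _ _)

lemma div_lt_and_le_of_mul_mem {a L k m : ℕ} (hk : 0 < k) (h : a < k * m ∧ k * m ≤ a + L) :
    a / k < m ∧ m ≤ a / k + (L / k + 1) := by
  refine ⟨Nat.div_lt_of_lt_mul h.1, ?_⟩
  have h1 := Nat.lt_div_mul_add (a := a) hk
  have h2 := Nat.lt_div_mul_add (a := L) hk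
  by_contra h3
  have h4 : (a / k + (L / k + 1) + 1) * k ≤ m * k := Nat.mul_le_mul_right k (by omega)
  have h5 := h.2
  rw [mul_comm k m] at h5
  have e : (a / k + (L / k + 1) + 1) * k = (a / k * k + k) + (L / k * k + k) := by ring
  omega

lemma rpow_two_fifths_le {A l k : ℝ} (hA : 1 ≤ A) (hk : 0 < k) (hk2 : k ^ 2 ≤ A)
    (hl : A ^ (3 / 4 : ℝ) ≤ l) : (A / k) ^ (2 / 5 : ℝ) ≤ l / k := by
  have hA0 : 0 < A := by linarith
  rw [le_div_iff₀ hk]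
  refine le_trans ?_ hl
  have h1 : k ≤ A ^ (1 / 2 : ℝ) := by
    rw [← Real.sqrt_eq_rpow]
    exact Real.le_sqrt_of_sq_le hk2
  have e : (A / k) ^ (2 / 5 : ℝ) * k = A ^ (2 / 5 : ℝ) * k ^ (3 / 5 : ℝ) := by
    rw [Real.div_rpow hA0.le hk.le]
    have h2 : k = k ^ (2 / 5 : ℝ) * k ^ (3 / 5 : ℝ) := by
      rw [← Real.rpow_add hk]; norm_num
    have h3 := (Real.rpow_pos_of_pos hk (2 / 5)).ne'
    rw [div_mul_eq_mul_div, div_eq_iff h3]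
    calc A ^ (2 / 5 : ℝ) * k = A ^ (2 / 5 : ℝ) * (k ^ (2 / 5 : ℝ) * k ^ (3 / 5 : ℝ)) := by rw [← h2]
      _ = _ := by ring
  rw [e]
  calc A ^ (2 / 5 : ℝ) * k ^ (3 / 5 : ℝ)
      ≤ A ^ (2 / 5 : ℝ) * (A ^ (1 / 2 : ℝ)) ^ (3 / 5 : ℝ) := by gcongr
    _ = A ^ (7 / 10 : ℝ) := by
        rw [← Real.rpow_mul hA0.le, ← Real.rpow_add hA0]; norm_num
    _ ≤ A ^ (3 / 4 : ℝ) := Real.rpow_le_rpow_of_exponent_le hA (by norm_num)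

lemma div_le_rpow_five_halves {A l m : ℝ} (hA : 2176782336 ≤ A) (hm : 0 < m)
    (hm2 : m ≤ 6 * A ^ (1 / 2 : ℝ)) (hl : A ^ (3 / 4 : ℝ) ≤ l) :
    A / m ≤ (l / m) ^ (5 / 2 : ℝ) := by
  have hA0 : 0 < A := by linarith
  set z := A ^ (3 / 4 : ℝ) / m with hz
  have hz0 : 0 < z := by positivity
  have h3 : (6 : ℝ) ≤ A ^ (1 / 12 : ℝ) := by
    calc (6 : ℝ) = (2176782336 : ℝ) ^ (1 / 12 : ℝ) := by
          rw [show (2176782336 : ℝ) = 6 ^ (12 : ℝ) by norm_num, ← Real.rpow_mul (by norm_num)]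
          norm_num
      _ ≤ _ := by gcongr
  have h1 : A ^ (1 / 6 : ℝ) ≤ z := by
    rw [hz, le_div_iff₀ hm]
    calc A ^ (1 / 6 : ℝ) * m ≤ A ^ (1 / 6 : ℝ) * (A ^ (1 / 12 : ℝ) * A ^ (1 / 2 : ℝ)) := by
          gcongr
          exact hm2.trans (by gcongr)
      _ = A ^ (3 / 4 : ℝ) := by
          rw [← Real.rpow_add hA0, ← Real.rpow_add hA0]; norm_num
  calc A / m = A ^ (1 / 4 : ℝ) * z := by
        rw [hz, ← mul_div_assoc, ← Real.rpow_add hA0]; norm_num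
    _ = (A ^ (1 / 6 : ℝ)) ^ (3 / 2 : ℝ) * z := by
        rw [← Real.rpow_mul hA0.le]; norm_num
    _ ≤ z ^ (3 / 2 : ℝ) * z := by gcongr
    _ = z ^ (5 / 2 : ℝ) := by
        conv_lhs => rw [← Real.rpow_one z, ← Real.rpow_mul hz0.le, ← Real.rpow_add hz0]
        norm_num
    _ ≤ _ := by
        rw [hz]
        gcongr

lemma cast_div_le_add_one (a : ℕ) {k : ℕ} (hk : 0 < k) : (a : ℝ) / k ≤ ((a / k + 1 : ℕ) : ℝ) := by
  rw [div_le_iff₀ (by exact_mod_cast hk)]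
  have h := (Nat.lt_div_mul_add (a := a) hk).le
  have e : a / k * k + k = (a / k + 1) * k := by ring
  rw [e] at h
  exact_mod_cast h

lemma exists_sum_vonMangoldt_mul_gw_le (hκ : 0 < κ) : ∃ C : ℝ, 1 ≤ C ∧ ∃ X : ℕ, 1 ≤ X ∧
    ∀ f Λf : ℕ → ℂ, IsHalaszClass κ f Λf → ∀ y : ℕ, 200 ≤ Real.log y → ∀ a L N : ℕ, X ≤ a →
    (a : ℝ) ^ (3 / 4 : ℝ) ≤ L → L ≤ 4 * a →
    ∑ k ∈ Ioc 0 N, ∑ m ∈ Ioc 0 N,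
      (if a < k * m ∧ k * m ≤ a + L then Λ k * gw f y m else 0) ≤ C * L * Real.log y ^ κ := by
  obtain ⟨C₁, hC₁, X, hX, h₁⟩ := exists_sum_gw_Ioc_le hκ
  obtain ⟨C₂, hC₂, h₂⟩ := exists_sum_gw_div_le hκ
  refine ⟨56 * C₁ + 21000 * C₂, by linarith, (X + 50000) ^ 2, Nat.one_le_pow _ _ (by omega),
    fun f Λf hf y hy a L N ha haL hLa => ?_⟩
  set s := Nat.sqrt a with hs
  have hsX : X + 50000 ≤ s := by rw [hs, Nat.le_sqrt']; exact ha
  have hs2 : s ^ 2 ≤ a := Nat.sqrt_le' a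
  have has : a < (s + 1) ^ 2 := Nat.lt_succ_sqrt' a
  have hs2r : (s : ℝ) ^ 2 ≤ a := by exact_mod_cast hs2
  have hs5 : (50000 : ℝ) ≤ s := by exact_mod_cast (by omega : 50000 ≤ s)
  have ha6 : (2500000000 : ℝ) ≤ a := by nlinarith
  have ha0 : (0 : ℝ) < a := by linarith
  have hL0 : (0 : ℝ) < L := lt_of_lt_of_le (by positivity) haL
  have hsq : (s : ℝ) ≤ (a : ℝ) ^ (1 / 2 : ℝ) := by
    rw [← Real.sqrt_eq_rpow]
    exact Real.le_sqrt_of_sq_le hs2r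
  have hsL : (s : ℝ) ≤ L := hsq.trans ((Real.rpow_le_rpow_of_exponent_le (by linarith)
    (by norm_num)).trans haL)
  have hsLn : s ≤ L := by exact_mod_cast hsL
  have hlogs : Real.log a ≤ 4 * Real.log s := by
    have : (a : ℝ) ≤ (s : ℝ) ^ 4 := by
      have h1 : (a : ℝ) ≤ ((s : ℝ) + 1) ^ 2 := by exact_mod_cast has.le
      nlinarith [sq_nonneg ((s : ℝ) ^ 2 - s)]
    calc Real.log a ≤ Real.log ((s : ℝ) ^ 4) := Real.log_le_log ha0 this
      _ = _ := by rw [Real.log_pow]; norm_num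
  have hloga : 1 ≤ Real.log a := by
    rw [Real.le_log_iff_exp_le ha0]
    linarith [Real.exp_one_lt_d9]
  have hlogy : 0 ≤ Real.log y ^ κ := by positivity
  have hsplit : ∀ k ∈ Ioc 0 N, ∀ m ∈ Ioc 0 N,
      (if a < k * m ∧ k * m ≤ a + L then Λ k * gw f y m else 0) ≤
      (if k ≤ s ∧ (a < k * m ∧ k * m ≤ a + L) then Λ k * gw f y m else 0) +
      (if m ≤ 5 * s + 4 ∧ (a < k * m ∧ k * m ≤ a + L) then Λ k * gw f y m else 0) := by
    intro k hk m hm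
    have h0 : 0 ≤ Λ k * gw f y m :=
      mul_nonneg ArithmeticFunction.vonMangoldt_nonneg (gw_nonneg _ _ _)
    by_cases hj : a < k * m ∧ k * m ≤ a + L
    · by_cases hks : k ≤ s
      · rw [if_pos hj, if_pos ⟨hks, hj⟩]
        split_ifs <;> linarith
      · have : m ≤ 5 * s + 4 := by
          by_contra h
          have : (s + 1) * (5 * s + 5) ≤ k * m := Nat.mul_le_mul (by omega) (by omega)
          nlinarith [hj.2]
        rw [if_pos hj, if_pos (⟨this, hj⟩ : m ≤ 5 * s + 4 ∧ _), if_neg (fun h => hks h.1)]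
        linarith
    · rw [if_neg hj, if_neg (fun h => hj h.2), if_neg (fun h => hj h.2), add_zero]
  refine (sum_le_sum fun k hk => sum_le_sum (hsplit k hk)).trans ?_
  simp only [sum_add_distrib]
  have hA : ∑ k ∈ Ioc 0 N, ∑ m ∈ Ioc 0 N,
      (if k ≤ s ∧ (a < k * m ∧ k * m ≤ a + L) then Λ k * gw f y m else 0) ≤
      56 * C₁ * L * Real.log y ^ κ := by
    have hk1 : ∀ k ∈ Ioc 0 N, ∑ m ∈ Ioc 0 N,
        (if k ≤ s ∧ (a < k * m ∧ k * m ≤ a + L) then Λ k * gw f y m else 0) ≤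
        if k ≤ s then (8 * C₁ * L / Real.log a * Real.log y ^ κ) * (Λ k / k) else 0 := by
      intro k hk
      have hk0 : 0 < k := (mem_Ioc.1 hk).1
      have hkr : (0 : ℝ) < k := by exact_mod_cast hk0
      by_cases hks : k ≤ s
      swap
      · rw [if_neg hks]
        exact (sum_eq_zero fun m _ => if_neg fun h => hks h.1).le
      rw [if_pos hks]
      have hksr : (k : ℝ) ≤ s := by exact_mod_cast hks
      have hq : s ≤ a / k := by
        rw [Nat.le_div_iff_mul_le hk0]
        nlinarith
      have hb := h₁ f Λf hf y hy (a / k) (L / k + 1) (by omega) (by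
        have h1 : ((a / k : ℕ) : ℝ) ≤ (a : ℝ) / k := Nat.cast_div_le
        have h2 : (L : ℝ) / k ≤ ((L / k + 1 : ℕ) : ℝ) := cast_div_le_add_one L hk0
        refine (Real.rpow_le_rpow (by positivity) h1 (by norm_num)).trans
          ((rpow_two_fifths_le (by linarith) hkr ?_ haL).trans h2)
        nlinarith) (by
        have h1 := Nat.div_le_div_right (c := k) hLa
        have h2 : 4 * a / k < 4 * (a / k) + 4 := by
          rw [Nat.div_lt_iff_lt_mul hk0]
          have := Nat.lt_div_mul_add (a := a) hk0
          nlinarith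
        omega)
      have hlog : Real.log a / 4 ≤ Real.log ((a / k : ℕ) : ℝ) := by
        have : Real.log s ≤ Real.log ((a / k : ℕ) : ℝ) :=
          Real.log_le_log (by linarith) (by exact_mod_cast hq)
        linarith
      have hLk : ((L / k + 1 : ℕ) : ℝ) ≤ 2 * (L / k) := by
        push_cast
        have h1 : ((L / k : ℕ) : ℝ) ≤ (L : ℝ) / k := Nat.cast_div_le
        have h2 : 1 ≤ (L : ℝ) / k := by rw [le_div_iff₀ hkr]; linarith
        linarith
      calc ∑ m ∈ Ioc 0 N, (if k ≤ s ∧ (a < k * m ∧ k * m ≤ a + L) then Λ k * gw f y m else 0)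
          = ∑ m ∈ Ioc 0 N with (k ≤ s ∧ (a < k * m ∧ k * m ≤ a + L)), Λ k * gw f y m := by
            rw [sum_filter]
        _ ≤ ∑ m ∈ Ioc (a / k) (a / k + (L / k + 1)), Λ k * gw f y m := by
            refine sum_le_sum_of_subset_of_nonneg (fun m hm => ?_) fun m _ _ =>
              mul_nonneg ArithmeticFunction.vonMangoldt_nonneg (gw_nonneg _ _ _)
            rw [mem_Ioc]
            exact div_lt_and_le_of_mul_mem hk0 (mem_filter.1 hm).2.2
        _ = Λ k * ∑ m ∈ Ioc (a / k) (a / k + (L / k + 1)), gw f y m := by rw [mul_sum]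
        _ ≤ Λ k * (C₁ * ((2 * (L / k)) / (Real.log a / 4)) * Real.log y ^ κ) := by
            refine mul_le_mul_of_nonneg_left (hb.trans ?_) ArithmeticFunction.vonMangoldt_nonneg
            gcongr
        _ = _ := by
            field_simp
            ring
    refine (sum_le_sum hk1).trans ?_
    rw [← sum_filter, ← mul_sum]
    have hs1 : ∑ k ∈ Ioc 0 N with k ≤ s, Λ k / k ≤ 7 * Real.log a := by
      calc ∑ k ∈ Ioc 0 N with k ≤ s, Λ k / k ≤ ∑ k ∈ Ioc 0 s, Λ k / k := by
            refine sum_le_sum_of_subset_of_nonneg (fun m hm => ?_) fun m _ _ =>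
              div_nonneg ArithmeticFunction.vonMangoldt_nonneg (Nat.cast_nonneg _)
            rw [mem_filter, mem_Ioc] at hm
            exact mem_Ioc.2 ⟨hm.1.1, hm.2⟩
        _ ≤ Real.log s + 6 := sum_vonMangoldt_div_le (by omega)
        _ ≤ Real.log a + 6 := by
            have := Real.log_le_log (by linarith : (0 : ℝ) < s) (by nlinarith : (s : ℝ) ≤ a)
            linarith
        _ ≤ _ := by linarith
    calc 8 * C₁ * L / Real.log a * Real.log y ^ κ * ∑ k ∈ Ioc 0 N with k ≤ s, Λ k / k
        ≤ 8 * C₁ * L / Real.log a * Real.log y ^ κ * (7 * Real.log a) := by gcongr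
      _ = _ := by
          field_simp
          ring
  have hB : ∑ k ∈ Ioc 0 N, ∑ m ∈ Ioc 0 N,
      (if m ≤ 5 * s + 4 ∧ (a < k * m ∧ k * m ≤ a + L) then Λ k * gw f y m else 0) ≤
      21000 * C₂ * L * Real.log y ^ κ := by
    rw [sum_comm]
    have hm1 : ∀ m ∈ Ioc 0 N, ∑ k ∈ Ioc 0 N,
        (if m ≤ 5 * s + 4 ∧ (a < k * m ∧ k * m ≤ a + L) then Λ k * gw f y m else 0) ≤
        (21000 * L) * (gw f y m / m) := by
      intro m hm
      have hm0 : 0 < m := (mem_Ioc.1 hm).1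
      have hmr : (0 : ℝ) < m := by exact_mod_cast hm0
      have hgm := gw_nonneg f y m
      by_cases hms : m ≤ 5 * s + 4
      swap
      · refine (sum_eq_zero fun k _ => if_neg fun h => hms h.1).le.trans (by positivity)
      have hmsr : (m : ℝ) ≤ 6 * s := by exact_mod_cast (by linarith : m ≤ 6 * s)
      have hb := sum_vonMangoldt_Ioc_le (a / m) (L / m + 1) (Nat.le_add_left 1 _) (by
        have h1 : ((a / m : ℕ) : ℝ) ≤ (a : ℝ) / m := Nat.cast_div_le
        have h2 : (L : ℝ) / m ≤ ((L / m + 1 : ℕ) : ℝ) := cast_div_le_add_one L hm0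
        refine h1.trans ((div_le_rpow_five_halves (by linarith) hmr (by linarith) haL).trans ?_)
        gcongr)
      have hLm : ((L / m + 1 : ℕ) : ℝ) ≤ 7 * (L / m) := by
        push_cast
        have h1 : ((L / m : ℕ) : ℝ) ≤ (L : ℝ) / m := Nat.cast_div_le
        have h2 : 1 / 6 ≤ (L : ℝ) / m := by rw [le_div_iff₀ hmr]; linarith
        linarith
      calc ∑ k ∈ Ioc 0 N,
            (if m ≤ 5 * s + 4 ∧ (a < k * m ∧ k * m ≤ a + L) then Λ k * gw f y m else 0)
          = ∑ k ∈ Ioc 0 N with (m ≤ 5 * s + 4 ∧ (a < k * m ∧ k * m ≤ a + L)),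
              Λ k * gw f y m := by rw [sum_filter]
        _ ≤ ∑ k ∈ Ioc (a / m) (a / m + (L / m + 1)), Λ k * gw f y m := by
            refine sum_le_sum_of_subset_of_nonneg (fun k hk => ?_) fun k _ _ =>
              mul_nonneg ArithmeticFunction.vonMangoldt_nonneg hgm
            rw [mem_Ioc]
            have := (mem_filter.1 hk).2.2
            rw [mul_comm k m] at this
            exact div_lt_and_le_of_mul_mem hm0 this
        _ = (∑ k ∈ Ioc (a / m) (a / m + (L / m + 1)), Λ k) * gw f y m := by rw [sum_mul]
        _ ≤ (3000 * (7 * (L / m))) * gw f y m := by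
            refine mul_le_mul_of_nonneg_right (hb.trans ?_) hgm
            gcongr
        _ = _ := by ring
    refine (sum_le_sum hm1).trans ?_
    rw [← mul_sum]
    calc 21000 * (L : ℝ) * ∑ m ∈ Ioc 0 N, gw f y m / m
        ≤ 21000 * (L : ℝ) * (C₂ * Real.log y ^ κ) := by
          gcongr
          exact h₂ f Λf hf y hy _ fun n hn => by have := mem_Ioc.1 hn; omega
      _ = _ := by ring
  calc _ ≤ 56 * C₁ * L * Real.log y ^ κ + 21000 * C₂ * L * Real.log y ^ κ := add_le_add hA hB
    _ = _ := by ring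

end Hyperbola

section Decomposition

variable {κ : ℝ} {f Λf : ℕ → ℂ} {y : ℕ}

lemma intervalIntegrable_rpow_neg {x : ℝ} (hx : 0 < x) (η : ℝ) :
    IntervalIntegrable (fun α : ℝ => x ^ (-α)) volume 0 η :=
  (Continuous.rpow continuous_const continuous_neg fun _ => Or.inl hx.ne').intervalIntegrable _ _

lemma integral_rpow_neg_le {x : ℝ} (hx : 1 < x) (η : ℝ) :
    ∫ α in (0 : ℝ)..η, x ^ (-α) ≤ 1 / Real.log x := by
  have hl : 0 < Real.log x := Real.log_pos hx
  have hx0 : 0 < x := by linarith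
  have hd : ∀ α : ℝ, HasDerivAt (fun α : ℝ => -(x ^ (-α) / Real.log x)) (x ^ (-α)) α := by
    intro α
    refine (((hasDerivAt_neg α).const_rpow hx0).div_const (Real.log x)).neg.congr_deriv ?_
    field_simp
  rw [intervalIntegral.integral_eq_sub_of_hasDerivAt (fun β _ => hd β)
    (intervalIntegrable_rpow_neg hx0 η)]
  have : 0 ≤ x ^ (-η) / Real.log x := by positivity
  simp only [neg_zero, Real.rpow_zero]
  linarith

lemma norm_mul_ro_rpow_le (f : ℕ → ℂ) {n : ℕ} (hn : n ≠ 0) {α : ℝ} (hα1 : α ≤ 1 / Real.log y) :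
    ‖f n‖ * (ro y n : ℝ) ^ (-(α + 1 / Real.log y)) ≤ (n : ℝ) ^ (-α) * gw f y n := by
  have h1 : (0 : ℝ) < ro y n := by exact_mod_cast ro_pos hn
  have h2 : (1 : ℝ) ≤ sm y n := by exact_mod_cast sm_pos y n
  have h3 : (n : ℝ) = sm y n * ro y n := by exact_mod_cast (sm_mul_ro hn).symm
  have e : (n : ℝ) ^ (-α) * gw f y n = ‖f n‖ * (ro y n : ℝ) ^ (-(α + 1 / Real.log y)) *
      (sm y n : ℝ) ^ (1 / Real.log y - α) := by
    rw [gw, wt, h3, Real.mul_rpow (by positivity) h1.le, neg_add, Real.rpow_add h1, sub_eq_add_neg,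
      Real.rpow_add (by linarith)]
    ring
  rw [e]
  exact le_mul_of_one_le_right (by positivity) (Real.one_le_rpow h2 (by linarith))

/-- The triple sum that carries the main term. -/
def tripleSum (f Λf : ℕ → ℂ) (y N : ℕ) (v : ℕ → ℝ) (α β : ℝ) : ℂ :=
  ∑ k ∈ Ioc 0 N, ∑ m ∈ Ioc 0 N, ∑ n ∈ Ioc 0 N, (v (k * (m * n)) : ℂ) *
    (bigPart y Λf k * ((k : ℝ) ^ (-α) : ℝ) * (bigPart y Λf m * ((m : ℝ) ^ (-(α + β)) : ℝ)) *
      (f n * ((ro y n : ℝ) ^ (-(α + β)) : ℝ)))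

lemma _root_.IsHalaszClass.sum_mul_log_ro_eq (hf : IsHalaszClass κ f Λf) {N : ℕ} {v : ℕ → ℝ}
    (hv : ∀ n, N < n → v n = 0) (α η : ℝ) :
    ∑ n ∈ Ioc 0 N, (v n : ℂ) * f n * ((ro y n : ℝ) ^ (-α) : ℝ) * (Real.log (ro y n) : ℂ) =
      ∑ k ∈ Ioc 0 N, ∑ m ∈ Ioc 0 N, (v (k * m) : ℂ) *
        (bigPart y Λf k * ((k : ℝ) ^ (-α) : ℝ) * f m) * ((ro y m : ℝ) ^ (-(α + η)) : ℝ) +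
      ∫ β in (0 : ℝ)..η, tripleSum f Λf y N v α β := by
  rw [hf.sum_mul_log_ro hv]
  have h := sum_rpow_neg_eq (Ioc 0 N ×ˢ Ioc 0 N) (fun p : ℕ × ℕ => (v (p.1 * p.2) : ℂ) *
    (bigPart y Λf p.1 * ((p.1 : ℝ) ^ (-α) : ℝ) * f p.2)) (b := fun p => (ro y p.2 : ℝ))
    (fun p hp => by
      have := (mem_Ioc.1 (mem_product.1 hp).2).1
      exact_mod_cast ro_pos (by omega)) α η
  simp only [sum_product] at h
  convert h using 1
  · refine sum_congr rfl fun k _ => sum_congr rfl fun m _ => ?_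
    ring
  · congr 1
    refine intervalIntegral.integral_congr fun β _ => ?_
    simp only [tripleSum]
    refine sum_congr rfl fun k hk => ?_
    have hk1 := (mem_Ioc.1 hk).1
    have h2 := hf.sum_mul_log_ro (y := y) (N := N) (v := fun m => v (k * m))
      (fun n hn => hv _ (by nlinarith)) (α + β)
    have h3 : ∀ m ∈ Ioc 0 N, (v (k * m) : ℂ) * (bigPart y Λf k * ((k : ℝ) ^ (-α) : ℝ) * f m) *
        ((ro y m : ℝ) ^ (-(α + β)) : ℝ) * (Real.log (ro y m) : ℂ) =
        bigPart y Λf k * ((k : ℝ) ^ (-α) : ℝ) * ((v (k * m) : ℂ) * f m *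
          ((ro y m : ℝ) ^ (-(α + β)) : ℝ) * (Real.log (ro y m) : ℂ)) := fun m _ => by ring
    rw [sum_congr rfl h3, ← mul_sum, h2, mul_sum]
    refine sum_congr rfl fun m _ => ?_
    rw [mul_sum]
    exact sum_congr rfl fun n _ => by ring

lemma exists_norm_sum_le_of_tripleSum_le (hκ : 0 < κ) : ∃ C : ℝ, 1 ≤ C ∧ ∃ X : ℕ, 1 ≤ X ∧
    ∀ f Λf : ℕ → ℂ, IsHalaszClass κ f Λf → ∀ y : ℕ, 200 ≤ Real.log y → ∀ a L N : ℕ, X ≤ a →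
    (a : ℝ) ^ (3 / 4 : ℝ) ≤ L → L ≤ 4 * a → a + L ≤ N → ∀ v : ℕ → ℝ, (∀ n, 0 ≤ v n) → (∀ n, v n ≤ 1) →
    (∀ n, v n ≠ 0 → a < n ∧ n ≤ a + L) → ∀ x : ℝ, 1 < x → x ≤ 2 * a → ∀ G : ℝ → ℝ,
    IntervalIntegrable G volume 0 (1 / Real.log y) →
    (∀ α ∈ Set.Ioc 0 (1 / Real.log y), ∀ β ∈ Set.Ioc 0 (1 / Real.log y),
      ‖tripleSum f Λf y N v α β‖ ≤ x ^ (-α) * G β) →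
    ‖∑ n ∈ Ioc 0 N, (v n : ℂ) * f n‖ ≤ C * (L / Real.log a) * Real.log y ^ κ +
      (C * L * Real.log y ^ κ + ∫ β in (0 : ℝ)..(1 / Real.log y), G β) * (1 / Real.log x) := by
  obtain ⟨C₁, hC₁, X₁, hX₁, h₁⟩ := exists_sum_gw_Ioc_le hκ
  obtain ⟨C₂, hC₂, X₂, hX₂, h₂⟩ := exists_sum_vonMangoldt_mul_gw_le hκ
  refine ⟨C₁ + 2 * κ * C₂, by nlinarith, X₁ + X₂, by omega, fun f Λf hf y hy a L N ha haL hLa hLN v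
    hv0 hv1 hv x hx hxa G hG hM => ?_⟩
  set η : ℝ := 1 / Real.log y with hη
  have hy0 : 0 < Real.log y := by linarith
  have hη0 : 0 ≤ η := by positivity
  have hη1 : η ≤ 1 := by rw [hη, div_le_iff₀ hy0]; linarith
  have ha1 : (1 : ℝ) ≤ a := by exact_mod_cast (by omega : 1 ≤ a)
  have hL0 : (0 : ℝ) ≤ L := Nat.cast_nonneg _
  have hlogy : 0 ≤ Real.log y ^ κ := by positivity
  have hvN : ∀ n, N < n → v n = 0 := fun n hn => by
    by_contra h
    have := (hv n h).2
    omega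
  have hI := sum_rpow_neg_eq (Ioc 0 N) (fun n => (v n : ℂ) * f n) (b := fun n => (ro y n : ℝ))
    (fun n hn => by
      have := (mem_Ioc.1 hn).1
      exact_mod_cast ro_pos (by omega)) 0 η
  simp only [neg_zero, Real.rpow_zero, Complex.ofReal_one, mul_one, zero_add] at hI
  rw [hI]
  have hE1 : ‖∑ n ∈ Ioc 0 N, (v n : ℂ) * f n * ((ro y n : ℝ) ^ (-η) : ℝ)‖ ≤
      C₁ * (L / Real.log a) * Real.log y ^ κ := by
    refine (norm_sum_le _ _).trans (le_trans ?_ (h₁ f Λf hf y hy a L (by omega) ?_ ?_))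
    · calc ∑ n ∈ Ioc 0 N, ‖(v n : ℂ) * f n * ((ro y n : ℝ) ^ (-η) : ℝ)‖
          ≤ ∑ n ∈ Ioc 0 N, if n ∈ Ioc a (a + L) then gw f y n else 0 := by
            refine sum_le_sum fun n hn => ?_
            have hn0 : n ≠ 0 := by have := (mem_Ioc.1 hn).1; omega
            rw [norm_mul, norm_mul, Complex.norm_real, Complex.norm_real,
              Real.norm_of_nonneg (hv0 n), Real.norm_of_nonneg (by positivity)]
            by_cases h0 : v n = 0
            · rw [h0, zero_mul, zero_mul]
              split_ifs
              · exact gw_nonneg _ _ _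
              · exact le_rfl
            · rw [if_pos (mem_Ioc.2 (hv n h0))]
              have h1 := norm_mul_ro_rpow_le f hn0 hη0
              rw [zero_add, neg_zero, Real.rpow_zero, one_mul, ← hη] at h1
              rw [mul_assoc]
              exact (mul_le_of_le_one_left (by positivity) (hv1 n)).trans h1
        _ = ∑ n ∈ Ioc 0 N with n ∈ Ioc a (a + L), gw f y n := by rw [sum_filter]
        _ ≤ _ := by
            refine sum_le_sum_of_subset_of_nonneg (fun n hn => (mem_filter.1 hn).2)
              fun n _ _ => gw_nonneg _ _ _
    · exact (Real.rpow_le_rpow_of_exponent_le ha1 (by norm_num)).trans haL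
    · omega
  have hE2 : ∀ α ∈ Set.Ioc 0 η, ‖∑ k ∈ Ioc 0 N, ∑ m ∈ Ioc 0 N, (v (k * m) : ℂ) *
        (bigPart y Λf k * ((k : ℝ) ^ (-α) : ℝ) * f m) * ((ro y m : ℝ) ^ (-(α + η)) : ℝ)‖ ≤
      x ^ (-α) * (2 * κ * C₂ * L * Real.log y ^ κ) := by
    intro α hα
    calc _ ≤ ∑ k ∈ Ioc 0 N, ∑ m ∈ Ioc 0 N, ‖(v (k * m) : ℂ) *
        (bigPart y Λf k * ((k : ℝ) ^ (-α) : ℝ) * f m) * ((ro y m : ℝ) ^ (-(α + η)) : ℝ)‖ :=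
          (norm_sum_le _ _).trans (sum_le_sum fun k _ => norm_sum_le _ _)
      _ ≤ ∑ k ∈ Ioc 0 N, ∑ m ∈ Ioc 0 N, (2 * κ * x ^ (-α)) *
          (if a < k * m ∧ k * m ≤ a + L then Λ k * gw f y m else 0) := by
          refine sum_le_sum fun k hk => sum_le_sum fun m hm => ?_
          have hk0 : k ≠ 0 := by have := (mem_Ioc.1 hk).1; omega
          have hm0 : m ≠ 0 := by have := (mem_Ioc.1 hm).1; omega
          by_cases h0 : v (k * m) = 0
          · rw [h0]
            simp only [Complex.ofReal_zero, zero_mul, norm_zero]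
            have : 0 ≤ Λ k * gw f y m :=
              mul_nonneg ArithmeticFunction.vonMangoldt_nonneg (gw_nonneg _ _ _)
            split_ifs
            · positivity
            · simp
          rw [if_pos (hv _ h0)]
          simp only [norm_mul, Complex.norm_real, Real.norm_of_nonneg (hv0 (k * m)),
            Real.norm_of_nonneg (show (0 : ℝ) ≤ (k : ℝ) ^ (-α) by positivity),
            Real.norm_of_nonneg (show (0 : ℝ) ≤ (ro y m : ℝ) ^ (-(α + η)) by positivity)]
          have h1 := norm_mul_ro_rpow_le f hm0 hα.2
          have h2 := hf.norm_bigPart_le hκ k (y := y)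
          have hkm : ((k : ℝ) * m) ^ (-α) ≤ 2 * x ^ (-α) := by
            have h3 : x / 2 ≤ (k : ℝ) * m := by
              have : (a : ℝ) ≤ (k : ℝ) * m := by exact_mod_cast (hv _ h0).1.le
              linarith
            calc ((k : ℝ) * m) ^ (-α) ≤ (x / 2) ^ (-α) :=
                  Real.rpow_le_rpow_of_nonpos (by linarith) h3 (by linarith [hα.1])
              _ = 2 ^ α * x ^ (-α) := by
                  rw [Real.div_rpow (by linarith) (by norm_num), Real.rpow_neg (by norm_num : (0:ℝ) ≤ 2)]
                  field_simp
              _ ≤ 2 ^ (1 : ℝ) * x ^ (-α) := by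
                  gcongr
                  · norm_num
                  · linarith [hα.2]
              _ = _ := by rw [Real.rpow_one]
          have hg := gw_nonneg f y m
          have hΛ : 0 ≤ Λ k := ArithmeticFunction.vonMangoldt_nonneg
          calc v (k * m) * (‖bigPart y Λf k‖ * (k : ℝ) ^ (-α) * ‖f m‖) * (ro y m : ℝ) ^ (-(α + η))
              = v (k * m) * (‖bigPart y Λf k‖ * (k : ℝ) ^ (-α) *
                (‖f m‖ * (ro y m : ℝ) ^ (-(α + η)))) := by ring
            _ ≤ 1 * ((κ * Λ k) * (k : ℝ) ^ (-α) * ((m : ℝ) ^ (-α) * gw f y m)) := by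
                gcongr
                exact hv1 _
            _ = κ * (((k : ℝ) * m) ^ (-α)) * (Λ k * gw f y m) := by
                rw [Real.mul_rpow (by positivity) (by positivity)]
                ring
            _ ≤ κ * (2 * x ^ (-α)) * (Λ k * gw f y m) := by gcongr
            _ = _ := by ring
      _ ≤ (2 * κ * x ^ (-α)) * (C₂ * L * Real.log y ^ κ) := by
          simp only [← mul_sum]
          gcongr
          exact h₂ f Λf hf y hy a L N (by omega) haL hLa
      _ = _ := by ring
  have hE3 : ‖∫ α in (0 : ℝ)..η, ∑ n ∈ Ioc 0 N, (v n : ℂ) * f n * ((ro y n : ℝ) ^ (-α) : ℝ) *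
      (Real.log (ro y n) : ℂ)‖ ≤
      (2 * κ * C₂ * L * Real.log y ^ κ + ∫ β in (0 : ℝ)..η, G β) * (1 / Real.log x) := by
    set K := 2 * κ * C₂ * L * Real.log y ^ κ + ∫ β in (0 : ℝ)..η, G β with hK
    have hb : ∀ α ∈ Set.Ioc 0 η, ‖∑ n ∈ Ioc 0 N, (v n : ℂ) * f n * ((ro y n : ℝ) ^ (-α) : ℝ) *
        (Real.log (ro y n) : ℂ)‖ ≤ K * x ^ (-α) := by
      intro α hα
      rw [hf.sum_mul_log_ro_eq hvN α η]
      refine (norm_add_le _ _).trans ?_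
      have h3 : ‖∫ β in (0 : ℝ)..η, tripleSum f Λf y N v α β‖ ≤
          ∫ β in (0 : ℝ)..η, x ^ (-α) * G β :=
        intervalIntegral.norm_integral_le_of_norm_le hη0
          (Filter.Eventually.of_forall fun β hβ => hM α hα β hβ) (hG.const_mul _)
      rw [intervalIntegral.integral_const_mul] at h3
      have := hE2 α hα
      rw [hK]
      linarith
    have hG0 : 0 ≤ ∫ β in (0 : ℝ)..η, G β := by
      have hη' : 0 < η := by positivity
      refine intervalIntegral.integral_nonneg_of_ae_restrict hη0 ?_
      rw [Filter.EventuallyLE, ← restrict_Ioc_eq_restrict_Icc, ae_restrict_iff' measurableSet_Ioc]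
      refine Filter.Eventually.of_forall fun β hβ => ?_
      have h4 := (norm_nonneg _).trans (hM η ⟨hη', le_rfl⟩ β hβ)
      exact nonneg_of_mul_nonneg_right h4 (by positivity)
    have hK0 : 0 ≤ K := by positivity
    have h5 := intervalIntegral.norm_integral_le_of_norm_le hη0
      (Filter.Eventually.of_forall fun α hα => hb α hα)
      ((intervalIntegrable_rpow_neg (by linarith : 0 < x) η).const_mul K)
    rw [intervalIntegral.integral_const_mul] at h5
    exact h5.trans (mul_le_mul_of_nonneg_left (integral_rpow_neg_le hx η) hK0)
  refine (norm_add_le _ _).trans ((add_le_add hE1 hE3).trans ?_)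
  have hla : 0 ≤ Real.log a := Real.log_nonneg ha1
  have hlx : 0 ≤ 1 / Real.log x := one_div_nonneg.2 (Real.log_nonneg hx.le)
  have h6 : C₁ * (L / Real.log a) * Real.log y ^ κ ≤
      (C₁ + 2 * κ * C₂) * (L / Real.log a) * Real.log y ^ κ := by
    gcongr
    nlinarith
  have h7 : 2 * κ * C₂ * L * Real.log y ^ κ ≤ (C₁ + 2 * κ * C₂) * L * Real.log y ^ κ := by
    gcongr
    linarith
  gcongr

end Decomposition

section Gronwall

variable {κ : ℝ} {f Λf : ℕ → ℂ} {y : ℕ}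

lemma _root_.IsHalaszClass.summable_norm_mul_sm (hf : IsHalaszClass κ f Λf) (hκ : 0 < κ) (y : ℕ)
    {σ : ℝ} (hσ : 0 < σ) :
    Summable fun n : ℕ => ‖f n‖ * (sm y n : ℝ) ^ (1 / 10 : ℝ) * (n : ℝ) ^ (-1 - σ) := by
  obtain ⟨C₀, hC₀, h₀⟩ := exists_norm_le_rpow hκ (ε := 1 / 100) (by norm_num)
  have hs : Summable fun n : ℕ => (n : ℝ) ^ (-1 - σ) := Real.summable_nat_rpow.2 (by linarith)
  have hm := (hf.isNonnegMult.mul_wt y (1 / 10) 0).mul_rpow (-1 - σ)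
  have e : ∀ n : ℕ, ‖f n‖ * wt y (1 / 10) 0 n * (n : ℝ) ^ (-1 - σ) =
      ‖f n‖ * (sm y n : ℝ) ^ (1 / 10 : ℝ) * (n : ℝ) ^ (-1 - σ) := fun n => by
    rw [wt, Real.rpow_zero, mul_one]
  simp only [← e]
  have hpow : ∀ p e : ℕ, p.Prime → 2 ≤ e →
      ‖f (p ^ e)‖ * wt y (1 / 10) 0 (p ^ e) * ((p ^ e : ℕ) : ℝ) ^ (-1 - σ) ≤
        C₀ * ((p ^ e : ℕ) : ℝ) ^ (-(5 / 8) : ℝ) := by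
    intro p e hp _
    have hn := pow_ne_zero e hp.ne_zero
    have h1 : (1 : ℝ) ≤ ((p ^ e : ℕ) : ℝ) := by exact_mod_cast Nat.one_le_iff_ne_zero.2 hn
    have h2 := h₀ f Λf hf _ hn
    have h3 := wt_le (y := y) (c := 1 / 10) (d := 0) (by norm_num) le_rfl hn
    have h4 := wt_nonneg y (1 / 10) 0 (p ^ e)
    set z : ℝ := ((p ^ e : ℕ) : ℝ)
    have hz : 0 < z := by linarith
    calc _ ≤ C₀ * z ^ (1 / 100 : ℝ) * z ^ (1 / 10 : ℝ) * z ^ (-1 - σ) := by gcongr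
      _ = C₀ * z ^ (1 / 100 + 1 / 10 + (-1 - σ)) := by
          rw [Real.rpow_add hz, Real.rpow_add hz]; ring
      _ ≤ _ := by
          gcongr
          linarith
  have hprime : ∀ N : ℕ, ∑ p ∈ N.primesBelow, ‖f p‖ * wt y (1 / 10) 0 p * (p : ℝ) ^ (-1 - σ) ≤
      κ * (y + 1) + κ * ∑' n : ℕ, (n : ℝ) ^ (-1 - σ) := by
    intro N
    have hp1 : ∀ p ∈ N.primesBelow, ‖f p‖ * wt y (1 / 10) 0 p * (p : ℝ) ^ (-1 - σ) ≤
        (if p < y + 1 then κ else 0) + κ * (p : ℝ) ^ (-1 - σ) := by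
      intro p hp
      have hp' := Nat.prime_of_mem_primesBelow hp
      have h1 : (1 : ℝ) ≤ p := by exact_mod_cast hp'.one_lt.le
      have h2 := hf.norm_prime_le hp'
      have h5 : 0 ≤ κ * (p : ℝ) ^ (-1 - σ) := by positivity
      have h4 := wt_nonneg y (1 / 10) 0 p
      split_ifs with h
      · have h3 := wt_le (y := y) (c := 1 / 10) (d := 0) (by norm_num) le_rfl hp'.ne_zero
        calc _ ≤ κ * (p : ℝ) ^ (1 / 10 : ℝ) * (p : ℝ) ^ (-1 - σ) := by gcongr
          _ = κ * (p : ℝ) ^ (1 / 10 + (-1 - σ)) := by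
              rw [mul_assoc, ← Real.rpow_add (by linarith)]
          _ ≤ κ * 1 := by
              gcongr
              exact Real.rpow_le_one_of_one_le_of_nonpos h1 (by linarith)
          _ ≤ _ := by linarith
      · have := wt_prime_pow_of_lt (y := y) (c := 1 / 10) (d := 0) hp' (by omega) 1
        rw [pow_one, Real.rpow_zero] at this
        rw [this, mul_one, zero_add]
        gcongr
    refine (sum_le_sum hp1).trans ?_
    rw [sum_add_distrib, ← mul_sum]
    gcongr
    · rw [← sum_filter, sum_const, nsmul_eq_mul, mul_comm]
      gcongr
      have : (N.primesBelow.filter (fun p => p < y + 1)).card ≤ (range (y + 1)).card :=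
        card_le_card fun p hp => mem_range.2 (mem_filter.1 hp).2
      rw [card_range] at this
      exact_mod_cast this
    · exact hs.sum_le_tsum _ fun _ _ => by positivity
  refine summable_of_sum_le (c := Real.exp (κ * (y + 1) + κ * (∑' n : ℕ, (n : ℝ) ^ (-1 - σ)) +
    powConst C₀)) (fun n => hm.nonneg n) fun S => ?_
  have h0 : ∑ n ∈ S, ‖f n‖ * wt y (1 / 10) 0 n * (n : ℝ) ^ (-1 - σ) =
      ∑ n ∈ S.erase 0, ‖f n‖ * wt y (1 / 10) 0 n * (n : ℝ) ^ (-1 - σ) := by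
    symm
    refine sum_erase _ ?_
    rw [Nat.cast_zero, Real.zero_rpow (by linarith), mul_zero]
  rw [h0]
  refine (hm.sum_smooth_le (C := C₀) (by linarith) hpow ((S.erase 0).sup id + 1) (S.erase 0)
    fun n hn => mem_smoothNumbers_of_le (mem_erase.1 hn).1 (le_sup (f := id) hn)).trans ?_
  gcongr
  exact hprime _

lemma sum_higher_prime_power_le {S : Finset ℕ} (hS : ∀ k ∈ S, IsPrimePow k ∧ ¬ k.Prime) :
    ∑ k ∈ S, (k : ℝ) ^ (-(5 / 8) : ℝ) ≤ powConst 1 := by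
  set φ : ℕ → ℕ × ℕ := fun k => (k.minFac, k.factorization k.minFac - 2) with hφ
  have hfac : ∀ k ∈ S, k = k.minFac ^ (k.factorization k.minFac - 2 + 2) := by
    intro k hk
    have h1 := isPrimePow_eq_minFac_pow (hS k hk).1
    have h2 : 2 ≤ k.factorization k.minFac := by
      by_contra h
      have h3 : k.factorization k.minFac = 0 ∨ k.factorization k.minFac = 1 := by omega
      rcases h3 with h3 | h3
      · rw [h3, pow_zero] at h1
        exact (hS k hk).1.ne_one h1
      · rw [h3, pow_one] at h1
        exact (hS k hk).2 (h1 ▸ Nat.minFac_prime (hS k hk).1.ne_one)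
    rw [Nat.sub_add_cancel h2]
    exact h1
  have hinj : Set.InjOn φ S := by
    intro k hk l hl h
    rw [hφ, Prod.mk.injEq] at h
    calc k = k.minFac ^ (k.factorization k.minFac - 2 + 2) := hfac k hk
      _ = l.minFac ^ (l.factorization l.minFac - 2 + 2) := by rw [h.2, h.1]
      _ = l := (hfac l hl).symm
  have e : ∑ k ∈ S, (k : ℝ) ^ (-(5 / 8) : ℝ) =
      ∑ q ∈ S.image φ, ((q.1 ^ (q.2 + 2) : ℕ) : ℝ) ^ (-(5 / 8) : ℝ) := by
    rw [sum_image hinj]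
    refine sum_congr rfl fun k hk => ?_
    rw [← hfac k hk]
  rw [e]
  set P := S.image Nat.minFac
  set M := S.sup (fun k => (φ k).2) + 1
  have hsub : S.image φ ⊆ P ×ˢ range M := by
    intro q hq
    obtain ⟨k, hk, rfl⟩ := mem_image.1 hq
    exact mem_product.2 ⟨mem_image_of_mem _ hk, mem_range.2
      (Nat.lt_succ_of_le (le_sup (f := fun k => (φ k).2) hk))⟩
  refine (sum_le_sum_of_subset_of_nonneg hsub fun _ _ _ => by positivity).trans ?_
  rw [sum_product]
  have hp : ∀ p ∈ P, ∑ e ∈ range M, ((p ^ (e + 2) : ℕ) : ℝ) ^ (-(5 / 8) : ℝ) ≤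
      3 * (p : ℝ) ^ (-(5 / 4) : ℝ) := by
    intro p hp
    obtain ⟨k, hk, rfl⟩ := mem_image.1 hp
    have hp' := Nat.minFac_prime (hS k hk).1.ne_one
    set p := k.minFac
    have hlt : (p : ℝ) ^ (-(5 / 8) : ℝ) < 1 := (prime_rpow_neg_le hp').trans_lt (by norm_num)
    have e2 : ∀ e : ℕ, ((p ^ (e + 2) : ℕ) : ℝ) ^ (-(5 / 8) : ℝ) =
        (p : ℝ) ^ (-(5 / 4) : ℝ) * ((p : ℝ) ^ (-(5 / 8) : ℝ)) ^ e := fun e => by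
      rw [rpow_pow_eq, pow_add, mul_comm (_ ^ e)]
      congr 1
      rw [← Real.rpow_natCast, ← Real.rpow_mul (by positivity)]
      norm_num
    simp only [e2, ← mul_sum]
    rw [mul_comm]
    gcongr
    refine ((summable_geometric_of_lt_one (by positivity) hlt).sum_le_tsum _
      fun _ _ => by positivity).trans ?_
    rw [tsum_geometric_of_lt_one (by positivity) hlt, inv_le_comm₀ _ (by norm_num)] <;>
      linarith [prime_rpow_neg_le hp']
  refine (sum_le_sum hp).trans ?_
  rw [← mul_sum, powConst, mul_one]
  gcongr
  exact sum_prime_rpow_five_fourths_le _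

lemma sum_vonMangoldt_minFac_le (hy : 200 ≤ Real.log y) {u σ : ℝ} (hu : u ≤ 2 / Real.log y)
    (hσ : 0 < σ) {S : Finset ℕ} (hS : ∀ k ∈ S, k.minFac ≤ y) :
    ∑ k ∈ S, Λ k * (k : ℝ) ^ (u - 1 - σ) ≤ (18 + powConst 1) * Real.log y := by
  have hy0 : 0 < Real.log y := by linarith
  have hypos : 0 < y := Nat.pos_of_ne_zero fun h => by rw [h] at hy0; simp at hy0
  have hyr : (1 : ℝ) ≤ y := by exact_mod_cast hypos
  have hu1 : u ≤ 1 / 100 := hu.trans (by rw [div_le_iff₀ hy0]; linarith)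
  have hle : ∀ k ∈ S, Λ k * (k : ℝ) ^ (u - 1 - σ) ≤
      (if k ∈ Ioc 0 y then 9 * (Λ k / k) else 0) +
      (if IsPrimePow k ∧ ¬ k.Prime then 8 * (k : ℝ) ^ (-(5 / 8) : ℝ) else 0) := by
    intro k hk
    have hΛ : 0 ≤ Λ k := ArithmeticFunction.vonMangoldt_nonneg
    have hA : 0 ≤ (if k ∈ Ioc 0 y then 9 * (Λ k / k) else 0) := by
      split_ifs <;> positivity
    have hB : 0 ≤ (if IsPrimePow k ∧ ¬ k.Prime then 8 * (k : ℝ) ^ (-(5 / 8) : ℝ) else 0) := by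
      split_ifs <;> positivity
    by_cases hpp : IsPrimePow k
    swap
    · rw [ArithmeticFunction.vonMangoldt_eq_zero_iff.2 hpp, zero_mul]
      rw [ArithmeticFunction.vonMangoldt_eq_zero_iff.2 hpp] at hA
      linarith
    have hk0 := hpp.pos
    have hkr : (1 : ℝ) ≤ k := by exact_mod_cast hk0
    have hkp : (0 : ℝ) < k := by linarith
    by_cases hky : k ≤ y
    · refine le_add_of_le_of_nonneg ?_ hB
      rw [if_pos (mem_Ioc.2 ⟨hk0, hky⟩)]
      have h1 : (k : ℝ) ^ (u - 1 - σ) ≤ 9 * (1 / k) := by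
        calc (k : ℝ) ^ (u - 1 - σ) ≤ (k : ℝ) ^ (2 / Real.log y + (-1)) :=
              Real.rpow_le_rpow_of_exponent_le hkr (by linarith)
          _ = (k : ℝ) ^ (2 / Real.log y) * (1 / k) := by
              rw [Real.rpow_add hkp, Real.rpow_neg_one, one_div]
          _ ≤ (y : ℝ) ^ (2 / Real.log y) * (1 / k) := by
              gcongr
          _ = Real.exp 1 ^ 2 * (1 / k) := by
              rw [Real.rpow_def_of_pos (by linarith), mul_div_cancel₀ _ hy0.ne', ← Real.exp_nat_mul]
              norm_num
          _ ≤ _ := by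
              gcongr
              nlinarith [Real.exp_one_lt_d9, Real.exp_pos 1]
      calc Λ k * (k : ℝ) ^ (u - 1 - σ) ≤ Λ k * (9 * (1 / k)) := by gcongr
        _ = _ := by ring
    · refine le_add_of_nonneg_of_le hA ?_
      have hnp : ¬ k.Prime := fun h => by
        have := hS k hk
        rw [h.minFac_eq] at this
        exact hky this
      rw [if_pos ⟨hpp, hnp⟩]
      have h2 : Λ k ≤ 8 * (k : ℝ) ^ (1 / 8 : ℝ) := by
        refine ArithmeticFunction.vonMangoldt_le_log.trans
          ((Real.log_le_rpow_div hkp.le (by norm_num : (0:ℝ) < 1 / 8)).trans (le_of_eq ?_))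
        ring
      calc Λ k * (k : ℝ) ^ (u - 1 - σ) ≤ 8 * (k : ℝ) ^ (1 / 8 : ℝ) * (k : ℝ) ^ (u - 1 - σ) := by
            gcongr
        _ = 8 * (k : ℝ) ^ (1 / 8 + (u - 1 - σ)) := by rw [Real.rpow_add hkp]; ring
        _ ≤ _ := by
            gcongr
            linarith
  refine (sum_le_sum hle).trans ?_
  rw [sum_add_distrib, ← sum_filter, ← sum_filter, ← mul_sum, ← mul_sum]
  have h1 : ∑ k ∈ S with k ∈ Ioc 0 y, Λ k / k ≤ Real.log y + 6 := by
    refine le_trans ?_ (sum_vonMangoldt_div_le hypos)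
    exact sum_le_sum_of_subset_of_nonneg (fun k hk => (mem_filter.1 hk).2) fun k _ _ =>
      div_nonneg ArithmeticFunction.vonMangoldt_nonneg (Nat.cast_nonneg _)
  have h2 := sum_higher_prime_power_le (S := S.filter fun k => IsPrimePow k ∧ ¬ k.Prime)
    fun k hk => (mem_filter.1 hk).2
  have h3 := powConst_nonneg (zero_le_one' ℝ)
  nlinarith

end Gronwall

section Twist

variable {κ : ℝ} {f Λf : ℕ → ℂ} {y : ℕ} {s : ℂ} {u : ℝ}

/-- The coefficients `f n` weighted by a power of the `y`-smooth part of `n`. -/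
def smoothTwist (y : ℕ) (f : ℕ → ℂ) (u : ℝ) (n : ℕ) : ℂ := f n * (((sm y n : ℝ) ^ u : ℝ) : ℂ)

lemma norm_term_le {a : ℕ → ℂ} {b : ℕ → ℝ} (h : ∀ n, n ≠ 0 → ‖a n‖ ≤ b n) (n : ℕ) :
    ‖LSeries.term a s n‖ ≤ ‖b n * (n : ℝ) ^ (-s.re)‖ := by
  rw [LSeries.norm_term_eq]
  split_ifs with hn
  · exact norm_nonneg _
  · rw [norm_mul, Real.norm_of_nonneg ((norm_nonneg _).trans (h n hn)),
      Real.norm_of_nonneg (by positivity), Real.rpow_neg (by positivity), ← div_eq_mul_inv]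
    gcongr
    exact h n hn

lemma norm_smoothTwist_le (hu : u ≤ 1 / 10) (n : ℕ) :
    ‖smoothTwist y f u n‖ ≤ ‖f n‖ * (sm y n : ℝ) ^ (1 / 10 : ℝ) := by
  have h1 : (1 : ℝ) ≤ sm y n := by exact_mod_cast sm_pos y n
  rw [smoothTwist, norm_mul, Complex.norm_real, Real.norm_of_nonneg (by positivity)]
  gcongr

lemma _root_.IsHalaszClass.summable_norm_mul_sm' (hf : IsHalaszClass κ f Λf) (hκ : 0 < κ) (y : ℕ)
    (hs : 1 < s.re) :
    Summable fun n : ℕ => ‖f n‖ * (sm y n : ℝ) ^ (1 / 10 : ℝ) * (n : ℝ) ^ (-s.re) := by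
  have := hf.summable_norm_mul_sm hκ y (σ := s.re - 1) (by linarith)
  convert this using 4
  ring

lemma _root_.IsHalaszClass.lseriesSummable_smoothTwist (hf : IsHalaszClass κ f Λf) (hκ : 0 < κ)
    (hs : 1 < s.re) (hu : u ≤ 1 / 10) : LSeriesSummable (smoothTwist y f u) s :=
  (hf.summable_norm_mul_sm' hκ y hs).norm.of_norm_bounded
    (norm_term_le fun n _ => norm_smoothTwist_le hu n)

lemma _root_.IsHalaszClass.hasDerivAt_lseries_smoothTwist (hf : IsHalaszClass κ f Λf) (hκ : 0 < κ)
    (hs : 1 < s.re) (hu : u ∈ Set.Ioo (-1 : ℝ) (1 / 20)) :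
    HasDerivAt (fun u : ℝ => LSeries (smoothTwist y f u) s)
      (LSeries (fun n => smoothTwist y f u n * (Real.log (sm y n) : ℂ)) s) u := by
  refine hasDerivAt_tsum_of_isPreconnected (t := Set.Ioo (-1 : ℝ) (1 / 20))
    (g := fun n u => LSeries.term (smoothTwist y f u) s n)
    (g' := fun n u => LSeries.term (fun n => smoothTwist y f u n * (Real.log (sm y n) : ℂ)) s n)
    ((hf.summable_norm_mul_sm' hκ y hs).mul_left 20).norm isOpen_Ioo isPreconnected_Ioo
    (fun n v _ => ?_) (fun n v hv => ?_) hu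
    (hf.lseriesSummable_smoothTwist hκ hs (hu.2.le.trans (by norm_num))) hu
  · rcases eq_or_ne n 0 with rfl | hn
    · simpa using hasDerivAt_const v (0 : ℂ)
    · simp only [LSeries.term_def, if_neg hn, smoothTwist]
      have h1 : (0 : ℝ) < sm y n := by exact_mod_cast sm_pos y n
      have h2 := ((Real.hasStrictDerivAt_const_rpow h1 v).hasDerivAt.ofReal_comp.const_mul
        (f n)).div_const ((n : ℂ) ^ s)
      refine h2.congr_deriv ?_
      push_cast
      ring
  · have := norm_term_le (s := s) (a := fun n => smoothTwist y f v n * (Real.log (sm y n) : ℂ))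
      (b := fun n => 20 * (‖f n‖ * (sm y n : ℝ) ^ (1 / 10 : ℝ))) (fun n _ => ?_) n
    · rwa [mul_assoc 20] at this
    have h1 : (1 : ℝ) ≤ sm y n := by exact_mod_cast sm_pos y n
    have h2 := Real.log_le_rpow_div (x := (sm y n : ℝ)) (by linarith) (by norm_num : (0:ℝ) < 1 / 20)
    have h0 := Real.log_nonneg h1
    have h4 := hv.2.le
    rw [smoothTwist, norm_mul, norm_mul, Complex.norm_real, Complex.norm_real,
      Real.norm_of_nonneg (by positivity), Real.norm_of_nonneg h0]
    calc ‖f n‖ * (sm y n : ℝ) ^ v * Real.log (sm y n)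
        ≤ ‖f n‖ * (sm y n : ℝ) ^ (1 / 20 : ℝ) * ((sm y n : ℝ) ^ (1 / 20 : ℝ) / (1 / 20)) := by
          gcongr
      _ = 20 * (‖f n‖ * ((sm y n : ℝ) ^ (1 / 20 : ℝ) * (sm y n : ℝ) ^ (1 / 20 : ℝ))) := by ring
      _ = _ := by rw [← Real.rpow_add (by linarith)]; norm_num

lemma _root_.IsHalaszClass.norm_smallPart_mul_le (hf : IsHalaszClass κ f Λf) (hκ : 0 < κ) (k : ℕ) :
    ‖smallPart y Λf k * (((k : ℝ) ^ u : ℝ) : ℂ)‖ ≤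
      κ * (if k.minFac ≤ y then Λ k * (k : ℝ) ^ u else 0) := by
  have h0 : 0 ≤ (k : ℝ) ^ u := by positivity
  split_ifs with h
  · rw [norm_mul, Complex.norm_real, Real.norm_of_nonneg h0, ← mul_assoc]
    gcongr
    exact hf.norm_smallPart_le hκ k
  · rw [smallPart, if_neg h, zero_mul, norm_zero, mul_zero]

lemma sum_smooth_vonMangoldt_le (hy : 200 ≤ Real.log y) (hu : u ≤ 2 / Real.log y) (hs : 1 < s.re)
    (S : Finset ℕ) :
    ∑ k ∈ S, (if k.minFac ≤ y then Λ k * (k : ℝ) ^ u else 0) * (k : ℝ) ^ (-s.re) ≤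
      (18 + powConst 1) * Real.log y := by
  simp only [ite_mul, zero_mul]
  rw [← sum_filter]
  have h := sum_vonMangoldt_minFac_le hy hu (σ := s.re - 1) (by linarith)
    (S := S.filter fun k => k.minFac ≤ y) fun k hk => (mem_filter.1 hk).2
  refine le_trans (sum_le_sum fun k _ => le_of_eq ?_) h
  rcases Nat.eq_zero_or_pos k with rfl | hk
  · simp
  · rw [mul_assoc, ← Real.rpow_add (by exact_mod_cast hk)]
    ring_nf

lemma _root_.IsHalaszClass.norm_lseries_smallPart_le (hf : IsHalaszClass κ f Λf) (hκ : 0 < κ)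
    (hy : 200 ≤ Real.log y) (hu : u ≤ 2 / Real.log y) (hs : 1 < s.re) :
    LSeriesSummable (fun k => smallPart y Λf k * (((k : ℝ) ^ u : ℝ) : ℂ)) s ∧
    ‖LSeries (fun k => smallPart y Λf k * (((k : ℝ) ^ u : ℝ) : ℂ)) s‖ ≤
      κ * ((18 + powConst 1) * Real.log y) := by
  set b : ℕ → ℝ := fun k =>
    (if k.minFac ≤ y then Λ k * (k : ℝ) ^ u else 0) * (k : ℝ) ^ (-s.re) with hb
  have hb0 : ∀ k, 0 ≤ b k := fun k => by
    have : 0 ≤ Λ k := ArithmeticFunction.vonMangoldt_nonneg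
    simp only [hb]
    split_ifs <;> positivity
  have hsum : Summable b := summable_of_sum_le hb0 (sum_smooth_vonMangoldt_le hy hu hs)
  have hle : ∀ k, ‖LSeries.term (fun k => smallPart y Λf k * (((k : ℝ) ^ u : ℝ) : ℂ)) s k‖ ≤
      κ * b k := fun k => by
    have := norm_term_le (s := s) (fun n _ => hf.norm_smallPart_mul_le (y := y) (u := u) hκ n) k
    rwa [mul_assoc, Real.norm_of_nonneg (mul_nonneg hκ.le (hb0 k))] at this
  refine ⟨(hsum.mul_left κ).of_norm_bounded hle, ?_⟩
  refine (tsum_of_norm_bounded (hsum.mul_left κ).hasSum hle).trans ?_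
  rw [tsum_mul_left]
  gcongr
  exact hsum.tsum_le_of_sum_le (sum_smooth_vonMangoldt_le hy hu hs)

lemma _root_.IsHalaszClass.convolution_smallPart (hf : IsHalaszClass κ f Λf) {n : ℕ} (hn : n ≠ 0) :
    smoothTwist y f u n * (Real.log (sm y n) : ℂ) =
      LSeries.convolution (fun k => smallPart y Λf k * (((k : ℝ) ^ u : ℝ) : ℂ))
        (smoothTwist y f u) n := by
  rw [LSeries.convolution_def]
  dsimp only
  rw [Nat.sum_divisorsAntidiagonal (fun d e => smallPart y Λf d * (((d : ℝ) ^ u : ℝ) : ℂ) *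
    smoothTwist y f u e), smoothTwist, mul_right_comm, hf.mul_log_sm hn, sum_mul]
  refine sum_congr rfl fun d hd => ?_
  by_cases h0 : smallPart y Λf d = 0
  · simp [h0]
  obtain ⟨h1, h2⟩ := hf.isPrimePow_of_smallPart_ne_zero h0
  have hdn := (Nat.mem_divisors.1 hd).1
  have h3 : sm y n = d * sm y (n / d) := by
    conv_lhs => rw [← Nat.mul_div_cancel' hdn]
    rw [sm_mul h1.ne_zero (Nat.div_pos (Nat.le_of_dvd (by omega) hdn) h1.pos).ne',
      sm_eq_self_of_isPrimePow h1 h2]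
  rw [h3, smoothTwist, Nat.cast_mul, Real.mul_rpow (by positivity) (by positivity)]
  push_cast
  ring

lemma fser_eq_lseries (hs : s ≠ 0) : Fser f s = LSeries f s := by
  refine tsum_congr fun n => ?_
  rcases eq_or_ne n 0 with rfl | hn
  · simp [Complex.zero_cpow hs]
  · rw [LSeries.term_def, if_neg hn]

lemma _root_.IsHalaszClass.norm_lseries_smoothTwist_le (hf : IsHalaszClass κ f Λf) (hκ : 0 < κ)
    (hy : 200 ≤ Real.log y) (hu0 : 0 ≤ u) (hu : u ≤ 2 / Real.log y) (hs : 1 < s.re) :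
    ‖LSeries (smoothTwist y f u) s‖ ≤ Real.exp (2 * κ * (18 + powConst 1)) * ‖Fser f s‖ := by
  have hy0 : 0 < Real.log y := by linarith
  have hb : 2 / Real.log y ≤ 1 / 100 := by rw [div_le_iff₀ hy0]; linarith
  have hmem : ∀ v ∈ Set.Icc 0 (2 / Real.log y), v ∈ Set.Ioo (-1 : ℝ) (1 / 20) := fun v hv =>
    ⟨by linarith [hv.1], by linarith [hv.2]⟩
  have hd : ∀ v ∈ Set.Icc 0 (2 / Real.log y), _ := fun v hv =>
    hf.hasDerivAt_lseries_smoothTwist (y := y) hκ hs (hmem v hv)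
  have key := norm_le_gronwallBound_of_norm_deriv_right_le
    (f := fun u : ℝ => LSeries (smoothTwist y f u) s)
    (f' := fun u => LSeries (fun n => smoothTwist y f u n * (Real.log (sm y n) : ℂ)) s)
    (δ := ‖LSeries (smoothTwist y f 0) s‖) (K := κ * ((18 + powConst 1) * Real.log y)) (ε := 0)
    (a := 0) (b := 2 / Real.log y) (fun v hv => (hd v hv).continuousAt.continuousWithinAt)
    (fun v hv => (hd v ⟨hv.1, hv.2.le⟩).hasDerivWithinAt) le_rfl (fun v hv => ?_) u ⟨hu0, hu⟩
  · rw [gronwallBound_ε0, sub_zero] at key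
    have h0 : LSeries (smoothTwist y f 0) s = Fser f s := by
      rw [fser_eq_lseries (fun h => by rw [h] at hs; simp at hs; linarith)]
      exact LSeries_congr (fun _ => by simp [smoothTwist]) s
    rw [h0] at key
    refine key.trans ?_
    rw [mul_comm]
    have := powConst_nonneg (zero_le_one' ℝ)
    refine mul_le_mul_of_nonneg_right (Real.exp_le_exp.2 ?_) (norm_nonneg _)
    calc κ * ((18 + powConst 1) * Real.log y) * u
        ≤ κ * ((18 + powConst 1) * Real.log y) * (2 / Real.log y) := by gcongr
      _ = 2 * κ * (18 + powConst 1) := by field_simp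
  · rw [add_zero]
    obtain ⟨h1, h2⟩ := hf.norm_lseries_smallPart_le hκ hy hv.2.le hs
    rw [LSeries_congr (fun {n} hn => hf.convolution_smallPart (y := y) (u := v) hn) s,
      LSeries_convolution' h1 (hf.lseriesSummable_smoothTwist hκ hs
        ((hmem v ⟨hv.1, hv.2.le⟩).2.le.trans (by norm_num))), norm_mul]
    gcongr

lemma exists_norm_fser_le (hκ : 0 < κ) : ∃ C : ℝ, 1 ≤ C ∧
    ∀ f Λf : ℕ → ℂ, IsHalaszClass κ f Λf → ∀ s : ℂ, 1 < s.re → s.re ≤ 2 →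
    ‖Fser f s‖ ≤ C * (s.re - 1) ^ (-κ) := by
  obtain ⟨C, hC1, hC⟩ := exists_sum_norm_rpow_le hκ
  refine ⟨C, hC1, fun f Λf hf s hs hs2 => ?_⟩
  have hbd : ∀ S : Finset ℕ, ∑ n ∈ S, ‖LSeries.term f s n‖ ≤ C * (s.re - 1) ^ (-κ) := by
    intro S
    refine le_trans ?_ (hC f Λf hf (s.re - 1) (by linarith) (by linarith) (S.erase 0)
      fun n hn => (mem_erase.1 hn).1)
    rw [← sum_erase S (a := 0) (by simp)]
    refine sum_le_sum fun n hn => ?_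
    have := norm_term_le (s := s) (a := f) (b := fun n => ‖f n‖) (fun _ _ => le_rfl) n
    rw [Real.norm_of_nonneg (by positivity)] at this
    rwa [show -1 - (s.re - 1) = -s.re by ring]
  have hsum : Summable fun n => ‖LSeries.term f s n‖ :=
    summable_of_sum_le (fun _ => norm_nonneg _) hbd
  rw [fser_eq_lseries (fun h => by rw [h] at hs; simp at hs; linarith)]
  exact (norm_tsum_le_tsum_norm hsum).trans (hsum.tsum_le_of_sum_le hbd)

lemma _root_.IsHalaszClass.continuousOn_fser (hf : IsHalaszClass κ f Λf) (hκ : 0 < κ) :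
    ContinuousOn (Fser f) {s | 1 < s.re} := by
  have h1 : LSeries.abscissaOfAbsConv f ≤ ((1 : ℝ) : EReal) := by
    refine LSeries.abscissaOfAbsConv_le_of_forall_lt_LSeriesSummable fun v hv => ?_
    have := hf.lseriesSummable_smoothTwist (y := 0) (u := 0) (s := (v : ℂ)) hκ (by simpa using hv)
      (by norm_num)
    exact (LSeriesSummable_congr _ fun {n} _ => by simp [smoothTwist]).1 this
  have h2 : ContinuousOn (LSeries f) {s | 1 < s.re} :=
    (LSeries_differentiableOn f).continuousOn.mono fun s hs => by
      exact h1.trans_lt (by exact_mod_cast hs)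
  refine h2.congr fun s hs => fser_eq_lseries fun h => ?_
  rw [h] at hs
  simp at hs
  linarith

end Twist

section Perron

variable {κ : ℝ} {f Λf : ℕ → ℂ} {y N : ℕ} {x h Δ c : ℝ}

lemma integrable_norm_trapHat (hc : 0 < c) (hΔ : 0 < Δ) (hh : 0 ≤ h) (hx : Δ < x) :
    Integrable fun t : ℝ => ‖trapHat x h Δ ((c : ℂ) + t * I)‖ := by
  have := (integral_trapHat (x := x) hc one_pos hΔ hh hx).1.norm
  simpa using this

lemma norm_term_add_mul_I (a : ℕ → ℂ) (n : ℕ) (t : ℝ) :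
    ‖LSeries.term a ((c : ℂ) + t * I) n‖ = ‖LSeries.term a (c : ℂ) n‖ := by
  rw [LSeries.norm_term_eq, LSeries.norm_term_eq]
  simp

/-- Perron's formula for the trapezoidal weight, summed over a finite family of dilations. -/
lemma sum_trap_eq_integral {ι : Type*} (J : Finset ι) {K : ι → ℕ} (hK : ∀ j ∈ J, 0 < K j)
    (d : ι → ℂ) {a : ℕ → ℂ} (hc : 0 < c) (hΔ : 0 < Δ) (hh : 0 ≤ h) (hx : Δ < x)
    (hN : x + h + Δ ≤ N) (ha : LSeriesSummable a (c : ℂ)) :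
    2 * Real.pi * ∑ j ∈ J, ∑ n ∈ Ioc 0 N, (trap x h Δ ((K j * n : ℕ) : ℝ) : ℂ) * (d j * a n) =
      ∫ t : ℝ, trapHat x h Δ ((c : ℂ) + t * I) *
        (∑ j ∈ J, d j * (K j : ℂ) ^ (-((c : ℂ) + t * I))) * LSeries a ((c : ℂ) + t * I) := by
  set P : ℝ → ℂ := fun t => ∑ j ∈ J, d j * (K j : ℂ) ^ (-((c : ℂ) + t * I)) with hP
  set F : ℕ → ℝ → ℂ := fun n t => trapHat x h Δ ((c : ℂ) + t * I) * P t *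
    LSeries.term a ((c : ℂ) + t * I) n with hF
  have hFn : ∀ n, 0 < n → ∀ t, F n t = ∑ j ∈ J, d j * a n *
      (trapHat x h Δ ((c : ℂ) + t * I) * ((((K j * n : ℕ) : ℝ) : ℂ)) ^ (-((c : ℂ) + t * I))) := by
    intro n hn t
    simp only [hF, hP, mul_sum, sum_mul]
    refine sum_congr rfl fun j hj => ?_
    rw [LSeries.term_def, if_neg hn.ne', Complex.ofReal_natCast, Nat.cast_mul,
      Complex.natCast_mul_natCast_cpow, Complex.cpow_neg (n : ℂ)]
    ring
  have hInt : ∀ n, 0 < n → ∀ j ∈ J, Integrable fun t : ℝ => d j * a n *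
      (trapHat x h Δ ((c : ℂ) + t * I) * ((((K j * n : ℕ) : ℝ) : ℂ)) ^ (-((c : ℂ) + t * I))) :=
    fun n hn j hj => (integral_trapHat (N := ((K j * n : ℕ) : ℝ)) hc
      (by exact_mod_cast Nat.mul_pos (hK j hj) hn) hΔ hh hx).1.const_mul _
  have hF0 : F 0 = fun _ => 0 := by
    funext t
    simp [hF]
  have hFint : ∀ n, Integrable (F n) := by
    intro n
    rcases Nat.eq_zero_or_pos n with rfl | hn
    · rw [hF0]
      exact integrable_zero _ _ _
    · rw [funext (hFn n hn)]
      exact integrable_finsetSum _ (hInt n hn)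
  have hFI : ∀ n, ∫ t, F n t = if n ∈ Ioc 0 N then ∑ j ∈ J, d j * a n *
      (2 * Real.pi * (trap x h Δ ((K j * n : ℕ) : ℝ) : ℝ)) else 0 := by
    intro n
    rcases Nat.eq_zero_or_pos n with rfl | hn
    · rw [hF0, if_neg (by simp)]
      simp
    rw [integral_congr_ae (.of_forall (hFn n hn)), integral_finsetSum _ (hInt n hn)]
    have e : ∀ j ∈ J, ∫ t : ℝ, d j * a n * (trapHat x h Δ ((c : ℂ) + t * I) *
        ((((K j * n : ℕ) : ℝ) : ℂ)) ^ (-((c : ℂ) + t * I))) =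
        d j * a n * (2 * Real.pi * (trap x h Δ ((K j * n : ℕ) : ℝ) : ℝ)) := fun j hj => by
      rw [integral_const_mul, (integral_trapHat (N := ((K j * n : ℕ) : ℝ)) hc
        (by exact_mod_cast Nat.mul_pos (hK j hj) hn) hΔ hh hx).2]
    rw [sum_congr rfl e]
    by_cases hnN : n ∈ Ioc 0 N
    · rw [if_pos hnN]
    · rw [if_neg hnN]
      refine sum_eq_zero fun j hj => ?_
      have h1 : N < n := by
        by_contra h
        exact hnN (mem_Ioc.2 ⟨hn, by omega⟩)
      have h2 : n ≤ K j * n := Nat.le_mul_of_pos_left _ (hK j hj)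
      have h3 : (N : ℝ) ≤ ((K j * n : ℕ) : ℝ) := by exact_mod_cast h1.le.trans h2
      rw [trap_eq_zero_of_ge hΔ hh (hN.trans h3)]
      simp
  have hPle : ∀ t, ‖P t‖ ≤ ∑ j ∈ J, ‖d j‖ * (K j : ℝ) ^ (-c) := by
    intro t
    refine (norm_sum_le _ _).trans (sum_le_sum fun j hj => le_of_eq ?_)
    rw [norm_mul, Complex.norm_natCast_cpow_of_pos (hK j hj)]
    simp
  have hsum : Summable fun n => ∫ t, ‖F n t‖ := by
    refine Summable.of_nonneg_of_le (fun n => integral_nonneg fun _ => norm_nonneg _) (fun n => ?_)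
      (ha.norm.mul_left ((∫ t : ℝ, ‖trapHat x h Δ ((c : ℂ) + t * I)‖) *
        ∑ j ∈ J, ‖d j‖ * (K j : ℝ) ^ (-c)))
    rw [← integral_mul_const, ← integral_mul_const]
    refine integral_mono (hFint n).norm
      (((integrable_norm_trapHat hc hΔ hh hx).mul_const _).mul_const _) fun t => ?_
    simp only [hF, norm_mul, norm_term_add_mul_I]
    gcongr
    exact hPle t
  have key := (hasSum_integral_of_summable_integral_norm hFint hsum).tsum_eq
  have e1 : ∀ t, ∑' n, F n t = trapHat x h Δ ((c : ℂ) + t * I) * P t *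
      LSeries a ((c : ℂ) + t * I) := fun t => by
    simp only [hF, tsum_mul_left]
    rfl
  rw [← integral_congr_ae (.of_forall e1), ← key, tsum_congr hFI,
    tsum_eq_sum (s := Ioc 0 N) fun n hn => if_neg hn, sum_comm, mul_sum]
  refine sum_congr rfl fun n hn => ?_
  rw [if_pos hn, mul_sum]
  refine sum_congr rfl fun j _ => ?_
  ring

lemma lseries_ro_eq {γ σ : ℝ} (hcσ : c + γ = 1 + σ) (t : ℝ) (n : ℕ) :
    LSeries.term (fun n => f n * ((ro y n : ℝ) ^ (-γ) : ℝ)) ((c : ℂ) + t * I) n =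
      LSeries.term (smoothTwist y f γ) (1 + (σ : ℂ) + t * I) n := by
  rcases eq_or_ne n 0 with rfl | hn
  · simp
  rw [LSeries.term_def, LSeries.term_def, if_neg hn, if_neg hn, smoothTwist]
  have hs : (0 : ℝ) < sm y n := by exact_mod_cast sm_pos y n
  have hr : (0 : ℝ) < ro y n := by exact_mod_cast ro_pos hn
  have hn0 : (0 : ℝ) < n := by positivity
  have e : (1 + (σ : ℂ) + t * I) = (c : ℂ) + t * I + (γ : ℂ) := by
    have : ((c + γ : ℝ) : ℂ) = ((1 + σ : ℝ) : ℂ) := by rw [hcσ]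
    push_cast at this
    linear_combination -this
  have e2 : (n : ℝ) ^ γ = (sm y n : ℝ) ^ γ * (ro y n : ℝ) ^ γ := by
    rw [← Real.mul_rpow hs.le hr.le]
    exact_mod_cast congrArg (fun k : ℕ => (k : ℝ) ^ γ) (sm_mul_ro (y := y) hn).symm
  have e3 : (n : ℂ) ^ (γ : ℂ) = (((n : ℝ) ^ γ : ℝ) : ℂ) := by
    rw [Complex.ofReal_cpow hn0.le, Complex.ofReal_natCast]
  have hnc : (n : ℂ) ≠ 0 := by exact_mod_cast hn
  have h1 : (((sm y n : ℝ) ^ γ : ℝ) : ℂ) ≠ 0 := by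
    exact_mod_cast (Real.rpow_pos_of_pos hs γ).ne'
  have h2 : (((ro y n : ℝ) ^ γ : ℝ) : ℂ) ≠ 0 := by
    exact_mod_cast (Real.rpow_pos_of_pos hr γ).ne'
  have h3 : (n : ℂ) ^ ((c : ℂ) + t * I) ≠ 0 := by
    rw [Complex.cpow_ne_zero_iff]; exact Or.inl hnc
  rw [e, Complex.cpow_add ((c : ℂ) + t * I) (γ : ℂ) hnc, e3, e2, Real.rpow_neg hr.le]
  push_cast
  field_simp

lemma natCast_cpow_add_mul_I {n : ℕ} (hn : 0 < n) (t : ℝ) :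
    (n : ℂ) ^ (-((c : ℂ) + t * I)) = (((n : ℝ) ^ (-c) : ℝ) : ℂ) * (n : ℂ) ^ (-((t : ℂ) * I)) := by
  rw [neg_add, Complex.cpow_add _ _ (by exact_mod_cast hn.ne'),
    Complex.ofReal_cpow (Nat.cast_nonneg _), Complex.ofReal_natCast, Complex.ofReal_neg]

/-- The Dirichlet polynomial with coefficients `bigPart y Λf` on the vertical line `Re s = w`. -/
def bigPoly (y : ℕ) (Λf : ℕ → ℂ) (N : ℕ) (w t : ℝ) : ℂ :=
  ∑ k ∈ Ioc 0 N, bigPart y Λf k * ((k : ℝ) ^ (-w) : ℝ) * (k : ℂ) ^ (-((t : ℂ) * I))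

lemma _root_.IsHalaszClass.tripleSum_eq_integral (hf : IsHalaszClass κ f Λf) (hκ : 0 < κ)
    {α β σ : ℝ} (hc : 0 < c) (hΔ : 0 < Δ) (hh : 0 ≤ h) (hx : Δ < x) (hN : x + h + Δ ≤ N)
    (hσ : 0 < σ) (hcσ : c + (α + β) = 1 + σ) (hαβ : α + β ≤ 1 / 10) :
    2 * Real.pi * tripleSum f Λf y N (fun n => trap x h Δ n) α β =
      ∫ t : ℝ, trapHat x h Δ ((c : ℂ) + t * I) *
        (bigPoly y Λf N (α + c) t * bigPoly y Λf N (1 + σ) t) *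
        LSeries (smoothTwist y f (α + β)) (1 + (σ : ℂ) + t * I) := by
  have hsummable : LSeriesSummable (fun n => f n * ((ro y n : ℝ) ^ (-(α + β)) : ℝ)) (c : ℂ) := by
    have h1 := hf.lseriesSummable_smoothTwist (y := y) (u := α + β)
      (s := 1 + (σ : ℂ) + (0 : ℝ) * I) hκ (by simpa using hσ) hαβ
    have h2 : LSeries.term (fun n => f n * ((ro y n : ℝ) ^ (-(α + β)) : ℝ)) (c : ℂ) =
        LSeries.term (smoothTwist y f (α + β)) (1 + (σ : ℂ) + (0 : ℝ) * I) := by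
      funext n
      rw [← lseries_ro_eq (c := c) hcσ 0 n]
      simp
    rw [LSeriesSummable, h2]
    exact h1
  have key := sum_trap_eq_integral (Ioc 0 N ×ˢ Ioc 0 N) (K := fun j => j.1 * j.2)
    (fun j hj => Nat.mul_pos (mem_Ioc.1 (mem_product.1 hj).1).1 (mem_Ioc.1 (mem_product.1 hj).2).1)
    (fun j => bigPart y Λf j.1 * ((j.1 : ℝ) ^ (-α) : ℝ) *
      (bigPart y Λf j.2 * ((j.2 : ℝ) ^ (-(α + β)) : ℝ))) hc hΔ hh hx hN hsummable
  rw [sum_product] at key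
  rw [tripleSum]
  simp only [mul_assoc] at key ⊢
  rw [key]
  refine integral_congr_ae (.of_forall fun t => ?_)
  dsimp only
  have e1 : LSeries (fun n => f n * ((ro y n : ℝ) ^ (-(α + β)) : ℝ)) ((c : ℂ) + t * I) =
      LSeries (smoothTwist y f (α + β)) (1 + (σ : ℂ) + t * I) :=
    tsum_congr fun n => lseries_ro_eq hcσ t n
  rw [e1, sum_product, ← mul_assoc (bigPoly _ _ _ _ _), bigPoly, bigPoly, sum_mul_sum]
  congr 2
  refine sum_congr rfl fun k hk => sum_congr rfl fun m hm => ?_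
  have hk' := (mem_Ioc.1 hk).1
  have hm' := (mem_Ioc.1 hm).1
  rw [Nat.cast_mul, Complex.natCast_mul_natCast_cpow, natCast_cpow_add_mul_I hk',
    natCast_cpow_add_mul_I hm', show -(1 + σ) = -(α + β) + -c by linarith, neg_add α c,
    Real.rpow_add (by exact_mod_cast hk'), Real.rpow_add (by exact_mod_cast hm' : (0:ℝ) < m)]
  push_cast
  ring

end Perron

section MainTerm

variable {κ : ℝ} {f Λf : ℕ → ℂ} {y N : ℕ} {x h Δ T c σ : ℝ}

lemma trapHat_mul_le (hc1 : 1 / 2 ≤ c) (hc2 : c ≤ 2) (hT : 2 ≤ T) (hΔ : Δ = x / (2 * T))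
    (hΔh : Δ ≤ h) (hhx : h ≤ x) (hx : 0 < x) {g : ℝ → ℝ} {M B : ℝ} (hg : ∀ t, 0 ≤ g t)
    (hM : ∀ t, |t| ≤ T → g t ≤ M) (hB : ∀ t, g t ≤ B) (t : ℝ) :
    ‖trapHat x h Δ ((c : ℂ) + t * I)‖ * g t ≤
      432 * x ^ c * (h / x * M + B / T) * poissonKer T t := by
  have hT0 : 0 < T := by linarith
  have hΔ0 : 0 < Δ := by rw [hΔ]; positivity
  have hh0 : 0 < h := hΔ0.trans_le hΔh
  have hΔx : Δ ≤ x / 2 := by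
    rw [hΔ, div_le_div_iff₀ (by positivity) (by norm_num)]
    nlinarith
  have hM0 : 0 ≤ M := (hg 0).trans (hM 0 (by simpa using hT0.le))
  have hB0 : 0 ≤ B := (hg 0).trans (hB 0)
  have hP := poissonKer_pos T t
  have hxc : 0 < x ^ c := by positivity
  by_cases ht : |t| ≤ T
  · have hP2 : 1 / 2 ≤ poissonKer T t := by
      rw [poissonKer, one_div]
      refine inv_anti₀ (by positivity) ?_
      have : (t / T) ^ 2 ≤ 1 := by
        rw [sq_le_one_iff_abs_le_one, abs_div, abs_of_pos hT0, div_le_one hT0]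
        exact ht
      linarith
    have e : x ^ (c - 1) = x ^ c / x := by rw [Real.rpow_sub hx, Real.rpow_one]
    calc ‖trapHat x h Δ ((c : ℂ) + t * I)‖ * g t ≤ 6 * x ^ (c - 1) * h * M := by
          gcongr
          · exact hg t
          · exact norm_trapHat_le hc1 hc2 hΔ0 hΔh hhx hΔx t
          · exact hM t ht
      _ = 12 * x ^ c * (h / x * M) * (1 / 2) := by rw [e]; ring
      _ ≤ 432 * x ^ c * (h / x * M + B / T) * poissonKer T t := by
          gcongr
          · norm_num
          · have : 0 ≤ B / T := by positivity
            linarith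
  · have ht0 : t ≠ 0 := fun h => ht (by rw [h, abs_zero]; exact hT0.le)
    have ht2 : T ^ 2 ≤ t ^ 2 := by
      rw [← sq_abs t]
      gcongr
      exact (not_le.1 ht).le
    have ht20 : 0 < t ^ 2 := by positivity
    have hP2 : T ^ 2 / (2 * t ^ 2) ≤ poissonKer T t := by
      rw [poissonKer, div_pow, ← one_div, div_le_div_iff₀ (by positivity) (by positivity)]
      field_simp
      linarith
    calc ‖trapHat x h Δ ((c : ℂ) + t * I)‖ * g t ≤ 108 * x ^ (c + 1) / (Δ * t ^ 2) * B := by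
          gcongr
          · exact hg t
          · exact norm_trapHat_le' hc1 hc2 hΔ0 hΔh hhx hΔx ht0
          · exact hB t
      _ = 432 * x ^ c * (B / T) * (T ^ 2 / (2 * t ^ 2)) := by
          rw [hΔ, Real.rpow_add hx, Real.rpow_one]
          field_simp
          ring
      _ ≤ 432 * x ^ c * (h / x * M + B / T) * poissonKer T t := by
          gcongr
          have : 0 ≤ h / x * M := by positivity
          linarith

lemma _root_.IsHalaszClass.integral_norm_bigPoly_sq_le (hf : IsHalaszClass κ f Λf) (hκ : 0 < κ)
    (hT : 2 ≤ T) (hy : T ^ 2 ≤ y) (w : ℝ) :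
    Integrable (fun t : ℝ => ‖bigPoly y Λf N w t‖ ^ 2 * poissonKer T t) ∧
    ∫ t : ℝ, ‖bigPoly y Λf N w t‖ ^ 2 * poissonKer T t ≤
      108000 * Real.pi * (κ ^ 2 * ∑ k ∈ Ioc 0 N, Λ k / k * (k : ℝ) ^ (2 - 2 * w)) := by
  set S := (Ioc 0 N).filter fun k => y < k.minFac with hS
  have hSub : S ⊆ Ioc 0 N := filter_subset _ _
  have e : ∀ t, bigPoly y Λf N w t = ∑ k ∈ S, bigPart y Λf k * ((k : ℝ) ^ (-w) : ℝ) *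
      (k : ℂ) ^ (-((t : ℂ) * I)) := by
    intro t
    rw [bigPoly]
    symm
    refine sum_subset hSub fun k hk hkS => ?_
    have : bigPart y Λf k = 0 := if_neg fun h => hkS (mem_filter.2 ⟨hk, h⟩)
    rw [this, zero_mul, zero_mul]
  obtain ⟨h1, h2⟩ := integral_norm_sq_le (S := S) (y := (y : ℝ)) hT hy (fun m hm => by
      have h1 := (mem_filter.1 hm).2
      have h2 := Nat.minFac_le (mem_Ioc.1 (hSub hm)).1
      exact_mod_cast h1.le.trans h2)
    (a := fun k => bigPart y Λf k * ((k : ℝ) ^ (-w) : ℝ)) (c := fun k => κ * (k : ℝ) ^ (-w))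
    (fun k _ => by
      rw [norm_mul, Complex.norm_real, Real.norm_of_nonneg (by positivity)]
      have := hf.norm_bigPart_le (y := y) hκ k
      calc _ ≤ κ * Λ k * (k : ℝ) ^ (-w) := by gcongr
        _ = _ := by ring)
    (fun _ _ => by positivity)
  simp only [← e] at h1 h2
  refine ⟨h1, h2.trans ?_⟩
  gcongr
  rw [mul_sum]
  refine le_trans (sum_le_sum fun k hk => le_of_eq ?_) (sum_le_sum_of_subset_of_nonneg hSub
    fun k _ _ => mul_nonneg (sq_nonneg κ) (mul_nonneg (div_nonneg
      ArithmeticFunction.vonMangoldt_nonneg (Nat.cast_nonneg _)) (by positivity)))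
  have hk0 : (0 : ℝ) < k := by exact_mod_cast (mem_Ioc.1 (hSub hk)).1
  have e2 : (k : ℝ) ^ (2 - 2 * w) = k ^ 2 * ((k : ℝ) ^ (-w)) ^ 2 := by
    rw [← Real.rpow_natCast, ← Real.rpow_natCast, ← Real.rpow_mul hk0.le, ← Real.rpow_add hk0]
    congr 1
    push_cast
    ring
  rw [e2]
  field_simp

lemma sum_vonMangoldt_rpow_neg_le (h0 : 0 < σ) (h1 : σ ≤ 1 / 2) :
    ∑ k ∈ Ioc 0 N, Λ k / k * (k : ℝ) ^ (2 - 2 * (1 + σ)) ≤ 24 / σ := by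
  have h := sum_vonMangoldt_rpow_le (S := Ioc 0 N) (μ := 2 * σ) (by linarith) (by linarith)
    fun n hn => (mem_Ioc.1 hn).1
  rw [show (48 : ℝ) / (2 * σ) = 24 / σ by field_simp; norm_num] at h
  rwa [show 2 - 2 * (1 + σ) = -(2 * σ) by ring]

lemma sum_vonMangoldt_rpow_pos_le (h0 : 0 < σ) (h1 : σ ≤ 1 / 2) {w : ℝ} (hw : 1 - σ ≤ w)
    (hN : (N : ℝ) ≤ 5 * x) (hx : 0 < x) :
    ∑ k ∈ Ioc 0 N, Λ k / k * (k : ℝ) ^ (2 - 2 * w) ≤ 120 * x ^ (2 * σ) / σ := by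
  have h := sum_vonMangoldt_rpow_top_le (S := Ioc 0 N) (μ := 2 * σ) (X := N) (by linarith)
    (by linarith) fun n hn => ⟨(mem_Ioc.1 hn).1, by exact_mod_cast (mem_Ioc.1 hn).2⟩
  have hN5 : (N : ℝ) ^ (2 * σ) ≤ 5 * x ^ (2 * σ) := by
    calc (N : ℝ) ^ (2 * σ) ≤ (5 * x) ^ (2 * σ) := by gcongr
      _ = 5 ^ (2 * σ) * x ^ (2 * σ) := Real.mul_rpow (by norm_num) hx.le
      _ ≤ 5 ^ (1 : ℝ) * x ^ (2 * σ) := by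
          gcongr
          · norm_num
          · linarith
      _ = _ := by rw [Real.rpow_one]
  calc ∑ k ∈ Ioc 0 N, Λ k / k * (k : ℝ) ^ (2 - 2 * w)
      ≤ ∑ k ∈ Ioc 0 N, Λ k / k * ((k : ℝ) / N) ^ (2 * σ) * (N : ℝ) ^ (2 * σ) := by
        refine sum_le_sum fun k hk => ?_
        have hk1 : (1 : ℝ) ≤ k := by exact_mod_cast (mem_Ioc.1 hk).1
        have hkN : (k : ℝ) ≤ N := by exact_mod_cast (mem_Ioc.1 hk).2
        have hN0 : (0 : ℝ) < N := by linarith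
        rw [mul_assoc, ← Real.mul_rpow (by positivity) hN0.le, div_mul_cancel₀ _ hN0.ne']
        have : 0 ≤ Λ k / k := div_nonneg ArithmeticFunction.vonMangoldt_nonneg (by linarith)
        gcongr
        linarith
    _ = (∑ k ∈ Ioc 0 N, Λ k / k * ((k : ℝ) / N) ^ (2 * σ)) * (N : ℝ) ^ (2 * σ) := by rw [sum_mul]
    _ ≤ 48 / (2 * σ) * (5 * x ^ (2 * σ)) := by gcongr
    _ = _ := by field_simp; norm_num

lemma exists_norm_tripleSum_le (hκ : 0 < κ) : ∃ C : ℝ, 1 ≤ C ∧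
    ∀ f Λf : ℕ → ℂ, IsHalaszClass κ f Λf → ∀ y N : ℕ, 200 ≤ Real.log y →
    ∀ x h Δ T : ℝ, 200 ≤ Real.log x → 0 < x → 2 ≤ T → T ^ 2 ≤ y → Δ = x / (2 * T) → Δ ≤ h → h ≤ x →
    x + h + Δ ≤ N → (N : ℝ) ≤ 5 * x →
    ∀ α ∈ Set.Ioc 0 (1 / Real.log y), ∀ β ∈ Set.Ioc 0 (1 / Real.log y),
    ∀ σ M : ℝ, σ = β / 2 + 1 / Real.log x →
    (∀ t : ℝ, |t| ≤ T → ‖Fser f (1 + (σ : ℂ) + t * I)‖ ≤ M) →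
    ‖tripleSum f Λf y N (fun n => trap x h Δ n) α β‖ ≤
      x ^ (-α) * (C * x * ((h / x * M + σ ^ (-κ) / T) / σ)) := by
  obtain ⟨C₁, hC₁, h₁⟩ := exists_norm_fser_le hκ
  set E := Real.exp (2 * κ * (18 + powConst 1)) with hE
  have hE1 : 1 ≤ E := Real.one_le_exp (by have := powConst_nonneg (zero_le_one' ℝ); positivity)
  refine ⟨1 + 432 * E * C₁ * (3888000 * κ ^ 2) * 9, by
    have : 0 ≤ 432 * E * C₁ * (3888000 * κ ^ 2) * 9 := by positivity
    linarith, fun f Λf hf y N hy x h Δ T hL hx hT hTy hΔ hΔh hhx hN hN5 α hα β hβ σ M hσ hM => ?_⟩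
  have hy0 : 0 < Real.log y := by linarith
  have hL0 : 0 < Real.log x := by linarith
  have hηs : 1 / Real.log y ≤ 1 / 200 := one_div_le_one_div_of_le (by norm_num) hy
  have hLs : 1 / Real.log x ≤ 1 / 200 := one_div_le_one_div_of_le (by norm_num) hL
  have hL1 : 0 < 1 / Real.log x := by positivity
  have hσ0 : 0 < σ := by rw [hσ]; linarith [hβ.1]
  have hσ1 : σ ≤ 1 / 2 := by rw [hσ]; linarith [hβ.2]
  set c := 1 + σ - (α + β) with hc
  have hc1 : 1 / 2 ≤ c := by rw [hc]; linarith [hα.2, hβ.2]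
  have hc2 : c ≤ 2 := by rw [hc]; linarith [hα.1, hβ.1]
  have hT0 : 0 < T := by linarith
  have hΔ0 : 0 < Δ := by rw [hΔ]; positivity
  have hh0 : 0 < h := hΔ0.trans_le hΔh
  have hΔx : Δ < x := by
    rw [hΔ, div_lt_iff₀ (by positivity)]
    nlinarith
  have hre : ∀ t : ℝ, (1 + (σ : ℂ) + t * I).re = 1 + σ := fun t => by simp
  have hgE : ∀ t : ℝ, ‖LSeries (smoothTwist y f (α + β)) (1 + (σ : ℂ) + t * I)‖ ≤
      E * ‖Fser f (1 + (σ : ℂ) + t * I)‖ := fun t =>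
    hf.norm_lseries_smoothTwist_le hκ hy (by linarith [hα.1, hβ.1])
      (by rw [show 2 / Real.log y = 1 / Real.log y + 1 / Real.log y by ring]
          linarith [hα.2, hβ.2]) (by rw [hre]; linarith)
  have hB : ∀ t : ℝ, ‖LSeries (smoothTwist y f (α + β)) (1 + (σ : ℂ) + t * I)‖ ≤
      E * C₁ * σ ^ (-κ) := fun t => by
    refine (hgE t).trans ?_
    rw [mul_assoc]
    have := h₁ f Λf hf (1 + (σ : ℂ) + t * I) (by rw [hre]; linarith) (by rw [hre]; linarith)
    rw [hre, add_sub_cancel_left] at this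
    gcongr
  have hM0 : 0 ≤ M := (norm_nonneg _).trans (hM 0 (by simpa using hT0.le))
  have hM' : ∀ t : ℝ, |t| ≤ T →
      ‖LSeries (smoothTwist y f (α + β)) (1 + (σ : ℂ) + t * I)‖ ≤ E * C₁ * M := fun t ht => by
    refine (hgE t).trans ?_
    rw [mul_assoc]
    have := hM t ht
    have h2 : M ≤ C₁ * M := le_mul_of_one_le_left hM0 hC₁
    gcongr
    linarith
  set D := 432 * x ^ c * (h / x * (E * C₁ * M) + E * C₁ * σ ^ (-κ) / T) with hD
  have hD0 : 0 ≤ D := by positivity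
  have hpt := trapHat_mul_le hc1 hc2 hT hΔ hΔh hhx hx (fun _ => norm_nonneg _) hM' hB
  obtain ⟨iA, jA⟩ := hf.integral_norm_bigPoly_sq_le (N := N) hκ hT hTy (α + c)
  obtain ⟨iB, jB⟩ := hf.integral_norm_bigPoly_sq_le (N := N) hκ hT hTy (1 + σ)
  have hsA := sum_vonMangoldt_rpow_pos_le (N := N) (w := α + c) hσ0 hσ1
    (by rw [hc, hσ]; linarith) hN5 hx
  have hsB := sum_vonMangoldt_rpow_neg_le (N := N) hσ0 hσ1
  set A := bigPoly y Λf N (α + c) with hA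
  set B := bigPoly y Λf N (1 + σ) with hBdef
  set P := poissonKer T with hP
  have hxσ : 0 < x ^ σ := by positivity
  have hrep := hf.tripleSum_eq_integral (y := y) hκ (c := c) (α := α) (β := β) (by linarith) hΔ0
    hh0.le hΔx hN hσ0 (by rw [hc]; ring) (by linarith [hα.2, hβ.2])
  have hInt : ‖2 * Real.pi * tripleSum f Λf y N (fun n => trap x h Δ n) α β‖ ≤
      ∫ t, D / 2 * ((x ^ σ)⁻¹ * (‖A t‖ ^ 2 * P t) + x ^ σ * (‖B t‖ ^ 2 * P t)) := by
    rw [hrep]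
    refine norm_integral_le_of_norm_le (((iA.const_mul _).add (iB.const_mul _)).const_mul _)
      (.of_forall fun t => ?_)
    have hPt : 0 ≤ P t := (poissonKer_pos T t).le
    have hamgm : 2 * (‖A t‖ * ‖B t‖) ≤ (x ^ σ)⁻¹ * ‖A t‖ ^ 2 + x ^ σ * ‖B t‖ ^ 2 := by
      have h1 : (x ^ σ)⁻¹ * ‖A t‖ ^ 2 + x ^ σ * ‖B t‖ ^ 2 - 2 * (‖A t‖ * ‖B t‖) =
          (x ^ σ)⁻¹ * (‖A t‖ - x ^ σ * ‖B t‖) ^ 2 := by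
        field_simp
        ring
      have h2 : 0 ≤ (x ^ σ)⁻¹ * (‖A t‖ - x ^ σ * ‖B t‖) ^ 2 := by positivity
      linarith
    rw [norm_mul, norm_mul, norm_mul]
    calc _ = (‖trapHat x h Δ ((c : ℂ) + t * I)‖ *
          ‖LSeries (smoothTwist y f (α + β)) (1 + (σ : ℂ) + t * I)‖) * (‖A t‖ * ‖B t‖) := by ring
      _ ≤ D * P t * (‖A t‖ * ‖B t‖) := by
          exact mul_le_mul_of_nonneg_right (hpt t) (by positivity)
      _ = D * P t / 2 * (2 * (‖A t‖ * ‖B t‖)) := by ring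
      _ ≤ D * P t / 2 * ((x ^ σ)⁻¹ * ‖A t‖ ^ 2 + x ^ σ * ‖B t‖ ^ 2) := by gcongr
      _ = _ := by ring
  rw [integral_const_mul, integral_add (iA.const_mul _) (iB.const_mul _), integral_const_mul,
    integral_const_mul, norm_mul, norm_mul, Complex.norm_real, Real.norm_of_nonneg Real.pi_pos.le,
    Complex.norm_ofNat] at hInt
  have hpi := Real.pi_pos
  have hfin : 2 * Real.pi * ‖tripleSum f Λf y N (fun n => trap x h Δ n) α β‖ ≤
      2 * Real.pi * (3888000 * κ ^ 2 * D * x ^ σ / σ) := by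
    refine hInt.trans ?_
    calc _ ≤ D / 2 * ((x ^ σ)⁻¹ * (108000 * Real.pi * (κ ^ 2 * (120 * x ^ (2 * σ) / σ))) +
          x ^ σ * (108000 * Real.pi * (κ ^ 2 * (24 / σ)))) := by
          gcongr
          · exact jA.trans (by gcongr)
          · exact jB.trans (by gcongr)
      _ = _ := by
          rw [two_mul, Real.rpow_add hx]
          field_simp
          ring
  have hfin' := le_of_mul_le_mul_left hfin (by positivity)
  have hexp : x ^ c * x ^ σ ≤ 9 * (x * x ^ (-α)) := by
    have h1 : c + σ = 1 + -α + 2 * (1 / Real.log x) := by rw [hc, hσ]; ring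
    have h2 : x ^ (2 * (1 / Real.log x)) = Real.exp 1 ^ 2 := by
      rw [Real.rpow_def_of_pos hx, ← Real.exp_nat_mul]
      congr 1
      field_simp
      norm_num
    rw [← Real.rpow_add hx, h1, Real.rpow_add hx, Real.rpow_add hx, Real.rpow_one, h2, mul_comm]
    gcongr
    nlinarith [Real.exp_one_lt_d9, Real.exp_pos 1]
  refine hfin'.trans ?_
  have hW : 0 ≤ (h / x * M + σ ^ (-κ) / T) / σ := by positivity
  calc 3888000 * κ ^ 2 * D * x ^ σ / σ
      = 432 * E * C₁ * (3888000 * κ ^ 2) * (x ^ c * x ^ σ) *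
        ((h / x * M + σ ^ (-κ) / T) / σ) := by
        rw [hD]; ring
    _ ≤ 432 * E * C₁ * (3888000 * κ ^ 2) * (9 * (x * x ^ (-α))) *
        ((h / x * M + σ ^ (-κ) / T) / σ) := by gcongr
    _ = x ^ (-α) * (432 * E * C₁ * (3888000 * κ ^ 2) * 9 * x *
        ((h / x * M + σ ^ (-κ) / T) / σ)) := by ring
    _ ≤ _ := by
        gcongr
        linarith

end MainTerm

section Assembly

variable {κ : ℝ} {f Λf : ℕ → ℂ}

/-- The supremum of `|F(1 + σ + it)|` over `|t| ≤ T`. -/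
def vertSup (f : ℕ → ℂ) (T σ : ℝ) : ℝ :=
  ⨆ t : {t : ℝ // |t| ≤ T}, ‖Fser f (1 + (σ : ℂ) + ((t : ℝ) : ℂ) * Complex.I)‖

lemma vertSup_nonneg (f : ℕ → ℂ) (T σ : ℝ) : 0 ≤ vertSup f T σ :=
  Real.iSup_nonneg fun _ => norm_nonneg _

lemma _root_.IsHalaszClass.norm_fser_le_vertSup (hf : IsHalaszClass κ f Λf) (hκ : 0 < κ) {T σ t : ℝ}
    (hσ : 0 < σ) (hσ1 : σ ≤ 1) (ht : |t| ≤ T) :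
    ‖Fser f (1 + (σ : ℂ) + t * I)‖ ≤ vertSup f T σ := by
  obtain ⟨C, -, hC⟩ := exists_norm_fser_le hκ
  refine le_ciSup (f := fun t : {t : ℝ // |t| ≤ T} =>
    ‖Fser f (1 + (σ : ℂ) + ((t : ℝ) : ℂ) * Complex.I)‖) ⟨C * σ ^ (-κ), ?_⟩ ⟨t, ht⟩
  rintro _ ⟨u, rfl⟩
  have := hC f Λf hf (1 + (σ : ℂ) + ((u : ℝ) : ℂ) * Complex.I) (by simpa using hσ)
    (by simp; linarith)
  simpa using this

lemma _root_.IsHalaszClass.continuousOn_vertSup (hf : IsHalaszClass κ f Λf) (hκ : 0 < κ) (T : ℝ) :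
    ContinuousOn (vertSup f T) (Set.Ioi 0) := by
  rw [continuousOn_iff_continuous_domRestrict]
  have hc : Continuous (Function.HasUncurry.uncurry fun (σ : Set.Ioi (0 : ℝ)) (t : ℝ) =>
      ‖Fser f (1 + ((σ : ℝ) : ℂ) + (t : ℂ) * Complex.I)‖) := by
    refine ((hf.continuousOn_fser hκ).comp_continuous (f := fun p : Set.Ioi (0 : ℝ) × ℝ =>
      1 + ((p.1 : ℝ) : ℂ) + (p.2 : ℂ) * Complex.I) (by fun_prop) fun p => ?_).norm
    have : (0 : ℝ) < p.1 := p.1.2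
    simpa using this
  have := (isCompact_Icc (a := -T) (b := T)).continuous_sSup hc
  convert this using 2 with σ
  rw [sSup_image', Set.domRestrict_apply, vertSup]
  refine (Equiv.subtypeEquivRight fun t => ?_).iSup_congr fun t => rfl
  rw [Set.mem_Icc, abs_le]

lemma integral_comp_half_add_le {S : ℝ → ℝ} {r T A B η : ℝ} (hκ : 0 < κ) (hr : 0 < r)
    (hS : ContinuousOn S (Set.Ioi 0)) (hS0 : ∀ σ, 0 ≤ S σ) (hT : 0 < T) (hA : 0 ≤ A) (hB : 0 ≤ B)
    (hη : 0 ≤ η) (hηr : η / 2 + r ≤ 1) :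
    IntervalIntegrable (fun β => A * ((B * S (β / 2 + r) + (β / 2 + r) ^ (-κ) / T) / (β / 2 + r)))
      volume 0 η ∧
    ∫ β in (0 : ℝ)..η, A * ((B * S (β / 2 + r) + (β / 2 + r) ^ (-κ) / T) / (β / 2 + r)) ≤
      2 * A * (B * (∫ σ in r..1, S σ / σ) + r ^ (-κ) / (κ * T)) := by
  set g : ℝ → ℝ := fun σ => A * ((B * S σ + σ ^ (-κ) / T) / σ) with hg
  have hid : ContinuousOn (fun σ : ℝ => σ) (Set.Ioi 0) := continuousOn_id
  have hpow : ContinuousOn (fun σ : ℝ => σ ^ (-κ)) (Set.Ioi 0) :=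
    hid.rpow_const fun σ hσ => Or.inl (ne_of_gt hσ)
  have hgc : ContinuousOn g (Set.Ioi 0) := by
    refine continuousOn_const.mul (((continuousOn_const.mul hS).add (hpow.div_const T)).div hid
      fun σ hσ => ne_of_gt hσ)
  have hsub : ∀ {b : ℝ}, r ≤ b → Set.uIcc r b ⊆ Set.Ioi 0 := fun hb σ hσ => by
    rw [Set.uIcc_of_le hb] at hσ
    exact hr.trans_le hσ.1
  refine ⟨?_, ?_⟩
  · refine ContinuousOn.intervalIntegrable ?_
    refine hgc.comp (f := fun β : ℝ => β / 2 + r) (by fun_prop) fun β hβ => ?_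
    rw [Set.uIcc_of_le hη] at hβ
    have := hβ.1
    simp only [Set.mem_Ioi]
    linarith
  · have h1 : ∫ β in (0 : ℝ)..η, g (β / 2 + r) = 2 * ∫ σ in r..(η / 2 + r), g σ := by
      rw [intervalIntegral.integral_comp_div_add g (by norm_num : (2 : ℝ) ≠ 0) r]
      simp
    have hg0 : ∀ σ ∈ Set.Ioi (0 : ℝ), 0 ≤ g σ := fun σ hσ => by
      have := hS0 σ
      have h' : 0 < σ := hσ
      simp only [hg]
      positivity
    have hr1 : r ≤ 1 := by linarith
    have h2 : ∫ σ in r..(η / 2 + r), g σ ≤ ∫ σ in r..1, g σ := by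
      refine intervalIntegral.integral_mono_interval le_rfl (by linarith) hηr ?_
        (hgc.mono (hsub hr1)).intervalIntegrable
      rw [Filter.EventuallyLE, ae_restrict_iff' measurableSet_Ioc]
      exact Filter.Eventually.of_forall fun σ hσ => hg0 σ (hr.trans hσ.1)
    have hi1 : IntervalIntegrable (fun σ => S σ / σ) volume r 1 :=
      ((hS.div hid fun σ hσ => ne_of_gt hσ).mono (hsub hr1)).intervalIntegrable
    have hi2 : IntervalIntegrable (fun σ : ℝ => σ ^ (-κ - 1)) volume r 1 :=
      ((hid.rpow_const fun σ hσ => Or.inl (ne_of_gt hσ)).mono (hsub hr1)).intervalIntegrable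
    have h3 : ∫ σ in r..1, g σ =
        A * (B * (∫ σ in r..1, S σ / σ) + 1 / T * ∫ σ in r..1, σ ^ (-κ - 1)) := by
      rw [← intervalIntegral.integral_const_mul, ← intervalIntegral.integral_const_mul,
        ← intervalIntegral.integral_add (hi1.const_mul _) (hi2.const_mul _),
        ← intervalIntegral.integral_const_mul]
      refine intervalIntegral.integral_congr fun σ hσ => ?_
      have hσ0 : 0 < σ := hsub hr1 hσ
      simp only [hg]
      rw [Real.rpow_sub_one hσ0.ne']
      field_simp
    have h4 : ∫ σ in r..1, σ ^ (-κ - 1) ≤ r ^ (-κ) / κ := by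
      rw [integral_rpow (Or.inr ⟨by linarith, fun h => lt_irrefl (0 : ℝ) (hsub hr1 h)⟩)]
      have e : -κ - 1 + 1 = -κ := by ring
      rw [e, Real.one_rpow, div_neg, ← neg_div, neg_sub]
      gcongr
      linarith
    rw [h1]
    calc 2 * ∫ σ in r..(η / 2 + r), g σ ≤ 2 * (A * (B * (∫ σ in r..1, S σ / σ) +
          1 / T * (r ^ (-κ) / κ))) := by
          rw [h3] at h2
          refine mul_le_mul_of_nonneg_left (h2.trans ?_) (by norm_num)
          gcongr
      _ = _ := by field_simp

lemma norm_sum_sub_sum_trap_le (f : ℕ → ℂ) {x h Δ : ℝ} {N l : ℕ} (hΔ : 0 < Δ) (hh : 0 ≤ h)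
    (hx : Δ ≤ x) (hN : x + h + Δ ≤ N) (hl : Δ + 1 ≤ l) :
    ‖∑ n ∈ Ioc ⌊x⌋₊ ⌊x + h⌋₊, f n - ∑ n ∈ Ioc 0 N, (trap x h Δ n : ℂ) * f n‖ ≤
      ∑ n ∈ Ioc ⌊x - Δ⌋₊ (⌊x - Δ⌋₊ + l), ‖f n‖ + ∑ n ∈ Ioc ⌊x + h⌋₊ (⌊x + h⌋₊ + l), ‖f n‖ := by
  set a := ⌊x - Δ⌋₊ with ha
  set b := ⌊x + h⌋₊ with hb
  have hx0 : 0 < x := hΔ.trans_le hx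
  have hbN : b ≤ N := by
    have : (b : ℝ) ≤ x + h := Nat.floor_le (by linarith)
    exact_mod_cast (by linarith : (b : ℝ) ≤ N)
  have hsub : ∑ n ∈ Ioc ⌊x⌋₊ b, f n = ∑ n ∈ Ioc 0 N, if n ∈ Ioc ⌊x⌋₊ b then f n else 0 := by
    rw [← sum_filter]
    refine sum_congr ?_ fun _ _ => rfl
    ext n
    simp only [mem_filter, mem_Ioc]
    omega
  have hpt : ∀ n ∈ Ioc 0 N, ‖(if n ∈ Ioc ⌊x⌋₊ b then f n else 0) - (trap x h Δ n : ℂ) * f n‖ ≤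
      (if n ∈ Ioc a (a + l) then ‖f n‖ else 0) + (if n ∈ Ioc b (b + l) then ‖f n‖ else 0) := by
    intro n hn
    have hp1 : (0 : ℝ) ≤ if n ∈ Ioc a (a + l) then ‖f n‖ else 0 := by
      split_ifs
      · exact norm_nonneg _
      · exact le_rfl
    have hp2 : (0 : ℝ) ≤ if n ∈ Ioc b (b + l) then ‖f n‖ else 0 := by
      split_ifs
      · exact norm_nonneg _
      · exact le_rfl
    have htr : ‖(trap x h Δ n : ℂ) * f n‖ ≤ ‖f n‖ := by
      rw [norm_mul, Complex.norm_real, Real.norm_of_nonneg (trap_nonneg hΔ hh _)]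
      exact mul_le_of_le_one_left (norm_nonneg _) (trap_le_one hΔ hh _)
    have ha1 : (a : ℝ) ≤ x - Δ := Nat.floor_le (by linarith)
    have ha2 : x - Δ < a + 1 := Nat.lt_floor_add_one _
    have hb1 : (b : ℝ) ≤ x + h := Nat.floor_le (by linarith)
    have hb2 : x + h < b + 1 := Nat.lt_floor_add_one _
    rcases le_or_gt (n : ℝ) x with h1 | h1
    · rw [if_neg (fun h' => absurd (mem_Ioc.1 h').1 (not_lt.2 (Nat.le_floor h1))), zero_sub,
        norm_neg]
      rcases le_or_gt (n : ℝ) (x - Δ) with h2 | h2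
      · rw [trap_eq_zero_of_le hΔ hh h2, Complex.ofReal_zero, zero_mul, norm_zero]
        positivity
      · have : n ∈ Ioc a (a + l) := by
          rw [mem_Ioc]
          refine ⟨by exact_mod_cast ha1.trans_lt h2, ?_⟩
          have : (n : ℝ) ≤ ((a + l : ℕ) : ℝ) := by push_cast; linarith
          exact_mod_cast this
        rw [if_pos this]
        linarith
    · rcases le_or_gt (n : ℝ) (x + h) with h2 | h2
      · rw [if_pos (mem_Ioc.2 ⟨(Nat.floor_lt hx0.le).2 h1, Nat.le_floor h2⟩),
          trap_eq_one hΔ h1.le h2, Complex.ofReal_one, one_mul, sub_self, norm_zero]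
        positivity
      · rw [if_neg (fun h' => absurd (mem_Ioc.1 h').2
          (not_le.2 ((Nat.floor_lt (by linarith)).2 h2))), zero_sub, norm_neg]
        rcases le_or_gt (x + h + Δ) (n : ℝ) with h3 | h3
        · rw [trap_eq_zero_of_ge hΔ hh h3, Complex.ofReal_zero, zero_mul, norm_zero]
          positivity
        · have : n ∈ Ioc b (b + l) := by
            rw [mem_Ioc]
            refine ⟨by exact_mod_cast hb1.trans_lt h2, ?_⟩
            have : (n : ℝ) ≤ ((b + l : ℕ) : ℝ) := by push_cast; linarith
            exact_mod_cast this
          rw [if_pos this]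
          linarith
  rw [hsub, ← sum_sub_distrib]
  refine (norm_sum_le _ _).trans ((sum_le_sum hpt).trans ?_)
  rw [sum_add_distrib, ← sum_filter, ← sum_filter]
  refine add_le_add ?_ ?_ <;>
  exact sum_le_sum_of_subset_of_nonneg (fun n hn => (mem_filter.1 hn).2) fun n _ _ => norm_nonneg _

end Assembly

section ShortInterval

variable {κ : ℝ}

lemma exists_nat_log_le {u c : ℝ} (hu : 1 ≤ u) (hc : 0 ≤ c) :
    ∃ y : ℕ, 200 ≤ Real.log y ∧ u ^ c ≤ y ∧ Real.log y ≤ 201 + c * Real.log u := by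
  have h1 : 1 ≤ u ^ c := Real.one_le_rpow hu hc
  have h2 : 1 ≤ Real.exp 200 := Real.one_le_exp (by norm_num)
  set v := Real.exp 200 * u ^ c with hv
  have hv1 : 1 ≤ v := one_le_mul_of_one_le_of_one_le h2 h1
  have hle : v ≤ ⌈v⌉₊ := Nat.le_ceil v
  have hlt : (⌈v⌉₊ : ℝ) < v + 1 := Nat.ceil_lt_add_one (by linarith)
  refine ⟨⌈v⌉₊, ?_, ?_, ?_⟩
  · rw [Real.le_log_iff_exp_le (by linarith)]
    exact (le_mul_of_one_le_right (by positivity) h1).trans hle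
  · exact (le_mul_of_one_le_left (by positivity) h2).trans hle
  · have h3 : (⌈v⌉₊ : ℝ) ≤ Real.exp 1 * v := by
      have := Real.add_one_le_exp (1 : ℝ)
      nlinarith
    have h4 := Real.log_le_log (by linarith) h3
    rw [Real.log_mul (by positivity) (by positivity), Real.log_exp, hv,
      Real.log_mul (by positivity) (by positivity), Real.log_exp,
      Real.log_rpow (by linarith)] at h4
    linarith

lemma exists_forall_ge_large (κ : ℝ) (Y : ℕ) : ∃ X : ℝ, 1 ≤ X ∧ ∀ x : ℝ, X ≤ x →
    4 ≤ x ∧ (2 * Y : ℝ) ≤ x ∧ 200 ≤ Real.log x ∧ (0 < κ → 4 ≤ Real.log x ^ κ) ∧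
    2 * Real.log x ^ κ ≤ x ^ (1 / 4 : ℝ) := by
  have h1 : ∀ᶠ x : ℝ in Filter.atTop, 0 < κ → 4 ≤ Real.log x ^ κ := by
    by_cases hκ : 0 < κ
    · filter_upwards [((tendsto_rpow_atTop hκ).comp Real.tendsto_log_atTop).eventually_ge_atTop 4]
        with x hx _ using hx
    · exact Filter.Eventually.of_forall fun x h => absurd h hκ
  have h2 : ∀ᶠ x : ℝ in Filter.atTop, 2 * Real.log x ^ κ ≤ x ^ (1 / 4 : ℝ) := by
    have := (isLittleO_log_rpow_rpow_atTop κ (by norm_num : (0 : ℝ) < 1 / 4)).def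
      (by norm_num : (0 : ℝ) < 1 / 2)
    filter_upwards [this, Filter.eventually_ge_atTop 1] with x hx hx1
    rw [Real.norm_of_nonneg (Real.rpow_nonneg (Real.log_nonneg hx1) _),
      Real.norm_of_nonneg (by positivity)] at hx
    linarith
  obtain ⟨X, hX⟩ := Filter.eventually_atTop.1 ((Filter.eventually_ge_atTop (4 : ℝ)).and
    ((Filter.eventually_ge_atTop (2 * Y : ℝ)).and
      ((Real.tendsto_log_atTop.eventually_ge_atTop 200).and (h1.and h2))))
  exact ⟨max X 1, le_max_right _ _, fun x hx => hX x ((le_max_left _ _).trans hx)⟩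

lemma half_log_le_log {x a : ℝ} (hx : 4 ≤ x) (ha : x / 2 ≤ a) : Real.log x / 2 ≤ Real.log a := by
  have h1 : Real.log x ≤ Real.log (a ^ 2) := Real.log_le_log (by linarith) (by nlinarith)
  rw [Real.log_pow] at h1
  push_cast at h1
  linarith

lemma exists_norm_sum_edge_le (hκ : 0 < κ) : ∃ C : ℝ, 1 ≤ C ∧ ∃ X : ℕ,
    ∀ f Λf : ℕ → ℂ, IsHalaszClass κ f Λf → ∀ x Δ : ℝ, 4 ≤ x → 1 ≤ Real.log x →
    2 * x ^ (1 / 2 : ℝ) ≤ Δ → Δ ≤ x → ∀ a l : ℕ, X ≤ a → x / 2 ≤ a → a ≤ 2 * x → Δ + 1 ≤ l →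
    l ≤ Δ + 2 → ∑ n ∈ Ioc a (a + l), ‖f n‖ ≤ C * (Δ / Real.log x) * Real.log x ^ κ := by
  obtain ⟨C, hC, X, -, h⟩ := exists_sum_norm_Ioc_le hκ
  refine ⟨4 * C * 2 ^ κ, ?_, X, fun f Λf hf x Δ hx hlx hΔ hΔx a l hXa hxa hax hl hl2 => ?_⟩
  · have := Real.one_le_rpow (by norm_num : (1 : ℝ) ≤ 2) hκ.le
    nlinarith
  have ha0 : (0 : ℝ) < a := by linarith
  have hx1 : 1 ≤ x ^ (1 / 2 : ℝ) := Real.one_le_rpow (by linarith) (by norm_num)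
  have h25 : (a : ℝ) ^ (2 / 5 : ℝ) ≤ l := by
    calc (a : ℝ) ^ (2 / 5 : ℝ) ≤ (2 * x) ^ (2 / 5 : ℝ) := by gcongr
      _ = 2 ^ (2 / 5 : ℝ) * x ^ (2 / 5 : ℝ) := Real.mul_rpow (by norm_num) (by linarith)
      _ ≤ 2 ^ (1 : ℝ) * x ^ (1 / 2 : ℝ) := by
          refine mul_le_mul (Real.rpow_le_rpow_of_exponent_le (by norm_num) (by norm_num))
            (Real.rpow_le_rpow_of_exponent_le (by linarith) (by norm_num)) (by positivity)
            (by positivity)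
      _ ≤ l := by rw [Real.rpow_one]; linarith
  have hl100 : l ≤ 100 * a := by
    have : (l : ℝ) ≤ 100 * a := by linarith
    exact_mod_cast this
  have hla : Real.log x / 2 ≤ Real.log a := half_log_le_log hx hxa
  have hla2 : Real.log a ≤ 2 * Real.log x := by
    have h1 : Real.log a ≤ Real.log (x ^ 2) := Real.log_le_log ha0 (by nlinarith)
    rw [Real.log_pow] at h1
    exact_mod_cast h1
  calc ∑ n ∈ Ioc a (a + l), ‖f n‖ ≤ C * (l / Real.log a) * Real.log a ^ κ :=
        h f Λf hf a l hXa h25 hl100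
    _ ≤ C * ((2 * Δ) / (Real.log x / 2)) * (2 * Real.log x) ^ κ := by
        have h1 : 0 ≤ Real.log a := by linarith
        have h2 : 0 < Δ := by linarith
        gcongr
        linarith
    _ = _ := by
        rw [Real.mul_rpow (by norm_num) (by linarith)]
        field_simp
        ring

end ShortInterval

section Main

variable {κ : ℝ}

set_option maxHeartbeats 1000000 in
lemma exists_norm_sum_trap_le (hκ : 0 < κ) : ∃ C : ℝ, 1 ≤ C ∧ ∃ X : ℕ,
    ∀ f Λf : ℕ → ℂ, IsHalaszClass κ f Λf → ∀ x h Δ T W : ℝ, ∀ y N : ℕ, 4 ≤ x → (2 * X : ℝ) + 2 ≤ x / 2 →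
    200 ≤ Real.log x → 200 ≤ Real.log y → Real.log y ≤ W → 2 ≤ T → T ^ 2 ≤ y → Δ = x / (2 * T) →
    1 ≤ Δ → 4 * Δ ≤ h → h ≤ x → x ^ (3 / 4 : ℝ) ≤ h → x + h + Δ ≤ N → (N : ℝ) ≤ x + h + Δ + 1 →
    ‖∑ n ∈ Ioc 0 N, (trap x h Δ n : ℂ) * f n‖ ≤ C * (h / Real.log x) * W ^ κ +
      C * x * (h / x * (∫ σ in (1 / Real.log x)..1, vertSup f T σ / σ) + Real.log x ^ κ / T) *
        (1 / Real.log x) := by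
  obtain ⟨C₁, hC₁, X, hX, h₁⟩ := exists_norm_sum_le_of_tripleSum_le hκ
  obtain ⟨C₂, hC₂, h₂⟩ := exists_norm_tripleSum_le hκ
  refine ⟨6 * C₁ + 2 * C₂ * (1 + 1 / κ), ?_, X,
    fun f Λf hf x h Δ T W y N hx hXx hlx hly hyW hT hTy hΔ hΔ1 hΔh hhx hh hN hN2 => ?_⟩
  · have : 0 < 1 / κ := by positivity
    nlinarith
  set a := ⌊x - Δ⌋₊ with ha
  set L := ⌊x + h + Δ⌋₊ - a with hL
  have hx0 : 0 < x := by linarith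
  have ha1 : (a : ℝ) ≤ x - Δ := Nat.floor_le (by linarith)
  have ha2 : x - Δ < a + 1 := Nat.lt_floor_add_one _
  have hb1 : (⌊x + h + Δ⌋₊ : ℝ) ≤ x + h + Δ := Nat.floor_le (by linarith)
  have hb2 : x + h + Δ < ⌊x + h + Δ⌋₊ + 1 := Nat.lt_floor_add_one _
  have hab : a ≤ ⌊x + h + Δ⌋₊ := Nat.floor_mono (by linarith)
  have haL : a + L = ⌊x + h + Δ⌋₊ := by omega
  have haLr : (a : ℝ) + L = ⌊x + h + Δ⌋₊ := by exact_mod_cast haL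
  have hax : x / 2 ≤ a := by linarith
  have hxa : x ≤ 2 * a := by linarith
  have hLh : (L : ℝ) ≤ 2 * h := by linarith
  have hlog : Real.log x / 2 ≤ Real.log a := half_log_le_log hx hax
  set η := 1 / Real.log y with hη
  have hη0 : 0 < η := by positivity
  have hη1 : η ≤ 1 / 200 := by rw [hη]; gcongr
  have hr1 : 1 / Real.log x ≤ 1 / 200 := by gcongr
  have hr0 : 0 < 1 / Real.log x := by positivity
  obtain ⟨hi, hle⟩ := integral_comp_half_add_le (S := vertSup f T) (r := 1 / Real.log x) (T := T)
    (A := C₂ * x) (B := h / x) (η := η) hκ hr0 (hf.continuousOn_vertSup hκ T) (vertSup_nonneg f T)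
    (by linarith) (by positivity) (div_nonneg (by linarith) hx0.le) hη0.le (by linarith)
  have hh0 : 0 < h := by linarith
  have hΔ0 : 0 < Δ := by linarith
  have hmain := h₁ f Λf hf y hly a L N (by
      have : (X : ℝ) ≤ a := by linarith [(Nat.cast_nonneg X : (0 : ℝ) ≤ X)]
      exact_mod_cast this) (by
      calc (a : ℝ) ^ (3 / 4 : ℝ) ≤ x ^ (3 / 4 : ℝ) := by gcongr; linarith
        _ ≤ L := by linarith) (by
      have : (L : ℝ) ≤ 4 * a := by linarith
      exact_mod_cast this) (by
      rw [haL]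
      exact_mod_cast hb1.trans hN) (fun n => trap x h Δ n)
    (fun n => trap_nonneg hΔ0 hh0.le _) (fun n => trap_le_one hΔ0 hh0.le _) (fun n hn => by
      constructor
      · by_contra hna
        refine hn (trap_eq_zero_of_le hΔ0 hh0.le (le_trans ?_ ha1))
        exact_mod_cast not_lt.1 hna
      · rw [haL]
        refine Nat.le_floor (le_of_lt ?_)
        by_contra hna
        exact hn (trap_eq_zero_of_ge hΔ0 hh0.le (not_lt.1 hna))) x (by linarith) hxa _ hi
    (fun α hα β hβ => by
      refine h₂ f Λf hf y N hly x h Δ T hlx hx0 hT hTy hΔ (by linarith) hhx hN (by linarith) α hα β hβ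
        _ _ rfl fun t ht => hf.norm_fser_le_vertSup hκ (by linarith [hβ.1]) (by linarith [hβ.2]) ht)
  set J := ∫ σ in (1 / Real.log x)..1, vertSup f T σ / σ with hJ
  have hJ0 : 0 ≤ J := intervalIntegral.integral_nonneg (by linarith) fun σ hσ =>
    div_nonneg (vertSup_nonneg f T σ) (hr0.le.trans hσ.1)
  have hW0 : 0 < Real.log y := by linarith
  have hWκ : Real.log y ^ κ ≤ W ^ κ := by gcongr
  have hlx0 : 0 < Real.log x := by linarith
  have hpow : (1 / Real.log x) ^ (-κ) = Real.log x ^ κ := by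
    rw [one_div, Real.inv_rpow hlx0.le, Real.rpow_neg hlx0.le, inv_inv]
  rw [hpow] at hle
  have hT0 : 0 < T := by linarith
  have hκi : 0 < 1 / κ := by positivity
  have hle2 : 2 * (C₂ * x) * (h / x * J + Real.log x ^ κ / (κ * T)) ≤
      (6 * C₁ + 2 * C₂ * (1 + 1 / κ)) * x * (h / x * J + Real.log x ^ κ / T) := by
    have hP : 0 ≤ Real.log x ^ κ / T := by positivity
    have hQ : 0 ≤ h / x * J := by positivity
    have e : Real.log x ^ κ / (κ * T) = 1 / κ * (Real.log x ^ κ / T) := by field_simp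
    rw [e]
    calc 2 * (C₂ * x) * (h / x * J + 1 / κ * (Real.log x ^ κ / T))
        ≤ 2 * (C₂ * x) * ((1 + 1 / κ) * (h / x * J + Real.log x ^ κ / T)) := by
          gcongr
          nlinarith
      _ = (2 * C₂ * (1 + 1 / κ)) * x * (h / x * J + Real.log x ^ κ / T) := by ring
      _ ≤ _ := by
          gcongr
          linarith
  have hW' : 0 ≤ W ^ κ := (Real.rpow_nonneg hW0.le κ).trans hWκ
  calc _ ≤ _ := hmain
    _ ≤ C₁ * (2 * h / (Real.log x / 2)) * W ^ κ + (C₁ * (2 * h) * W ^ κ +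
        (6 * C₁ + 2 * C₂ * (1 + 1 / κ)) * x * (h / x * J + Real.log x ^ κ / T)) *
          (1 / Real.log x) := by
        gcongr
        exact hle.trans hle2
    _ = (6 * C₁) * (h / Real.log x) * W ^ κ +
        (6 * C₁ + 2 * C₂ * (1 + 1 / κ)) * x * (h / x * J + Real.log x ^ κ / T) *
          (1 / Real.log x) := by
        ring
    _ ≤ _ := by
        gcongr
        have : 0 ≤ 2 * C₂ * (1 + 1 / κ) := by positivity
        linarith

set_option maxHeartbeats 1000000 in
lemma exists_norm_sum_short_le (hκ : 0 < κ) : ∃ C : ℝ, 0 < C ∧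
    ∀ f Λf : ℕ → ℂ, IsHalaszClass κ f Λf → ∀ x δ : ℝ, C ≤ x → 0 < δ → δ < 1 / 4 →
    ‖∑ n ∈ Ioc ⌊x⌋₊ ⌊x + x ^ (1 - δ)⌋₊, f n‖ ≤ C * (x ^ (1 - δ) / Real.log x) *
      ((∫ σ in (1 / Real.log x)..1, vertSup f ((1 / 2) * x ^ δ * Real.log x ^ κ) σ / σ) +
        (δ * Real.log x + Real.log (Real.log x)) ^ κ) := by
  obtain ⟨C₁, hC₁, X₁, h₁⟩ := exists_norm_sum_edge_le hκ
  obtain ⟨C₂, hC₂, X₂, h₂⟩ := exists_norm_sum_trap_le hκ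
  obtain ⟨X, hX, hlarge⟩ := exists_forall_ge_large κ (2 * X₁ + 2 * X₂ + 4)
  set D : ℝ := 2 * κ + 203 with hD
  have hD0 : 0 < D := by linarith
  have hDκ : 0 < D ^ κ := by positivity
  refine ⟨X + (2 * C₁ + C₂ * D ^ κ + 3 * C₂), by positivity,
    fun f Λf hf x δ hCx hδ hδ4 => ?_⟩
  obtain ⟨hx4, hXx, hlx, hlκ, hlx4⟩ := hlarge x (by
    have : 0 < 2 * C₁ + C₂ * D ^ κ + 3 * C₂ := by positivity
    linarith)
  replace hlκ := hlκ hκ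
  push_cast at hXx
  have hx0 : 0 < x := by linarith
  have hx1 : 1 ≤ x := by linarith
  have hlx0 : 0 < Real.log x := by linarith
  set h := x ^ (1 - δ) with hh
  set lκ := Real.log x ^ κ with hlκdef
  set T := (1 / 2) * x ^ δ * lκ with hT
  set W := δ * Real.log x + Real.log (Real.log x) with hW
  have hlκ0 : 0 < lκ := by linarith
  have hxδ : 1 ≤ x ^ δ := Real.one_le_rpow hx1 hδ.le
  have hh0 : 0 < h := by positivity
  have hhx : h ≤ x := by
    calc h ≤ x ^ (1 : ℝ) := Real.rpow_le_rpow_of_exponent_le hx1 (by linarith)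
      _ = x := Real.rpow_one x
  have hh34 : x ^ (3 / 4 : ℝ) ≤ h := Real.rpow_le_rpow_of_exponent_le hx1 (by linarith)
  have hT2 : 2 ≤ T := by rw [hT]; nlinarith
  have hhδ : h * x ^ δ = x := by
    rw [hh, ← Real.rpow_add hx0, sub_add_cancel, Real.rpow_one]
  set Δ := x / (2 * T) with hΔ
  have hΔl : Δ * lκ = h := by
    rw [hΔ, hT, div_mul_eq_mul_div, div_eq_iff (by positivity)]
    linear_combination (-lκ) * hhδ
  have hΔ0 : 0 < Δ := by positivity
  have hΔh : 4 * Δ ≤ h := by rw [← hΔl]; nlinarith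
  have hΔx : 2 * x ^ (1 / 2 : ℝ) ≤ Δ := by
    have h3 : x ^ (1 / 2 : ℝ) * x ^ (1 / 4 : ℝ) = x ^ (3 / 4 : ℝ) := by
      rw [← Real.rpow_add hx0]; norm_num
    have h4 : 0 < x ^ (1 / 2 : ℝ) := by positivity
    have h5 : 2 * x ^ (1 / 2 : ℝ) * lκ ≤ Δ * lκ := by
      rw [hΔl]
      refine le_trans ?_ hh34
      rw [← h3]
      nlinarith
    exact le_of_mul_le_mul_right h5 hlκ0
  have hx12 : 1 ≤ x ^ (1 / 2 : ℝ) := Real.one_le_rpow hx1 (by norm_num)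
  have hllx : 1 ≤ Real.log (Real.log x) := by
    rw [Real.le_log_iff_exp_le hlx0]
    linarith [Real.exp_one_lt_d9]
  have hW1 : 1 ≤ W := by
    have : 0 < δ * Real.log x := by positivity
    linarith
  have hu1 : 1 ≤ x ^ δ * Real.log x := one_le_mul_of_one_le_of_one_le hxδ (by linarith)
  obtain ⟨y, hy200, hyT, hyW⟩ := exists_nat_log_le (c := 2 * κ + 2) hu1 (by linarith)
  have hyW' : Real.log y ≤ D * W := by
    rw [Real.log_mul (by positivity) hlx0.ne', Real.log_rpow hx0, ← hW] at hyW
    nlinarith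
  have hTy : T ^ 2 ≤ y := by
    refine le_trans ?_ hyT
    have h3 : T ≤ (x ^ δ * Real.log x) ^ (κ + 1) := by
      rw [Real.mul_rpow (by positivity) hlx0.le, hT]
      have h4 : x ^ δ ≤ (x ^ δ) ^ (κ + 1) := by
        conv_lhs => rw [← Real.rpow_one (x ^ δ)]
        exact Real.rpow_le_rpow_of_exponent_le hxδ (by linarith)
      have h5 : lκ ≤ Real.log x ^ (κ + 1) :=
        Real.rpow_le_rpow_of_exponent_le (by linarith) (by linarith)
      calc 1 / 2 * x ^ δ * lκ ≤ x ^ δ * lκ := by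
            rw [mul_assoc]
            have : 0 < x ^ δ * lκ := by positivity
            linarith
        _ ≤ _ := by gcongr
    calc T ^ 2 ≤ ((x ^ δ * Real.log x) ^ (κ + 1)) ^ 2 := by gcongr
      _ = _ := by
          rw [← Real.rpow_natCast, ← Real.rpow_mul (by linarith)]
          congr 1
          push_cast
          ring
  set N := ⌈x + h + Δ⌉₊ with hN
  have hN1 : x + h + Δ ≤ N := Nat.le_ceil _
  have hN2 : (N : ℝ) ≤ x + h + Δ + 1 := (Nat.ceil_lt_add_one (by linarith)).le
  have hX1 : (0 : ℝ) ≤ X₁ := Nat.cast_nonneg _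
  have hX2 : (0 : ℝ) ≤ X₂ := Nat.cast_nonneg _
  have htrap := h₂ f Λf hf x h Δ T (D * W) y N hx4 (by linarith) hlx hy200 hyW' hT2 hTy hΔ
    (by linarith) hΔh hhx hh34 hN1 hN2
  set l := ⌈Δ⌉₊ + 1 with hl
  have hl1 : Δ + 1 ≤ l := by
    rw [hl]
    push_cast
    linarith [Nat.le_ceil Δ]
  have hl2 : (l : ℝ) ≤ Δ + 2 := by
    rw [hl]
    push_cast
    linarith [Nat.ceil_lt_add_one hΔ0.le]
  have hdiff := norm_sum_sub_sum_trap_le f hΔ0 hh0.le (by linarith : Δ ≤ x) hN1 hl1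
  have ha1 : (⌊x - Δ⌋₊ : ℝ) ≤ x - Δ := Nat.floor_le (by linarith)
  have ha2 : x - Δ < ⌊x - Δ⌋₊ + 1 := Nat.lt_floor_add_one _
  have hb1 : (⌊x + h⌋₊ : ℝ) ≤ x + h := Nat.floor_le (by linarith)
  have hb2 : x + h < ⌊x + h⌋₊ + 1 := Nat.lt_floor_add_one _
  have hE1 := h₁ f Λf hf x Δ hx4 (by linarith) hΔx (by linarith) ⌊x - Δ⌋₊ l (by
    have : (X₁ : ℝ) ≤ (⌊x - Δ⌋₊ : ℝ) := by linarith
    exact_mod_cast this) (by linarith) (by linarith) hl1 hl2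
  have hE2 := h₁ f Λf hf x Δ hx4 (by linarith) hΔx (by linarith) ⌊x + h⌋₊ l (by
    have : (X₁ : ℝ) ≤ (⌊x + h⌋₊ : ℝ) := by linarith
    exact_mod_cast this) (by linarith) (by linarith) hl1 hl2
  have hedge : C₁ * (Δ / Real.log x) * lκ = C₁ * (h / Real.log x) := by
    rw [← hΔl]; ring
  rw [← hlκdef, hedge] at hE1 hE2
  set J := ∫ σ in (1 / Real.log x)..1, vertSup f T σ / σ with hJ
  have hJ0 : 0 ≤ J := by
    have hr1 : 1 / Real.log x ≤ 1 := by rw [div_le_one hlx0]; linarith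
    exact intervalIntegral.integral_nonneg hr1 fun σ hσ =>
      div_nonneg (vertSup_nonneg f T σ) (le_trans (by positivity) hσ.1)
  have hWκ : 1 ≤ W ^ κ := Real.one_le_rpow hW1 hκ.le
  have hterm : C₂ * x * (h / x * J + lκ / T) * (1 / Real.log x) =
      C₂ * (h / Real.log x) * (J + 2) := by
    have e : x * (lκ / T) = 2 * h := by
      rw [← hΔl, hΔ]; field_simp
    have e2 : x * (h / x * J + lκ / T) = h * (J + 2) := by
      rw [mul_add, e]; field_simp
    calc _ = C₂ * (x * (h / x * J + lκ / T)) * (1 / Real.log x) := by ring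
      _ = _ := by rw [e2]; ring
  rw [← hlκdef, hterm, Real.mul_rpow hD0.le (by linarith)] at htrap
  set R := h / Real.log x with hR
  have hR0 : 0 < R := by positivity
  have htri := norm_le_norm_sub_add (∑ n ∈ Ioc ⌊x⌋₊ ⌊x + h⌋₊, f n)
    (∑ n ∈ Ioc 0 N, (trap x h Δ n : ℂ) * f n)
  calc ‖∑ n ∈ Ioc ⌊x⌋₊ ⌊x + h⌋₊, f n‖
      ≤ C₁ * R + C₁ * R + (C₂ * R * (D ^ κ * W ^ κ) + C₂ * R * (J + 2)) := by linarith
    _ = R * (2 * C₁ * 1 + C₂ * D ^ κ * W ^ κ + (C₂ * J + 2 * C₂ * 1)) := by ring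
    _ ≤ R * (2 * C₁ * W ^ κ + C₂ * D ^ κ * W ^ κ + (C₂ * J + 2 * C₂ * W ^ κ)) := by gcongr
    _ = R * ((2 * C₁ + C₂ * D ^ κ + 2 * C₂) * W ^ κ + C₂ * J) := by ring
    _ ≤ R * ((X + (2 * C₁ + C₂ * D ^ κ + 3 * C₂)) * W ^ κ +
        (X + (2 * C₁ + C₂ * D ^ κ + 3 * C₂)) * J) := by
        have : 0 < C₂ * D ^ κ := by positivity
        have hW0 : 0 ≤ W ^ κ := by linarith
        exact mul_le_mul_of_nonneg_left (add_le_add (mul_le_mul_of_nonneg_right (by linarith) hW0)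
          (mul_le_mul_of_nonneg_right (by linarith) hJ0)) hR0.le
    _ = _ := by ring

end Main

end HalaszShort

theorem halasz_short_intervals (κ : ℝ) (hκ : 0 < κ) :
    ∃ C : ℝ, 0 < C ∧ ∀ f Λf : ℕ → ℂ, IsHalaszClass κ f Λf →
    ∀ x δ : ℝ, C ≤ x → 0 < δ → δ < 1 / 4 →
    ‖∑ n ∈ Finset.Ioc ⌊x⌋₊ ⌊x + x ^ (1 - δ)⌋₊, f n‖ ≤
      C * (x ^ (1 - δ) / Real.log x) *
        ((∫ σ in (1 / Real.log x)..1,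
            (⨆ t : {t : ℝ // |t| ≤ (1 / 2) * x ^ δ * Real.log x ^ κ},
              ‖Fser f (1 + (σ : ℂ) + ((t : ℝ) : ℂ) * Complex.I)‖) / σ)
          + (δ * Real.log x + Real.log (Real.log x)) ^ κ) := by
  exact HalaszShort.exists_norm_sum_short_le hκ
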